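/- arXiv:1008.2375 — 4 statements merged into one kernel-verified Lean document; each statement's English description precedes it below -/
import Mathlib

section
/- For all n ≥ 1, the number of (1-23-4)-avoiding permutations of {1,...,n} equals the sum over k from 1 to n of u(n,k), where u(n,k) is defined by the recurrence u(n,k) = u(n-1,k-1) + k·Σ_{j=k}^{n-1} u(n-1,j) for 1 ≤ k ≤ n, with initial conditions u(0,0) = 1 and u(n,0) = 0 for n ≥ 1. -/
/-- A permutation `p` of `{1,...,n}` (positions `Fin n`) contains the dashed
pattern 1-23-4: there are positions `a < b`, `b' = b+1`, `c > b'` with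
`p a < p b < p b' < p c`. -/
def Contains1234 {n : ℕ} (p : Equiv.Perm (Fin n)) : Prop :=
  ∃ a b b' c : Fin n, a < b ∧ (b' : ℕ) = (b : ℕ) + 1 ∧ b' < c ∧
    p a < p b ∧ p b < p b' ∧ p b' < p c

namespace P1234
def F : ℕ → ℕ → ℕ → ℕ
  | 0, _, _ => 1
  | m+1, s, f => if f = 0 then ∑ i ∈ Finset.range (s+1), F m (s+1) i
      else ∑ i ∈ Finset.range (f+1), F m (s+1) i + ∑ i ∈ Finset.Ico (f+1) (s+1), F m i i

def G (m s : ℕ) : ℕ := F m s s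

lemma F_zero (m s : ℕ) : F m s 0 = G m s := by
  cases m with
  | zero => rfl
  | succ m =>
    unfold G
    rw [F, F]
    by_cases h : s = 0 <;> simp [h]

lemma F_succ (m s f : ℕ) (hf : f ≠ 0) : F (m+1) s f =
    ∑ i ∈ Finset.range (f+1), F m (s+1) i + ∑ i ∈ Finset.Ico (f+1) (s+1), G m i := by
  rw [F, if_neg hf]; rfl

def VV : ℕ → ℕ → ℕ → ℕ
  | 0, _, _ => 0
  | m+1, s, 0 => G m (s+2)
  | m+1, s, f+1 => VV (m+1) s f + VV m (s+1) (f+1)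

lemma F_step (m : ℕ) : ∀ s f, 1 ≤ f → f ≤ s → F m (s+1) f = F m s f + VV m s f := by
  induction m with
  | zero => intro s f _ _; simp [F, VV]
  | succ m ih =>
    intro s f h1 h2
    have key : ∀ f, f ≤ s + 1 → ∑ i ∈ Finset.range (f+1), F m (s+2) i + G m (s+1)
        = ∑ i ∈ Finset.range (f+1), F m (s+1) i + VV (m+1) s f := by
      intro f
      induction f with
      | zero => intro _; simp [F_zero, VV]; ring
      | succ f ihf =>
        intro h
        rw [Finset.sum_range_succ, Finset.sum_range_succ _ (f+1)]
        have := ihf (by omega)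
        have h3 := ih (s+1) (f+1) (by omega) h
        simp only [VV]
        linarith
    rw [F_succ _ _ _ (by omega), F_succ _ _ _ (by omega)]
    rw [Finset.sum_Ico_succ_top (by omega)]
    have := key f (by omega)
    linarith

lemma G_step (m f : ℕ) : G m (f+1) = G m f + VV m f (f+1) := by
  cases m with
  | zero => simp [G, F, VV]
  | succ m =>
    by_cases h : f = 0
    · subst h
      have h1 := F_step m 1 1 le_rfl le_rfl
      have h2 : G (m+1) 0 = G m 1 := by
        simp [G, F]; exact F_zero m 1
      rw [h2]
      unfold G
      rw [F_succ _ _ _ (by omega)]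
      simp only [VV, Finset.sum_range_succ, F_zero]
      simp [G] at *
      omega
    · have h1 := F_step (m+1) f f (by omega) le_rfl
      have h2 : F m (f+2) (f+1) = F m (f+1) (f+1) + VV m (f+1) (f+1) :=
        F_step m (f+1) (f+1) (by omega) le_rfl
      have h3 : F (m+1) (f+1) (f+1) + G m (f+1) = F (m+1) (f+1) f + F m (f+2) (f+1) := by
        rw [F_succ _ _ _ (by omega), F_succ _ _ _ h]
        rw [Finset.sum_range_succ _ (f+1)]
        simp
        ring
      simp only [VV, G] at *
      omega

lemma G_zero (m : ℕ) : G (m+1) 0 = G m 1 := by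
  simp [G, F]; exact F_zero m 1

lemma VV_closed (m : ℕ) : ∀ s f, VV m s (f+1) =
    ∑ i ∈ Finset.range m, (f+i).choose i * G (m-1-i) (s+2+i) := by
  induction m with
  | zero => intro s f; simp [VV]
  | succ m ih =>
    intro s f
    induction f with
    | zero =>
      rw [VV, VV, ih, Finset.sum_range_succ', add_comm]
      congr 1
      · apply Finset.sum_congr rfl
        intro i hi
        simp
        rw [show m - 1 - i = m - (i+1) by omega, show s+1+2+i = s+2+(i+1) by omega]
      · simp
    | succ f ihf =>
      rw [VV, ihf, ih, Finset.sum_range_succ', Finset.sum_range_succ' _ m, add_right_comm,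
        ← Finset.sum_add_distrib]
      congr 1
      · apply Finset.sum_congr rfl
        intro i hi
        rw [show m - 1 - i = m + 1 - 1 - (i+1) by omega, show s+1+2+i = s+2+(i+1) by omega,
          ← add_mul, show f+1+(i+1) = (f+1+i)+1 by omega, Nat.choose_succ_succ,
          show f + (i+1) = f+1+i by omega, add_comm ((f+1+i).choose i)]
      · simp

lemma stir (N : ℕ) : ∀ J, ∑ i ∈ Finset.range (N+1), N.choose i * Nat.stirlingSecond i J
    = Nat.stirlingSecond (N+1) (J+1) := by
  induction N with
  | zero => intro J; cases J <;> simp [Nat.stirlingSecond]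
  | succ N ih =>
    intro J
    have e : ∑ i ∈ Finset.range (N+1+1), (N+1).choose i * Nat.stirlingSecond i J
      = ∑ i ∈ Finset.range (N+1), N.choose i * Nat.stirlingSecond i J
        + ∑ i ∈ Finset.range (N+1), N.choose i * Nat.stirlingSecond (i+1) J := by
      rw [Finset.sum_range_succ', Finset.sum_congr rfl (fun i _ => by
        rw [Nat.choose_succ_succ, add_mul]), Finset.sum_add_distrib]
      have := Finset.sum_range_succ' (fun i => N.choose i * Nat.stirlingSecond i J) (N+1)
      rw [Finset.sum_range_succ] at this
      simp at this ⊢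
      omega
    rw [e, ih]
    cases J with
    | zero => simp [Nat.stirlingSecond]
    | succ J =>
      simp only [Nat.stirlingSecond_succ_succ (k := J), mul_add, Finset.sum_add_distrib]
      rw [ih J]
      have : ∑ x ∈ Finset.range (N + 1), N.choose x * ((J + 1) * Nat.stirlingSecond x (J + 1))
        = (J+1) * ∑ x ∈ Finset.range (N + 1), N.choose x * (Nat.stirlingSecond x (J + 1)) := by
        rw [Finset.mul_sum]; apply Finset.sum_congr rfl; intros; ring
      rw [this, ih, Nat.stirlingSecond_succ_succ (N+1) (J+1)]
      ring

lemma stir2 (J M : ℕ) : ∑ m ∈ Finset.range (M+1),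
    Nat.stirlingSecond (J+m) J * (J+M).choose (M-m) = Nat.stirlingSecond (J+1+M) (J+1) := by
  rw [show J+1+M = (J+M)+1 by omega, ← stir, show J+M+1 = J+(M+1) by omega,
    Finset.sum_range_add _ J]
  rw [Finset.sum_eq_zero (s := Finset.range J), zero_add]
  · apply Finset.sum_congr rfl
    intro i hi
    simp at hi
    rw [mul_comm]; congr 1
    rw [← Nat.choose_symm (by omega)]; congr 1; omega
  · intro i hi
    simp at hi
    simp [Nat.stirlingSecond_eq_zero_of_lt hi]

def H (n J : ℕ) : ℕ := ∑ m ∈ Finset.range (n+1), Nat.stirlingSecond (J+m) J * G (n-m) (J+1+m)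

lemma H_zero (n : ℕ) : H n 0 = G n 1 := by
  rw [H, Finset.sum_range_succ']
  simp [Nat.stirlingSecond]

lemma H_zero' (J : ℕ) : H 0 J = 1 := by
  simp [H, G, F, Nat.stirlingSecond_self]

lemma K1 (n J : ℕ) : H (n+1) J = H n (J+1) +
    ∑ m ∈ Finset.range (n+2), Nat.stirlingSecond (J+m) J * G (n+1-m) (J+m) := by
  have h1 : H n (J+1) = ∑ m ∈ Finset.range (n+2), Nat.stirlingSecond (J+m) J *
      VV (n+1-m) (J+m) (J+m+1) := by
    rw [Finset.sum_range_succ]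
    simp only [VV_closed, Nat.sub_self, Finset.range_zero, Finset.sum_empty, mul_zero, add_zero,
      Finset.mul_sum]
    have := Finset.sum_range_diag_flip (n+1) (fun m i => Nat.stirlingSecond (J+m) J *
      ((J+m+i).choose i * G (n+1-m-1-i) (J+m+2+i)))
    rw [← this, H]
    apply Finset.sum_congr rfl
    intro M hM
    simp at hM
    rw [← stir2, Finset.sum_mul]
    apply Finset.sum_congr rfl
    intro m hm
    simp at hm
    rw [mul_assoc]; congr 2
    · congr 1; omega
    · congr 1 <;> omega
  rw [h1, ← Finset.sum_add_distrib, H]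
  apply Finset.sum_congr rfl
  intro m hm
  rw [← mul_add, show J+1+m = J+m+1 by omega, G_step, add_comm (G _ _)]

lemma K2 (n J : ℕ) : H (n+1) (J+1) = H n (J+2) + H (n+1) J + (J+1) * H n (J+1) := by
  rw [K1, add_assoc (H n (J+2))]
  congr 1
  rw [Finset.sum_range_succ', H, Finset.sum_range_succ' _ (n+1), H, Finset.mul_sum,
    add_right_comm (Finset.sum _ _), ← Finset.sum_add_distrib]
  congr 1
  · apply Finset.sum_congr rfl
    intro m hm
    rw [show J+1+(m+1) = (J+m+1)+1 by omega, Nat.stirlingSecond_succ_succ,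
      show n+1-(m+1) = n-m by omega, show J+1+m = J+m+1 by omega,
      show J + (m+1) = J+m+1 by omega, show J+1+1+m = J+m+1+1 by omega]
    ring
  · simp [Nat.stirlingSecond_self]

lemma H_rec (n J : ℕ) : H (n+1) J = H n (J+1) + ∑ k ∈ Finset.range (J+1), (k+1) * H n k := by
  induction J with
  | zero =>
    rw [K1, Finset.sum_range_succ']
    simp [Nat.stirlingSecond, H_zero, G_zero]
  | succ J ih =>
    rw [K2, ih, Finset.sum_range_succ _ (J+1)]
    ring

end P1234

namespace P1234

def pre {n : ℕ} (v : Fin (n+1)) (p : Equiv.Perm (Fin n)) : Equiv.Perm (Fin (n+1)) :=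
  ((finSuccEquiv' 0).trans (Equiv.optionCongr p)).trans (finSuccEquiv' v).symm

@[simp] lemma pre_zero {n : ℕ} (v : Fin (n+1)) (p : Equiv.Perm (Fin n)) : pre v p 0 = v := by
  simp [pre]

@[simp] lemma pre_succ {n : ℕ} (v : Fin (n+1)) (p : Equiv.Perm (Fin n)) (i : Fin n) :
    pre v p i.succ = v.succAbove (p i) := by
  have : (finSuccEquiv' (0 : Fin (n+1))) i.succ = some i := by
    rw [← Fin.succAbove_zero_apply, finSuccEquiv'_succAbove]
  simp [pre, this]

lemma pre_bij (n : ℕ) : Function.Bijective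
    (fun x : Equiv.Perm (Fin n) × Fin (n+1) => pre x.2 x.1) := by
  rw [Fintype.bijective_iff_injective_and_card]
  constructor
  · rintro ⟨p, v⟩ ⟨q, w⟩ h
    simp only at h
    have h0 : v = w := by simpa using congrArg (fun e => e 0) h
    subst h0
    congr 1
    ext i
    have := congrArg (fun e => e i.succ) h
    simp at this
    rw [this]
  · simp [Fintype.card_perm, Nat.factorial_succ, mul_comm]

def Allowed {n : ℕ} (p : Equiv.Perm (Fin n)) (v : ℕ) : Prop :=
  ∀ b b' c : Fin n, (b' : ℕ) = (b : ℕ) + 1 → b' < c → p b < p b' → p b' < p c → (p b : ℕ) < v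

lemma contains_pre {n : ℕ} (v : Fin (n+1)) (p : Equiv.Perm (Fin n)) :
    Contains1234 (pre v p) ↔ Contains1234 p ∨ ¬ Allowed p v := by
  constructor
  · rintro ⟨a, b, b', c, hab, hb, hc, h1, h2, h3⟩
    obtain ⟨b, rfl⟩ := Fin.exists_succ_eq.2 (Fin.ne_zero_of_lt hab)
    obtain ⟨c, rfl⟩ := Fin.exists_succ_eq.2 (Fin.ne_zero_of_lt hc)
    have hb0 : b' ≠ 0 := by rintro rfl; simp at hb
    obtain ⟨b', rfl⟩ := Fin.exists_succ_eq.2 hb0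
    simp only [pre_succ, Fin.succAbove_lt_succAbove_iff, Fin.succ_lt_succ_iff, Fin.val_succ,
      add_left_inj] at *
    rcases Fin.eq_zero_or_eq_succ a with rfl | ⟨a, rfl⟩
    · right
      intro h
      have := h b b' c hb hc h2 h3
      rw [pre_zero, Fin.lt_succAbove_iff_le_castSucc, Fin.le_def] at h1
      simp at h1
      omega
    · left
      simp only [pre_succ, Fin.succAbove_lt_succAbove_iff, Fin.succ_lt_succ_iff] at *
      exact ⟨a, b, b', c, hab, hb, hc, h1, h2, h3⟩
  · rintro (⟨a, b, b', c, hab, hb, hc, h1, h2, h3⟩ | h)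
    · exact ⟨a.succ, b.succ, b'.succ, c.succ, by simpa, by simpa, by simpa, by simpa, by simpa,
        by simpa⟩
    · simp only [Allowed] at h
      push Not at h
      obtain ⟨b, b', c, hb, hc, h2, h3, h4⟩ := h
      refine ⟨0, b.succ, b'.succ, c.succ, by simp, by simpa, by simpa, ?_, by simpa, by simpa⟩
      rw [pre_zero, pre_succ, Fin.lt_succAbove_iff_le_castSucc, Fin.le_def]
      simpa

lemma allowed_pre {n : ℕ} (v : Fin (n+2)) (p : Equiv.Perm (Fin (n+1))) (h : Allowed p v) (w : ℕ) :
    Allowed (pre v p) w ↔ (((v : ℕ) ≤ p 0 ∧ (p 0 : ℕ) ≠ n) → (v : ℕ) < w) ∧ Allowed p w := by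
  have val : ∀ b, (p b : ℕ) < v → ((v.succAbove (p b) : Fin (n+2)) : ℕ) = p b := by
    intro b hb
    rw [Fin.succAbove_of_castSucc_lt _ _ (by rw [Fin.lt_def]; simpa)]
    simp
  constructor
  · intro hq
    constructor
    · rintro ⟨h1, h2⟩
      obtain ⟨c, hc⟩ := p.surjective (Fin.last n)
      have hc0 : c ≠ 0 := by rintro rfl; rw [hc] at h2; simp at h2
      have := hq 0 (Fin.succ 0) c.succ (by simp) (Fin.succ_lt_succ_iff.2 (Fin.pos_of_ne_zero hc0))
        (by rw [pre_zero, pre_succ, Fin.lt_succAbove_iff_le_castSucc, Fin.le_def]; simpa)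
        (by simp only [pre_succ, Fin.succAbove_lt_succAbove_iff]
            rw [hc, Fin.lt_def]; simp; have := (p 0).isLt; omega)
      simpa using this
    · intro b b' c hb hc h1 h2
      have h3 := hq b.succ b'.succ c.succ (by simpa) (by simpa) (by simpa) (by simpa)
      rwa [pre_succ, val b (h b b' c hb hc h1 h2)] at h3
  · rintro ⟨h1, h2⟩ b b' c hb hc h3 h4
    obtain ⟨c, rfl⟩ := Fin.exists_succ_eq.2 (Fin.ne_zero_of_lt hc)
    have hb0 : b' ≠ 0 := by rintro rfl; simp at hb
    obtain ⟨b', rfl⟩ := Fin.exists_succ_eq.2 hb0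
    rcases Fin.eq_zero_or_eq_succ b with rfl | ⟨b, rfl⟩
    · have hb' : b' = 0 := by ext; simpa using hb
      subst hb'
      rw [pre_zero, pre_succ, Fin.lt_succAbove_iff_le_castSucc, Fin.le_def] at h3
      rw [pre_succ, pre_succ, Fin.succAbove_lt_succAbove_iff, Fin.lt_def] at h4
      rw [pre_zero]
      apply h1
      refine ⟨by simpa using h3, ?_⟩
      have := (p c).isLt
      omega
    · simp only [pre_succ, Fin.succAbove_lt_succAbove_iff, Fin.succ_lt_succ_iff, Fin.val_succ,
        add_left_inj] at *
      rw [val b (h b b' c hb hc h3 h4)]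
      exact h2 b b' c hb hc h3 h4

open Classical in
noncomputable def D : (m n : ℕ) → Equiv.Perm (Fin n) → ℕ
  | 0, _, p => if Contains1234 p then 0 else 1
  | m+1, n, p => ∑ v : Fin (n+1), D m (n+1) (pre v p)

lemma D_contains (m : ℕ) : ∀ (n : ℕ) (p : Equiv.Perm (Fin n)), Contains1234 p → D m n p = 0 := by
  induction m with
  | zero => intro n p h; simp [D, h]
  | succ m ih =>
    intro n p h
    rw [D]
    exact Finset.sum_eq_zero fun v _ => ih _ _ ((contains_pre v p).2 (Or.inl h))

lemma D_total (m : ℕ) : ∀ n k, k = n + m →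
    ∑ p : Equiv.Perm (Fin k), D 0 k p = ∑ p : Equiv.Perm (Fin n), D m n p := by
  induction m with
  | zero => rintro n k rfl; rfl
  | succ m ih =>
    intro n k h
    rw [ih (n+1) k (by omega), ← (pre_bij n).sum_comp, Fintype.sum_prod_type]
    rfl

structure St {n : ℕ} (p : Equiv.Perm (Fin (n+1))) (s f : ℕ) : Prop where
  av : ¬ Contains1234 p
  hf : f + p 0 = n
  hs : s ≤ n + 1
  hfs : f ≤ s
  al : ∀ v : ℕ, Allowed p v ↔ n + 1 ≤ v + s

lemma St_pre {n : ℕ} {p : Equiv.Perm (Fin (n+1))} {s f : ℕ} (h : St p s f) (i : Fin (n+2))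
    (hi : (i : ℕ) ≤ s) :
    St (pre i.rev p) (if f = 0 ∨ (i : ℕ) ≤ f then s + 1 else i) i := by
  have hv : ((i.rev : Fin (n+2)) : ℕ) + i = n + 1 := by
    rw [Fin.val_rev]; have := i.isLt; omega
  have ha : Allowed p (i.rev : Fin (n+2)) := (h.al _).2 (by omega)
  have h1 := h.hf
  have h2 := h.hs
  have h3 := h.hfs
  refine ⟨?_, ?_, ?_, ?_, ?_⟩
  · rw [contains_pre]; exact not_or.2 ⟨h.av, not_not.2 ha⟩
  · rw [pre_zero]; omega
  · split_ifs <;> omega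
  · split_ifs <;> omega
  · intro w
    rw [allowed_pre _ _ ha, h.al]
    split_ifs with hc
    · constructor
      · intro h; omega
      · intro h; refine ⟨?_, by omega⟩
        rintro ⟨h5, h6⟩
        omega
    · constructor
      · rintro ⟨h5, h6⟩; have := h5 ⟨by omega, by omega⟩; omega
      · intro h5; exact ⟨fun _ => by omega, by omega⟩

lemma D_eq (m : ℕ) : ∀ (n : ℕ) (p : Equiv.Perm (Fin (n+1))) (s f : ℕ), St p s f →
    D m (n+1) p = F m s f := by
  induction m with
  | zero => intro n p s f h; simp [D, F, h.av]
  | succ m ih =>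
    intro n p s f h
    have h2 := h.hs
    have h3 := h.hfs
    rw [D, ← Equiv.sum_comp Fin.revPerm]
    have e : ∀ i : Fin (n+2), D m (n+2) (pre (Fin.revPerm i) p) =
      (fun i : ℕ => if i ≤ s then F m (if f = 0 ∨ i ≤ f then s + 1 else i) i else 0) i := by
      intro i
      simp only [Fin.revPerm_apply]
      split_ifs with h4 h5
      · have := St_pre h i h4
        rw [if_pos h5] at this
        exact ih _ _ _ _ this
      · have := St_pre h i h4
        rw [if_neg h5] at this
        exact ih _ _ _ _ this
      · apply D_contains
        rw [contains_pre, h.al, Fin.val_rev]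
        right
        omega
    rw [Finset.sum_congr rfl (fun i _ => e i), Fin.sum_univ_eq_sum_range (n := n+2)
      (fun i : ℕ => if i ≤ s then F m (if f = 0 ∨ i ≤ f then s + 1 else i) i else 0)]
    rw [← Finset.sum_subset (s₁ := Finset.range (s+1))]
    · rw [F]
      split_ifs with h0
      · apply Finset.sum_congr rfl
        intro i hi
        simp at hi
        rw [if_pos (by omega), if_pos (Or.inl h0)]
      · rw [← Finset.sum_range_add_sum_Ico _ (show f+1 ≤ s+1 by omega)]
        congr 1
        · apply Finset.sum_congr rfl
          intro i hi
          simp at hi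
          rw [if_pos (by omega), if_pos (by omega)]
        · apply Finset.sum_congr rfl
          intro i hi
          simp at hi
          rw [if_pos (by omega), if_neg (by omega)]
    · intro i; simp; omega
    · intro i _ hi; simp at hi; rw [if_neg (by omega)]

lemma count (m : ℕ) : Nat.card {p : Equiv.Perm (Fin (m+1)) // ¬ Contains1234 p} = H m 0 := by
  classical
  rw [H_zero, ← F_zero, Nat.card_eq_fintype_card, Fintype.card_subtype, Finset.card_filter]
  have h := D_total m 1 (m+1) (by omega)
  have hst : St (1 : Equiv.Perm (Fin 1)) 1 0 := by
    refine ⟨?_, by simp, le_rfl, by simp, ?_⟩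
    · rintro ⟨a, b, b', c, hab, _⟩; omega
    · intro v
      constructor
      · intro _; omega
      · intro _ b b' c hb; omega
  rw [Fintype.sum_unique (fun p : Equiv.Perm (Fin 1) => D m 1 p), Subsingleton.elim (default : Equiv.Perm (Fin 1)) 1,
    D_eq m 0 1 1 0 hst] at h
  rw [← h]
  apply Finset.sum_congr rfl
  intro p _
  simp [D]

end P1234

theorem stmt0 (u : ℕ → ℕ → ℕ) (hu0 : u 0 0 = 1)
    (hu1 : ∀ n : ℕ, 1 ≤ n → u n 0 = 0)
    (hrec : ∀ n k : ℕ, 1 ≤ k → k ≤ n →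
      u n k = u (n - 1) (k - 1) + k * ∑ j ∈ Finset.Icc k (n - 1), u (n - 1) j)
    (n : ℕ) (hn : 1 ≤ n) :
    Nat.card {p : Equiv.Perm (Fin n) // ¬ Contains1234 p}
      = ∑ k ∈ Finset.Icc 1 n, u n k := by
  obtain ⟨n, rfl⟩ : ∃ m, n = m + 1 := ⟨n - 1, by omega⟩
  rw [P1234.count]
  have key : ∀ m r, ∑ k ∈ Finset.range (m+1), u (m+1) (k+1) * P1234.H r k = P1234.H (m+r) 0 := by
    intro m
    induction m with
    | zero =>
      intro r
      simp [hrec 1 1 le_rfl le_rfl, hu0]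
    | succ m ih =>
      intro r
      rw [show m + 1 + r = m + (r+1) by omega, ← ih (r+1)]
      have e1 : ∀ k ∈ Finset.range (m+1+1), u (m+1+1) (k+1) * P1234.H r k =
          u (m+1) k * P1234.H r k + ∑ j ∈ Finset.Ico k (m+1),
            u (m+1) (j+1) * ((k+1) * P1234.H r k) := by
        intro k hk
        simp at hk
        rw [hrec (m+1+1) (k+1) (by omega) (by omega)]
        simp only [Nat.add_sub_cancel]
        rw [← Finset.sum_mul]
        have : ∑ j ∈ Finset.Icc (k+1) (m+1), u (m+1) j = ∑ j ∈ Finset.Ico k (m+1), u (m+1) (j+1) := by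
          rw [Finset.sum_Ico_add' (fun j => u (m+1) j) k (m+1) 1]
          rfl
        rw [this]; ring
      rw [Finset.sum_congr rfl e1, Finset.sum_add_distrib, Finset.sum_range_succ',
        hu1 (m+1) (by omega)]
      simp only [P1234.H_rec r, mul_add, Finset.sum_add_distrib, Finset.mul_sum]
      rw [zero_mul, add_zero]
      congr 1
      rw [Finset.sum_sigma', Finset.sum_sigma']
      apply Finset.sum_bij' (fun x _ => ⟨x.2, x.1⟩) (fun x _ => ⟨x.2, x.1⟩)
      all_goals simp
      all_goals omega
  have := key n 0
  simp only [P1234.H_zero', mul_one, add_zero] at this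
  rw [← this, Finset.range_eq_Ico, Finset.sum_Ico_add' (fun j => u (n+1) j) 0 (n+1) 1]
  rfl
end

section
/- For all n ≥ 1, the number of (1-23-4)-avoiding permutations of {1,...,n} equals the number of valley-marked Dyck paths of semilength n. -/
/-- A Dyck path of semilength `n`, encoded as a list of booleans where `true`
is an up-step `U = (1,1)` and `false` is a down-step `D = (1,-1)`: it has `2n`
steps, never goes below the x-axis, and ends on the x-axis. -/
def IsDyckPath (n : ℕ) (p : List Bool) : Prop :=
  p.length = 2 * n ∧
    (∀ i : ℕ, (p.take i).count false ≤ (p.take i).count true) ∧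
    p.count false = p.count true

/-- The height of the lattice point reached after the first `j` steps. -/
def pathHeight (p : List Bool) (j : ℕ) : ℕ :=
  (p.take j).count true - (p.take j).count false

/-- There is a valley (a `D` step immediately followed by a `U` step) at
position `i`; its valley vertex is the point reached after `i+1` steps. -/
def IsValley (p : List Bool) (i : ℕ) : Prop :=
  p[i]? = some false ∧ p[i + 1]? = some true

/-- A valley-marking of the path `p`: for each valley, a choice of one of the
lattice points between the valley vertex and the x-axis inclusive, i.e. an
integer mark `m` with `0 ≤ m ≤` the height of the valley vertex (and, for
bookkeeping, the mark is `0` at non-valley positions). -/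
def IsValleyMarking (p : List Bool) (m : ℕ → ℕ) : Prop :=
  ∀ i : ℕ, (IsValley p i → m i ≤ pathHeight p (i + 1)) ∧
    (¬ IsValley p i → m i = 0)

/-- The length of the first ascent: the initial maximal run of `U` steps. -/
def firstAscentLength (p : List Bool) : ℕ :=
  (p.takeWhile id).length

set_option linter.all false
set_option linter.unusedSimpArgs false
set_option linter.unusedTactic false
namespace V

/-- perm side counting function -/
def f : ℕ → ℕ → ℕ → ℕ
  | 0, _, _ => 1
  | m+1, l, th => ∑ r ∈ Finset.range th, if 0 < l ∧ l < r then f m r (r+1) else f m r (th+1)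

/-- path side counting function -/
def h : ℕ → ℕ → ℕ
  | 0, _ => 1
  | m+1, g => h m (g+1) + ∑ i ∈ Finset.range (g+1), (i+1) * h m i

/-- moments -/
def e : ℕ → ℕ → ℤ
  | 0, 0 => 1
  | 0, j+1 => ∑ i : Fin (j+1), (j.choose i : ℤ) * e 0 i
  | m+1, 0 => e m 0 + e m 1
  | m+1, j+1 => (∑ i : Fin (j+1), (j.choose i : ℤ) * e (m+1) i) + e m (j+2)
termination_by m j => (m, j)

open Polynomial in
noncomputable def lam (m : ℕ) : ℤ[X] →ₗ[ℤ] ℤ :=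
  (Polynomial.basisMonomials ℤ).constr ℤ (fun j => e m j)

open Polynomial in
lemma lam_X (m j : ℕ) : lam m (X^j) = e m j := by
  have := (Polynomial.basisMonomials ℤ).constr_basis ℤ (fun j => e m j) j
  simp only [Polynomial.coe_basisMonomials, Polynomial.monomial_one_right_eq_X_pow] at this
  exact this

open Polynomial in
noncomputable def sg : ℤ[X] →+* ℤ[X] := Polynomial.compRingHom (X + 1)

open Polynomial in
lemma lam_shift_mono (m j : ℕ) : lam m (sg (X^j)) = ∑ i : Fin (j+1), (j.choose i : ℤ) * e m i := by
  simp only [sg, map_pow, coe_compRingHom_apply, X_comp]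
  rw [add_pow, map_sum, Finset.sum_range]
  refine Finset.sum_congr rfl fun i _ => ?_
  rw [one_pow, mul_one, mul_comm, ← Int.cast_natCast, ← Polynomial.C_eq_intCast, ← Polynomial.smul_eq_C_mul,
    map_smul, lam_X, smul_eq_mul]
  simp

open Polynomial in
lemma lam_zero_X (p : ℤ[X]) : lam 0 (X * p) = lam 0 (sg p) := by
  induction p using Polynomial.induction_on' with
  | add p q hp hq => rw [mul_add, map_add, hp, hq, map_add, map_add]
  | monomial n a =>
    rw [← Polynomial.C_mul_X_pow_eq_monomial, mul_left_comm, ← pow_succ', ← smul_eq_C_mul, map_smul, lam_X,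
      map_mul, show sg (C a) = C a by simp [sg], ← smul_eq_C_mul, map_smul, lam_shift_mono, e]

open Polynomial in
lemma lam_succ_X (m : ℕ) (p : ℤ[X]) : lam (m+1) (X * p) = lam (m+1) (sg p) + lam m (X^2 * p) := by
  induction p using Polynomial.induction_on' with
  | add p q hp hq => rw [mul_add, map_add, hp, hq, map_add, map_add, mul_add, map_add]; ring
  | monomial n a =>
    rw [← Polynomial.C_mul_X_pow_eq_monomial, mul_left_comm, ← pow_succ', ← smul_eq_C_mul, map_smul, lam_X,
      map_mul, show sg (C a) = C a by simp [sg], ← smul_eq_C_mul, map_smul, lam_shift_mono, e,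
      mul_left_comm, ← smul_eq_C_mul, map_smul, ← pow_add, add_comm 2 n, lam_X, smul_add]

lemma lam_zero_one : lam 0 1 = 1 := by
  have := lam_X 0 0
  rw [pow_zero] at this; rw [this, e]

open Polynomial in
lemma lam_succ_one (m : ℕ) : lam (m+1) 1 = lam m 1 + lam m X := by
  have h1 := lam_X (m+1) 0
  have h2 := lam_X m 0
  have h3 := lam_X m 1
  rw [pow_zero] at h1 h2; rw [pow_one] at h3
  rw [h1, h2, h3, e]

-- path side
open Polynomial in
lemma lam_desc_zero (l : ℕ) : lam 0 (descPochhammer ℤ l) = 1 := by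
  induction l with
  | zero => simpa using lam_zero_one
  | succ l ih =>
    rw [descPochhammer_succ_left, lam_zero_X, ← ih]
    congr 1
    simp [sg, Polynomial.comp_assoc]

open Polynomial in
lemma lam_desc_succ (m l : ℕ) : lam (m+1) (descPochhammer ℤ (l+1)) =
    lam (m+1) (descPochhammer ℤ l) + lam m (descPochhammer ℤ (l+2)) + (l+1) * lam m (descPochhammer ℤ (l+1)) := by
  have h1 : X^2 * (descPochhammer ℤ l).comp (X-1) = descPochhammer ℤ (l+2) + ((l+1 : ℕ):ℤ) • descPochhammer ℤ (l+1) := by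
    rw [descPochhammer_succ_right ℤ (l+1), smul_eq_C_mul]
    rw [pow_two, mul_assoc, ← descPochhammer_succ_left]
    push_cast
    simp
    ring
  conv_lhs => rw [descPochhammer_succ_left, lam_succ_X, h1, map_add, map_smul]
  rw [show sg ((descPochhammer ℤ l).comp (X-1)) = descPochhammer ℤ l by simp [sg, Polynomial.comp_assoc]]
  push_cast
  simp only [smul_eq_mul]
  push_cast
  ring

lemma h_eq (m : ℕ) : ∀ g, (h m g : ℤ) = lam m (descPochhammer ℤ g) := by
  induction m with
  | zero => intro g; rw [lam_desc_zero, h]; rfl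
  | succ m ih =>
    intro g
    induction g with
    | zero =>
      rw [descPochhammer_zero, lam_succ_one]
      have h0 := ih 0
      have h1 := ih 1
      rw [descPochhammer_zero] at h0; rw [descPochhammer_one] at h1
      rw [← h0, ← h1, h]; simp; ring
    | succ g ihg =>
      rw [lam_desc_succ, ← ihg, ← ih, ← ih, h, h, Finset.sum_range_succ _ (g+1)]
      push_cast; ring

/- power series -/
open Polynomial in
noncomputable def Lam (φ : PowerSeries ℤ[X]) : PowerSeries ℤ :=
  PowerSeries.mk fun m => ∑ ab ∈ Finset.HasAntidiagonal.antidiagonal m, lam ab.1 (PowerSeries.coeff ab.2 φ)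

lemma Lam_add (a b) : Lam (a + b) = Lam a + Lam b := by
  ext m; simp [Lam, Finset.sum_add_distrib]

lemma Lam_sub (a b) : Lam (a - b) = Lam a - Lam b := by
  ext m; simp [Lam, Finset.sum_sub_distrib]

lemma Lam_X (a) : Lam (PowerSeries.X * a) = PowerSeries.X * Lam a := by
  ext m
  cases m with
  | zero => simp [Lam]
  | succ m =>
    rw [PowerSeries.coeff_succ_X_mul]
    simp [Lam, Finset.Nat.antidiagonal_succ', PowerSeries.coeff_succ_X_mul]

noncomputable def K : PowerSeries (Polynomial ℤ) := PowerSeries.C Polynomial.X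
noncomputable def sig : PowerSeries (Polynomial ℤ) →+* PowerSeries (Polynomial ℤ) := PowerSeries.map sg

lemma Lam_K (φ) : Lam (K * φ) = Lam (sig φ) + PowerSeries.X * Lam (K^2 * φ) := by
  ext m
  cases m with
  | zero => simp [Lam, K, sig, lam_zero_X]
  | succ m =>
    rw [map_add, PowerSeries.coeff_succ_X_mul]
    simp only [Lam, PowerSeries.coeff_mk, Finset.Nat.antidiagonal_succ, Finset.sum_cons, Finset.sum_map,
      K, sig, PowerSeries.coeff_C_mul, PowerSeries.coeff_map, lam_zero_X, ← map_pow]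
    simp [lam_succ_X, Finset.sum_add_distrib, add_assoc]

lemma coeff_Lam_C : ∀ (p : Polynomial ℤ) m, PowerSeries.coeff m (Lam (PowerSeries.C p)) = lam m p := by
  intro p m
  simp only [Lam, PowerSeries.coeff_mk, PowerSeries.coeff_C]
  rw [Finset.sum_eq_single (m, 0)]
  · simp
  · rintro ⟨a, b⟩ hab hne
    rw [if_neg, map_zero]
    rintro h0
    apply hne
    simp only [Finset.mem_antidiagonal] at hab h0 
    subst h0; simp at hab; simp [hab]
  · simp

lemma Lam_one : Lam 1 = 1 + PowerSeries.X * (Lam 1 + Lam K) := by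
  ext m
  have k1 : ∀ m, PowerSeries.coeff m (Lam 1) = lam m 1 := by
    intro m; rw [← coeff_Lam_C 1 m, map_one]
  cases m with
  | zero => rw [k1, lam_zero_one]; simp
  | succ m =>
    rw [map_add, PowerSeries.coeff_succ_X_mul, map_add, k1, k1, K, coeff_Lam_C, lam_succ_one]
    simp [PowerSeries.coeff_one]

end V

namespace V

local notation "x" => (PowerSeries.X : PowerSeries (Polynomial ℤ))

noncomputable def s : PowerSeries (Polynomial ℤ) := 1 - x * K
noncomputable def t : PowerSeries (Polynomial ℤ) := 1 - x * (K + 1)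
noncomputable def u : PowerSeries (Polynomial ℤ) := PowerSeries.invOfUnit s 1
noncomputable def v : PowerSeries (Polynomial ℤ) := sig u
noncomputable def w : PowerSeries (Polynomial ℤ) := PowerSeries.invOfUnit (1 - x) 1

lemma su : s * u = 1 := PowerSeries.mul_invOfUnit _ _ (by simp [s])
lemma sig_s : sig s = t := by
  simp [sig, s, t, K, sg]
lemma tv : t * v = 1 := by rw [← sig_s, v, ← map_mul, su, map_one]
lemma xw : (1 - x) * w = 1 := PowerSeries.mul_invOfUnit _ _ (by simp)
lemma K_ne : K ≠ 0 := by
  intro h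
  have := congrArg (PowerSeries.coeff 0) h
  simp [K] at this

lemma Lam_Ks (φ) : Lam (K * s * φ) = Lam (sig φ) := by
  have : K * s * φ = K * φ - x * (K^2 * φ) := by rw [s]; ring
  rw [this, Lam_sub, Lam_X, Lam_K]; ring

lemma Lam_t : Lam t = 1 := by
  have : t = 1 - x * K - x * 1 := by rw [t]; ring
  rw [this, Lam_sub, Lam_sub, Lam_X, Lam_X]
  linear_combination Lam_one

lemma D_ex (l θ : ℕ) : K ∣ u^θ * s * (s * v)^l - s * w^l := by
  rw [← Ideal.mem_span_singleton]
  set I := Ideal.span {K}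
  rw [← Ideal.Quotient.eq]
  have hK : Ideal.Quotient.mk I K = 0 := Ideal.Quotient.eq_zero_iff_mem.2 (Ideal.mem_span_singleton_self K)
  have hs : Ideal.Quotient.mk I s = 1 := by simp [s, hK]
  have hu : Ideal.Quotient.mk I u = 1 := by
    have := congrArg (Ideal.Quotient.mk I) su
    simpa [hs] using this
  have hv : Ideal.Quotient.mk I v = Ideal.Quotient.mk I w := by
    have h1 := congrArg (Ideal.Quotient.mk I) tv
    have h2 := congrArg (Ideal.Quotient.mk I) xw
    simp [t, hK] at h1 h2
    linear_combination (Ideal.Quotient.mk I w) * h1 - (Ideal.Quotient.mk I v) * h2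
  simp [hs, hu, hv]

noncomputable def D (l θ : ℕ) := (D_ex l θ).choose
lemma D_spec (l θ : ℕ) : K * D l θ = u^θ * s * (s * v)^l - s * w^l := (D_ex l θ).choose_spec.symm

noncomputable def Z (l θ : ℕ) := t * w^l + D l θ

lemma st : s - x = t := by rw [s, t]; ring

lemma Z_succ (l θ : ℕ) : Z (l+1) θ = Z l θ + x * Z (l+1) (θ+1) := by
  apply mul_left_cancel₀ K_ne
  have h1 := D_spec (l+1) θ
  have h2 := D_spec l θ
  have h3 := D_spec (l+1) (θ+1)
  rw [Z, Z, Z]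
  have e1 : K * (t * w^(l+1) + D (l+1) θ) - K * (t * w^l + D l θ + x * (t * w^(l+1) + D (l+1) (θ+1)))
    = K * t * w^l * ((1-x)*w - 1) + (u^θ * s * (s*v)^l) * (s * v - 1 - x * u * (s * v)) - s * w^l * ((1-x) * w - 1) := by
    linear_combination h1 - h2 - x * h3
  have e2 : s * v - 1 - x * u * (s * v) = 0 := by
    linear_combination v * st + tv - x * v * su
  rw [xw, e2] at e1
  linear_combination e1

lemma Z_zero_succ (θ : ℕ) : Z 0 (θ+1) = Z 0 θ + x * u^θ := by
  apply mul_left_cancel₀ K_ne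
  have h1 := D_spec 0 (θ+1)
  have h2 := D_spec 0 θ
  have hs : s = 1 - x * K := rfl
  rw [Z, Z]
  linear_combination h1 - h2 + u^θ * su - u^θ * hs

lemma Z_zero_zero : Z 0 0 = t := by
  apply mul_left_cancel₀ K_ne
  have h2 := D_spec 0 0
  rw [Z]; linear_combination h2

lemma Z_diag (l : ℕ) : (1 - x) * Z (l+1) (l+2) - Z l (l+1) = x * v^(l+1) := by
  apply mul_left_cancel₀ K_ne
  have h1 := D_spec (l+1) (l+2)
  have h2 := D_spec l (l+1)
  have g : ∀ l, u^(l+1) * s * (s*v)^l = v^l := by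
    intro l
    have : u^(l+1) * s * (s*v)^l = (s*u)^(l+1) * v^l := by ring
    rw [this, su]; ring
  rw [g] at h1 h2
  rw [Z, Z]
  have e : (1 - x) * v^(l+1) - v^l = v^(l+1) * x * K := by
    have ht : t = 1 - x * (K+1) := rfl
    linear_combination v^l * tv - v^(l+1) * ht
  linear_combination (1-x) * h1 - h2 + e + (K * t - s) * w^l * xw

noncomputable def c (l : ℕ) := x * ∑ r ∈ Finset.range l, Z (r+1) (r+2)

noncomputable def F : ℕ → ℕ → PowerSeries ℤ
  | 0, θ => Lam (u^(θ-2))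
  | l+1, θ => Lam (Z (l+1) θ - c (l+1))

lemma Lam_v (j) : Lam (v^j) = Lam (K * s * u^j) := by rw [Lam_Ks, map_pow, v]

lemma Lam_xv (j) : Lam (x * v^(j+1)) = Lam (x * K * u^j) := by
  rw [Lam_X, Lam_v, ← Lam_X]; congr 1
  linear_combination x * K * u^j * su

lemma F_diag (l : ℕ) : F (l+1) (l+2) = F 0 (l+2) := by
  induction l with
  | zero =>
    simp only [F, c]
    have h : Z 1 2 - x * ∑ r ∈ Finset.range 1, Z (r+1) (r+2) = t + x + x * v^1 := by
      have h1 := Z_diag 0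
      have h2 := Z_zero_succ 0
      rw [Z_zero_zero] at h2
      simp at h1 h2 ⊢
      linear_combination h1 + h2
    simp only [zero_add] at h ⊢
    rw [h, Lam_add, Lam_xv 0, ← Lam_add]
    congr 1
    rw [t]; simp; ring
  | succ l ih =>
    have h1 := Z_diag (l+1)
    have : F (l+1+1) (l+1+2) - F (l+1) (l+2) = Lam (x * v^(l+2)) := by
      simp only [F, ← Lam_sub]
      congr 1
      rw [c, c, Finset.sum_range_succ _ (l+1)]
      linear_combination h1
    rw [ih, Lam_xv] at this
    have h2 : Lam (u^(l+1)) - Lam (u^l) = Lam (x * K * u^(l+1)) := by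
      rw [← Lam_sub]
      congr 1
      have hs : s = 1 - x * K := rfl
      linear_combination u^l * su - u^(l+1) * hs
    simp only [F] at this ⊢
    simp only [show l+1+2-2 = l+1 by omega, show l+2-2 = l by omega] at this ⊢
    linear_combination this - h2

local notation "y" => (PowerSeries.X : PowerSeries ℤ)

lemma Lam_Z0 (θ : ℕ) : Lam (Z 0 θ) = 1 + y * ∑ r ∈ Finset.range θ, F 0 (r+2) := by
  induction θ with
  | zero => rw [Z_zero_zero, Lam_t]; simp
  | succ θ ih => 
    rw [Z_zero_succ, Lam_add, Lam_X, ih, Finset.sum_range_succ]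
    simp only [F, show θ+2-2 = θ by omega]; ring

lemma F_step (l θ : ℕ) : F (l+2) θ = F (l+1) θ + y * (F (l+2) (θ+1) - F (l+2) (l+3)) := by
  rw [mul_sub]
  simp only [F, ← Lam_X, ← Lam_sub, ← Lam_add]
  congr 1
  have := Z_succ (l+1) θ
  rw [c, c, Finset.sum_range_succ _ (l+1)]
  linear_combination this

lemma F_one (θ : ℕ) : F 1 θ = Lam (Z 0 θ) + y * F 1 (θ+1) - y * F 0 2 := by
  rw [← F_diag 0]
  simp only [F, ← Lam_X, ← Lam_sub, ← Lam_add]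
  congr 1
  have := Z_succ 0 θ
  simp [c] at this ⊢
  linear_combination this

lemma F_sum (l θ : ℕ) (h : l + 1 < θ) : F (l+1) θ = 1 + y * ∑ r ∈ Finset.range θ,
    if l+1 < r then F r (r+1) else F r (θ+1) := by
  induction l with
  | zero =>
    rw [F_one, Lam_Z0]
    obtain ⟨θ, rfl⟩ : ∃ k, θ = k + 2 := ⟨θ - 2, by omega⟩
    rw [Finset.sum_range_succ' _ (θ+1), Finset.sum_range_succ _ θ,
      Finset.sum_range_succ' _ (θ+1), Finset.sum_range_succ' _ θ]
    have : ∀ k ∈ Finset.range θ, (if 0 + 1 < k + 1 + 1 then F (k + 1 + 1) (k + 1 + 1 + 1) else F (k + 1 + 1) (θ + 2 + 1))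
        = F 0 (k + 1 + 2) := by
      intro k _
      rw [if_pos (by omega)]
      exact F_diag (k+1)
    rw [Finset.sum_congr rfl this]
    simp only [zero_add, lt_irrefl, if_false, Nat.not_lt_zero]
    rw [show θ + 1 + 2 = θ + 2 + 1 by omega]
    ring
  | succ l ih =>
    rw [F_step, ih (by omega), add_assoc, ← mul_add]
    congr 2
    rw [← Finset.add_sum_erase _ _ (Finset.mem_range.2 h), ← Finset.add_sum_erase _ _ (Finset.mem_range.2 h)]
    simp only [show l + 1 < l + 1 + 1 by omega, if_true, show ¬ (l + 1 + 1 < l + 1 + 1) by omega, if_false]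
    have : ∀ r ∈ (Finset.range θ).erase (l+1+1), (if l+1 < r then F r (r+1) else F r (θ+1)) = if l+1+1 < r then F r (r+1) else F r (θ+1) := by
      intro r hr
      rw [Finset.mem_erase] at hr
      have : (l + 1 < r) ↔ (l + 1 + 1 < r) := by omega
      simp only [this]
    rw [Finset.sum_congr rfl this]
    ring

lemma F_all (l θ : ℕ) (h : l < θ) (h2 : 2 ≤ θ) : F l θ = 1 + y * ∑ r ∈ Finset.range θ,
    if 0 < l ∧ l < r then F r (r+1) else F r (θ+1) := by
  cases l with
  | zero =>
    obtain ⟨θ, rfl⟩ : ∃ k, θ = k + 2 := ⟨θ - 2, by omega⟩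
    rw [← F_diag, F_sum _ _ (by omega)]
    congr 2
    apply Finset.sum_congr rfl
    intro r hr
    rw [Finset.mem_range] at hr
    rw [if_neg (by omega), if_neg (by omega)]
  | succ l => rw [F_sum _ _ h]; simp

lemma f_eq (m : ℕ) : ∀ l θ, l < θ → 2 ≤ θ → PowerSeries.coeff m (F l θ) = (f m l θ : ℤ) := by
  induction m with
  | zero => intro l θ h1 h2; rw [F_all l θ h1 h2]; simp [f]
  | succ m ih =>
    intro l θ h1 h2
    rw [F_all l θ h1 h2, map_add, PowerSeries.coeff_succ_X_mul, map_sum, f]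
    push_cast
    simp only [PowerSeries.coeff_one, Nat.succ_ne_zero, if_false, zero_add]
    apply Finset.sum_congr rfl
    intro r hr
    rw [Finset.mem_range] at hr
    split_ifs
    · exact ih _ _ (by omega) (by omega)
    · exact ih _ _ (by omega) (by omega)

lemma f_eq_h (m : ℕ) : f m 0 2 = h m 0 := by
  have h1 := f_eq m 0 2 (by omega) (by omega)
  have h2 := h_eq m 0
  rw [descPochhammer_zero] at h2
  zify
  rw [← h1, h2]
  simp only [F, Nat.sub_self, pow_zero]
  rw [← coeff_Lam_C, map_one]

end V

namespace V

def c1 : Bool → ℕ → ℕ → ℕ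
  | _, 0, _ => 1
  | b, m+1, 0 => (if b then 1 else 1) * c1 true m 1
  | b, m+1, h+1 => (if b then 1 else h+2) * c1 true m (h+2) + c1 false (m+1) h
termination_by _ m h => (m, h)

lemma c1_false (m g : ℕ) : c1 false (m+1) g = ∑ i ∈ Finset.range (g+1), (i+1) * c1 true m (i+1) := by
  induction g with
  | zero => simp [c1]
  | succ g ih => rw [c1, ih, Finset.sum_range_succ _ (g+1)]; simp; ring

lemma c1_true (m : ℕ) : ∀ g, c1 true m (g+1) = h m g := by
  induction m with
  | zero => intro g; simp [c1, h]
  | succ m ih => intro g; rw [c1, h, c1_false]; simp [ih]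

def Cmp (h m : ℕ) (q : List Bool) : Prop :=
  q.count true = m ∧ q.count false = m + h ∧ ∀ i, (q.take i).count false ≤ h + (q.take i).count true

def Mk (b : Bool) (h : ℕ) (q : List Bool) (μ : ℕ → ℕ) : Prop :=
  ∀ i, (IsValley (b::q) i → μ i ≤ h + (q.take i).count true - (q.take i).count false) ∧
    (¬ IsValley (b::q) i → μ i = 0)

lemma cmp_true (h m : ℕ) (q : List Bool) : Cmp h m (true::q) ↔ ∃ m', m = m'+1 ∧ Cmp (h+1) m' q := by
  constructor
  · rintro ⟨h1, h2, h3⟩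
    simp at h1 h2
    refine ⟨q.count true, h1.symm, rfl, by omega, fun i => ?_⟩
    have := h3 (i+1)
    simp at this; omega
  · rintro ⟨m', rfl, h1, h2, h3⟩
    refine ⟨by simp [h1], by simp [h2]; omega, fun i => ?_⟩
    cases i with
    | zero => simp
    | succ i => have := h3 i; simp; omega

lemma cmp_false (h m : ℕ) (q : List Bool) : Cmp h m (false::q) ↔ ∃ h', h = h'+1 ∧ Cmp h' m q := by
  constructor
  · rintro ⟨h1, h2, h3⟩
    have h0 := h3 1
    simp at h1 h2 h0
    refine ⟨h-1, by omega, h1, by omega, fun i => ?_⟩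
    have := h3 (i+1)
    simp at this; omega
  · rintro ⟨m', rfl, h1, h2, h3⟩
    refine ⟨by simp [h1], by simp [h2]; omega, fun i => ?_⟩
    cases i with
    | zero => simp
    | succ i => have := h3 i; simp; omega

lemma cmp_nil (h m : ℕ) : Cmp h m [] ↔ h = 0 ∧ m = 0 := by
  constructor
  · rintro ⟨h1, h2, h3⟩; simp at h1 h2; omega
  · rintro ⟨rfl, rfl⟩; simp [Cmp]

lemma mk_nil (b : Bool) (h : ℕ) (μ) : Mk b h [] μ ↔ μ = fun _ => 0 := by
  constructor
  · intro H; funext i; exact (H i).2 (by simp [IsValley])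
  · rintro rfl; intro i; simp

lemma valley_succ (b c : Bool) (q : List Bool) (i : ℕ) : IsValley (b::c::q) (i+1) ↔ IsValley (c::q) i := by
  simp [IsValley]

lemma mk_true (b : Bool) (h : ℕ) (q μ) : Mk b h (true::q) μ ↔
    μ 0 < (if b then 1 else h+1) ∧ Mk true (h+1) q (fun i => μ (i+1)) := by
  constructor
  · intro H
    refine ⟨?_, fun i => ?_⟩
    · have := H 0
      cases b <;> simp [IsValley] at this ⊢ <;> omega
    · have := H (i+1)
      rw [valley_succ] at this
      simp only [List.take_succ_cons, List.count_cons_self] at this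
      simp at this
      refine ⟨fun hv => ?_, this.2⟩
      have := this.1 hv; beta_reduce at this ⊢; omega
  · rintro ⟨h1, h2⟩ i
    cases i with
    | zero => cases b <;> simp [IsValley] at h1 ⊢ <;> omega
    | succ i =>
      have := h2 i
      rw [valley_succ]
      simp only [List.take_succ_cons, List.count_cons_self]
      simp
      refine ⟨fun hv => ?_, this.2⟩
      have := this.1 hv; beta_reduce at this ⊢; omega

lemma mk_false (b : Bool) (h : ℕ) (q μ) : Mk b (h+1) (false::q) μ ↔
    μ 0 = 0 ∧ Mk false h q (fun i => μ (i+1)) := by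
  constructor
  · intro H
    refine ⟨?_, fun i => ?_⟩
    · have := H 0
      simpa [IsValley] using this
    · have := H (i+1)
      rw [valley_succ] at this
      simp only [List.take_succ_cons, List.count_cons_self] at this
      simp at this
      refine ⟨fun hv => ?_, this.2⟩
      have := this.1 hv; beta_reduce at this ⊢; omega
  · rintro ⟨h1, h2⟩ i
    cases i with
    | zero => simp [IsValley, h1]
    | succ i =>
      have := h2 i
      rw [valley_succ]
      simp only [List.take_succ_cons, List.count_cons_self]
      simp
      refine ⟨fun hv => ?_, this.2⟩
      have := this.1 hv; beta_reduce at this ⊢; omega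

abbrev PM := List Bool × (ℕ → ℕ)

def cns (b : Bool) (z : ℕ × PM) : PM := (b :: z.2.1, fun i => Nat.casesOn i z.1 z.2.2)

lemma cns_inj (b : Bool) : Function.Injective (cns b) := by
  rintro ⟨k, q, μ⟩ ⟨k', q', μ'⟩ H
  simp only [cns, Prod.mk.injEq, List.cons.injEq, true_and] at H
  obtain ⟨h1, h2⟩ := H
  have h3 := congrFun h2 0
  have h4 : μ = μ' := by funext i; exact congrFun h2 (i+1)
  simp at h3
  simp [h1, h3, h4]

def SS (b : Bool) (m h : ℕ) (z : PM) : Prop := Cmp h m z.1 ∧ Mk b h z.1 z.2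

open Classical in
lemma exU (b : Bool) (m h : ℕ) (T : Finset PM) (hT : ∀ z, z ∈ T ↔ SS true m (h+1) z) (z : PM) :
    z ∈ (Finset.range (if b then 1 else h+1) ×ˢ T).image (cns true) ↔ SS b (m+1) h z ∧ ∃ q, z.1 = true :: q := by
  rw [Finset.mem_image]
  constructor
  · rintro ⟨⟨k, q, μ⟩, hk, rfl⟩
    simp only [Finset.mem_product, Finset.mem_range, hT] at hk
    refine ⟨⟨?_, ?_⟩, q, rfl⟩
    · exact (cmp_true _ _ _).2 ⟨m, rfl, hk.2.1⟩
    · exact (mk_true _ _ _ _).2 ⟨hk.1, hk.2.2⟩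
  · obtain ⟨p, μ⟩ := z
    rintro ⟨⟨h1, h2⟩, q, h3⟩
    simp only at h1 h2 h3
    subst h3
    rw [cmp_true] at h1
    rw [mk_true] at h2
    obtain ⟨m', hm, h1⟩ := h1
    obtain rfl : m = m' := by omega
    refine ⟨(μ 0, q, fun i => μ (i+1)), ?_, ?_⟩
    · simp only [Finset.mem_product, Finset.mem_range, hT]
      exact ⟨h2.1, h1, h2.2⟩
    · simp only [cns, Prod.mk.injEq, true_and]
      funext i; cases i <;> rfl

open Classical in
lemma exD (b : Bool) (m h : ℕ) (T : Finset PM) (hT : ∀ z, z ∈ T ↔ SS false m h z) (z : PM) :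
    z ∈ (Finset.range 1 ×ˢ T).image (cns false) ↔ SS b m (h+1) z ∧ ∃ q, z.1 = false :: q := by
  rw [Finset.mem_image]
  constructor
  · rintro ⟨⟨k, q, μ⟩, hk, rfl⟩
    simp only [Finset.mem_product, Finset.mem_range, hT] at hk
    refine ⟨⟨?_, ?_⟩, q, rfl⟩
    · exact (cmp_false _ _ _).2 ⟨h, rfl, hk.2.1⟩
    · exact (mk_false _ _ _ _).2 ⟨by simpa [cns] using hk.1, hk.2.2⟩
  · obtain ⟨p, μ⟩ := z
    rintro ⟨⟨h1, h2⟩, q, h3⟩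
    simp only at h1 h2 h3
    subst h3
    rw [cmp_false] at h1
    rw [mk_false] at h2
    obtain ⟨m', hm, h1⟩ := h1
    obtain rfl : h = m' := by omega
    refine ⟨(μ 0, q, fun i => μ (i+1)), ?_, ?_⟩
    · simp only [Finset.mem_product, Finset.mem_range, hT]
      exact ⟨by omega, h1, h2.2⟩
    · simp only [cns, Prod.mk.injEq, true_and]
      funext i; cases i <;> rfl

lemma SS_D0 (b : Bool) (m : ℕ) (z : PM) (q) (H : SS b m 0 z) : z.1 ≠ false :: q := by
  intro e
  have := H.1
  rw [e, cmp_false] at this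
  obtain ⟨_, h, _⟩ := this; omega

lemma SS_U0 (b : Bool) (h : ℕ) (z : PM) (q) (H : SS b 0 h z) : z.1 ≠ true :: q := by
  intro e
  have := H.1
  rw [e, cmp_true] at this
  obtain ⟨_, h, _⟩ := this; omega

lemma SS_nil (b : Bool) (m h : ℕ) (z : PM) (H : SS b m h z) (hz : z.1 = []) : h = 0 ∧ m = 0 := by
  have := H.1
  rwa [hz, cmp_nil] at this

lemma lcases (q : List Bool) : q = [] ∨ (∃ r, q = true :: r) ∨ ∃ r, q = false :: r := by
  rcases q with _ | ⟨b, r⟩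
  · simp
  · cases b <;> simp

open Classical in
lemma fin_ex (m : ℕ) : ∀ (h : ℕ) (b : Bool), ∃ T : Finset PM, (∀ z, z ∈ T ↔ SS b m h z) ∧ T.card = c1 b m h := by
  induction m with
  | zero =>
    intro h
    induction h with
    | zero =>
      intro b
      refine ⟨{([], fun _ => 0)}, ?_, by simp [c1]⟩
      intro z
      rw [Finset.mem_singleton]
      constructor
      · rintro rfl; exact ⟨(cmp_nil _ _).2 ⟨rfl, rfl⟩, (mk_nil _ _ _).2 rfl⟩
      · intro H
        rcases lcases z.1 with h1 | ⟨r, h1⟩ | ⟨r, h1⟩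
        · have := H.2
          rw [h1, mk_nil] at this
          exact Prod.ext h1 this
        · exact absurd h1 (SS_U0 _ _ _ _ H)
        · exact absurd h1 (SS_D0 _ _ _ _ H)
    | succ h ih =>
      intro b
      obtain ⟨T, hT, hc⟩ := ih false
      refine ⟨(Finset.range 1 ×ˢ T).image (cns false), ?_, ?_⟩
      · intro z
        rw [exD b 0 h T hT]
        refine ⟨fun H => H.1, fun H => ⟨H, ?_⟩⟩
        rcases lcases z.1 with h1 | ⟨r, h1⟩ | h1
        · have := SS_nil _ _ _ _ H h1; omega
        · exact absurd h1 (SS_U0 _ _ _ _ H)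
        · exact h1
      · rw [Finset.card_image_of_injective _ (cns_inj _), Finset.card_product, hc]; simp [c1]
  | succ m ihm =>
    intro h
    induction h with
    | zero =>
      intro b
      obtain ⟨T, hT, hc⟩ := ihm 1 true
      refine ⟨(Finset.range (if b then 1 else 0+1) ×ˢ T).image (cns true), ?_, ?_⟩
      · intro z
        rw [exU b m 0 T hT]
        refine ⟨fun H => H.1, fun H => ⟨H, ?_⟩⟩
        rcases lcases z.1 with h1 | h1 | ⟨r, h1⟩
        · have := SS_nil _ _ _ _ H h1; omega
        · exact h1
        · exact absurd h1 (SS_D0 _ _ _ _ H)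
      · rw [Finset.card_image_of_injective _ (cns_inj _), Finset.card_product, hc]; simp [c1]
    | succ h ih =>
      intro b
      obtain ⟨T, hT, hc⟩ := ihm (h+2) true
      obtain ⟨T', hT', hc'⟩ := ih false
      refine ⟨(Finset.range (if b then 1 else h+1+1) ×ˢ T).image (cns true) ∪ 
        (Finset.range 1 ×ˢ T').image (cns false), ?_, ?_⟩
      · intro z
        rw [Finset.mem_union, exU b m (h+1) T hT, exD b (m+1) h T' hT']
        constructor
        · rintro (H | H) <;> exact H.1
        · intro H
          rcases lcases z.1 with h1 | h1 | h1
          · have := SS_nil _ _ _ _ H h1; omega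
          · exact Or.inl ⟨H, h1⟩
          · exact Or.inr ⟨H, h1⟩
      · rw [Finset.card_union_of_disjoint, Finset.card_image_of_injective _ (cns_inj _),
          Finset.card_image_of_injective _ (cns_inj _), Finset.card_product, Finset.card_product, hc, hc']
        · simp [c1]
        · rw [Finset.disjoint_left]
          intro z h1 h2
          rw [exU b m (h+1) T hT] at h1
          rw [exD b (m+1) h T' hT'] at h2
          obtain ⟨_, q, e1⟩ := h1
          obtain ⟨_, q', e2⟩ := h2
          rw [e1] at e2; simp at e2

lemma dyck_cons (n : ℕ) (q : List Bool) : IsDyckPath (n+1) (true::q) ↔ Cmp 1 n q := by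
  have hl : q.count true + q.count false = q.length := List.count_true_add_count_false q
  constructor
  · rintro ⟨h1, h2, h3⟩
    simp at h1 h3
    refine ⟨by omega, by omega, fun i => ?_⟩
    have := h2 (i+1)
    simp at this; omega
  · rintro ⟨h1, h2, h3⟩
    refine ⟨by simp; omega, fun i => ?_, by simp; omega⟩
    cases i with
    | zero => simp
    | succ i => have := h3 i; simp; omega

lemma vm_cons (q : List Bool) (μ : ℕ → ℕ) : IsValleyMarking (true::q) μ ↔ Mk true 1 q μ := by
  have : ∀ i, pathHeight (true::q) (i+1) = 1 + (q.take i).count true - (q.take i).count false := by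
    intro i; simp [pathHeight, add_comm]
  simp only [IsValleyMarking, Mk, this]

open Classical in
lemma path_card (n : ℕ) : Nat.card {pm : List Bool × (ℕ → ℕ) //
          IsDyckPath (n+1) pm.1 ∧ IsValleyMarking pm.1 pm.2} = h n 0 := by
  obtain ⟨T, hT, hc⟩ := fin_ex n 1 true
  rw [← c1_true, ← hc]
  let g : PM → PM := fun z => (true :: z.1, z.2)
  have hg : Function.Injective g := by
    rintro ⟨a, b⟩ ⟨a', b'⟩ H; simpa [g] using H
  rw [← Finset.card_image_of_injective T hg]
  apply Nat.subtype_card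
  rintro ⟨p, μ⟩
  rw [Finset.mem_image]
  constructor
  · rintro ⟨⟨q, ν⟩, hz, H⟩
    rw [hT] at hz
    simp only [g, Prod.mk.injEq] at H
    obtain ⟨rfl, rfl⟩ := H
    exact ⟨(dyck_cons n q).2 hz.1, (vm_cons q ν).2 hz.2⟩
  · rintro ⟨h1, h2⟩
    simp only at h1 h2
    rcases lcases p with rfl | ⟨q, rfl⟩ | ⟨q, rfl⟩
    · have := h1.1; simp at this
    · exact ⟨(q, μ), (hT _).2 ⟨(dyck_cons n q).1 h1, (vm_cons q μ).1 h2⟩, rfl⟩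
    · have := h1.2.1 1; simp at this

end V

namespace V

def ext {n : ℕ} (p : Equiv.Perm (Fin n)) (r : Fin (n+1)) : Equiv.Perm (Fin (n+1)) :=
  ((finSuccEquiv' (Fin.last n)).trans (Equiv.optionCongr p)).trans (finSuccEquiv' r).symm

lemma ext_last {n : ℕ} (p : Equiv.Perm (Fin n)) (r : Fin (n+1)) : ext p r (Fin.last n) = r := by
  simp [ext]

lemma ext_cast {n : ℕ} (p : Equiv.Perm (Fin n)) (r : Fin (n+1)) (j : Fin n) :
    ext p r j.castSucc = r.succAbove (p j) := by
  have e : finSuccEquiv' (Fin.last n) j.castSucc = some j := by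
    have := finSuccEquiv'_succAbove (Fin.last n) j
    rwa [Fin.succAbove_last] at this
  simp [ext, e]

lemma ext_bij (n : ℕ) : Function.Bijective (fun z : Equiv.Perm (Fin n) × Fin (n+1) => ext z.1 z.2) := by
  rw [Fintype.bijective_iff_injective_and_card]
  constructor
  · rintro ⟨p, r⟩ ⟨p', r'⟩ H
    simp only at H
    have h1 : r = r' := by rw [← ext_last p r, H, ext_last]
    subst h1
    have h2 : p = p' := by
      ext1 j
      have := congrFun (congrArg DFunLike.coe H) j.castSucc
      rw [ext_cast, ext_cast] at this
      exact Fin.succAbove_right_injective this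
    rw [h2]
  · simp [Fintype.card_perm, Nat.factorial_succ, mul_comm]

def Top {n : ℕ} (p : Equiv.Perm (Fin n)) (x : ℕ) : Prop :=
  ∃ a b b' : Fin n, a < b ∧ (b' : ℕ) = b + 1 ∧ p a < p b ∧ p b < p b' ∧ (p b' : ℕ) = x

lemma sA_lt {n : ℕ} (r : Fin (n+1)) (i : Fin n) : r.succAbove i < r ↔ (i : ℕ) < r := by
  rw [Fin.succAbove_lt_iff_castSucc_lt]; simp [Fin.lt_def]

lemma av_ext {n : ℕ} (p : Equiv.Perm (Fin n)) (r : Fin (n+1)) :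
    ¬ Contains1234 (ext p r) ↔ ¬ Contains1234 p ∧ ∀ x, Top p x → (r : ℕ) ≤ x := by
  rw [← not_iff_not]
  push Not
  constructor
  · rintro ⟨a, b, b', c, h1, h2, h3, h4, h5, h6⟩
    have hb' : b' ≠ Fin.last n := (lt_of_lt_of_le h3 (Fin.le_last c)).ne
    have hb : b ≠ Fin.last n := by
      intro e; have := b'.is_lt; rw [e] at h2; simp at h2; omega
    have ha : a ≠ Fin.last n := (lt_of_lt_of_le h1 (Fin.le_last b)).ne
    obtain ⟨b', rfl⟩ := Fin.exists_castSucc_eq.2 hb'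
    obtain ⟨b, rfl⟩ := Fin.exists_castSucc_eq.2 hb
    obtain ⟨a, rfl⟩ := Fin.exists_castSucc_eq.2 ha
    rw [ext_cast, ext_cast, Fin.succAbove_lt_succAbove_iff] at h4 h5
    intro hp
    by_cases hc : c = Fin.last n
    · subst hc
      rw [ext_last, ext_cast, sA_lt] at h6
      exact ⟨_, ⟨a, b, b', h1, h2, h4, h5, rfl⟩, h6⟩
    · obtain ⟨c, rfl⟩ := Fin.exists_castSucc_eq.2 hc
      rw [ext_cast, ext_cast, Fin.succAbove_lt_succAbove_iff] at h6
      exact absurd ⟨a, b, b', c, h1, h2, h3, h4, h5, h6⟩ hp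
  · intro H
    by_cases hp : Contains1234 p
    · obtain ⟨a, b, b', c, h1, h2, h3, h4, h5, h6⟩ := hp
      refine ⟨a.castSucc, b.castSucc, b'.castSucc, c.castSucc, h1, h2, h3, ?_, ?_, ?_⟩ <;>
      rw [ext_cast, ext_cast, Fin.succAbove_lt_succAbove_iff] <;> assumption
    · obtain ⟨x, ⟨a, b, b', h1, h2, h4, h5, rfl⟩, h6⟩ := H hp
      refine ⟨a.castSucc, b.castSucc, b'.castSucc, Fin.last n, h1, h2, Fin.castSucc_lt_last _, ?_, ?_, ?_⟩
      · rw [ext_cast, ext_cast, Fin.succAbove_lt_succAbove_iff]; exact h4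
      · rw [ext_cast, ext_cast, Fin.succAbove_lt_succAbove_iff]; exact h5
      · rw [ext_cast, ext_last, sA_lt]; exact h6

lemma top_ext {n : ℕ} (p : Equiv.Perm (Fin (n+1))) (r : Fin (n+2)) (hr : ∀ x, Top p x → (r : ℕ) ≤ x) (y : ℕ) :
    Top (ext p r) y ↔ (∃ x, Top p x ∧ y = x + 1) ∨ 
      (0 < (p (Fin.last n) : ℕ) ∧ (p (Fin.last n) : ℕ) < r ∧ y = r) := by
  constructor
  · rintro ⟨a, b, b', h1, h2, h4, h5, rfl⟩
    have hb : b ≠ Fin.last (n+1) := by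
      intro e; have := b'.is_lt; rw [e] at h2; simp at h2; omega
    have ha : a ≠ Fin.last (n+1) := (lt_of_lt_of_le h1 (Fin.le_last b)).ne
    obtain ⟨b, rfl⟩ := Fin.exists_castSucc_eq.2 hb
    obtain ⟨a, rfl⟩ := Fin.exists_castSucc_eq.2 ha
    rw [ext_cast, ext_cast, Fin.succAbove_lt_succAbove_iff] at h4
    by_cases hb' : b' = Fin.last (n+1)
    · subst hb'
      right
      have : b = Fin.last n := by
        ext; simp at h2 ⊢; omega
      subst this
      rw [ext_cast, ext_last, sA_lt] at h5
      rw [ext_last]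
      refine ⟨?_, h5, rfl⟩
      rw [Fin.lt_def] at h4; omega
    · left
      obtain ⟨b', rfl⟩ := Fin.exists_castSucc_eq.2 hb'
      rw [ext_cast, ext_cast, Fin.succAbove_lt_succAbove_iff] at h5
      have ht : Top p (p b') := ⟨a, b, b', h1, h2, h4, h5, rfl⟩
      refine ⟨_, ht, ?_⟩
      have := hr _ ht
      rw [ext_cast, Fin.succAbove_of_le_castSucc]
      · simp
      · rw [Fin.le_def]; simpa using this
  · rintro (⟨x, ht, rfl⟩ | ⟨h1, h2, rfl⟩)
    · have := hr _ ht
      obtain ⟨a, b, b', h1, h2, h4, h5, rfl⟩ := ht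
      refine ⟨a.castSucc, b.castSucc, b'.castSucc, h1, h2, ?_, ?_, ?_⟩
      · rw [ext_cast, ext_cast, Fin.succAbove_lt_succAbove_iff]; exact h4
      · rw [ext_cast, ext_cast, Fin.succAbove_lt_succAbove_iff]; exact h5
      · rw [ext_cast, Fin.succAbove_of_le_castSucc]
        · simp
        · rw [Fin.le_def]; simpa using this
    · refine ⟨(p.symm 0).castSucc, (Fin.last n).castSucc, Fin.last (n+1), ?_, by simp, ?_, ?_, ?_⟩
      · rw [Fin.castSucc_lt_castSucc_iff]
        refine lt_of_le_of_ne (Fin.le_last _) ?_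
        intro e
        rw [← e] at h1; simp at h1
      · rw [ext_cast, ext_cast, Fin.succAbove_lt_succAbove_iff, Fin.lt_def]; simpa using h1
      · rw [ext_cast, ext_last, sA_lt]; exact h2
      · rw [ext_last]

def St {n : ℕ} (p : Equiv.Perm (Fin (n+1))) (l θ : ℕ) : Prop :=
  (p (Fin.last n) : ℕ) = l ∧ θ ≤ n + 2 ∧ ∀ r ≤ n + 1, (r < θ ↔ ∀ x, Top p x → r ≤ x)

lemma St_ext {n : ℕ} (p : Equiv.Perm (Fin (n+1))) (l θ : ℕ) (H : St p l θ) (r : Fin (n+2)) (hr : (r:ℕ) < θ) :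
    if 0 < l ∧ l < r then St (ext p r) r (r+1) else St (ext p r) r (θ+1) := by
  obtain ⟨h1, h2, h3⟩ := H
  have hr' := (h3 r (by omega)).1 hr
  split_ifs with hl
  · refine ⟨by rw [ext_last], by omega, ?_⟩
    intro r' hr2
    constructor
    · intro h x hx
      rw [top_ext p r hr'] at hx
      rcases hx with ⟨y, hy, rfl⟩ | ⟨_, _, rfl⟩
      · have := hr' y hy; omega
      · omega
    · intro h
      have := h r ((top_ext p r hr' r).2 (Or.inr ⟨by omega, by omega, rfl⟩))
      omega
  · refine ⟨by rw [ext_last], by omega, ?_⟩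
    intro r' hr2
    have key : (∀ x, Top (ext p r) x → r' ≤ x) ↔ ∀ x, Top p x → r' ≤ x + 1 := by
      constructor
      · intro h x hx
        exact h _ ((top_ext p r hr' _).2 (Or.inl ⟨x, hx, rfl⟩))
      · intro h x hx
        rw [top_ext p r hr'] at hx
        rcases hx with ⟨y, hy, rfl⟩ | ⟨_, _, rfl⟩
        · exact h y hy
        · omega
    rw [key]
    cases r' with
    | zero => simp
    | succ r' =>
      have := h3 r' (by omega)
      simp only [Nat.add_lt_add_iff_right, Nat.add_le_add_iff_right]
      exact this

open Classical in
noncomputable def DD : (m : ℕ) → {n : ℕ} → Equiv.Perm (Fin (n+1)) → ℕ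
  | 0, _, _ => 1
  | m+1, n, p => ∑ r : Fin (n+2), if ¬ Contains1234 (ext p r) then DD m (ext p r) else 0

open Classical in
lemma DD_eq (m : ℕ) : ∀ {n : ℕ} (p : Equiv.Perm (Fin (n+1))) (l θ : ℕ), ¬ Contains1234 p → St p l θ →
    DD m p = f m l θ := by
  induction m with
  | zero => intros; simp [DD, f]
  | succ m ih =>
    intro n p l θ hp H
    have hθ := H.2.1
    rw [DD, f]
    have : ∀ r : Fin (n+2), (if ¬ Contains1234 (ext p r) then DD m (ext p r) else 0) =
        (fun r : ℕ => if r < θ then (if 0 < l ∧ l < r then f m r (r+1) else f m r (θ+1)) else 0) r := by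
      intro r
      have e : ¬ Contains1234 (ext p r) ↔ (r : ℕ) < θ := by
        rw [av_ext, H.2.2 r (by omega)]; simp [hp]
      simp only
      by_cases hr : (r : ℕ) < θ
      · rw [if_pos (e.2 hr), if_pos hr]
        have := St_ext p l θ H r hr
        split_ifs at this ⊢ with hl
        · exact ih _ _ _ (e.2 hr) this
        · exact ih _ _ _ (e.2 hr) this
      · rw [if_neg (fun h => hr (e.1 h)), if_neg hr]
    rw [Finset.sum_congr rfl (fun r _ => this r)]
    rw [← Finset.sum_range (n := n+2) (fun r : ℕ => if r < θ then (if 0 < l ∧ l < r then f m r (r+1) else f m r (θ+1)) else 0)]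
    rw [← Finset.sum_filter]
    congr 1
    ext r; simp; omega

open Classical in
lemma DD_sum (m : ℕ) : ∀ n N : ℕ, N = n + 1 + m →
    Nat.card {p : Equiv.Perm (Fin N) // ¬ Contains1234 p} = 
      ∑ p : Equiv.Perm (Fin (n+1)), if ¬ Contains1234 p then DD m p else 0 := by
  induction m with
  | zero =>
    rintro n N rfl
    rw [Nat.card_eq_fintype_card, Fintype.card_subtype, Finset.card_filter]
    rfl
  | succ m ih =>
    rintro n N hN
    rw [ih (n+1) N (by omega)]
    rw [← (Equiv.ofBijective _ (ext_bij (n+1))).sum_comp, Fintype.sum_prod_type]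
    apply Finset.sum_congr rfl
    intro p _
    simp only [Equiv.ofBijective_apply, DD]
    by_cases hp : Contains1234 p
    · rw [if_neg (by simpa using hp)]
      apply Finset.sum_eq_zero
      intro r _
      rw [if_neg]
      intro h; exact ((av_ext p r).1 h).1 hp
    · rw [if_pos hp]

lemma perm_card (m : ℕ) : Nat.card {p : Equiv.Perm (Fin (m+1)) // ¬ Contains1234 p} = f m 0 2 := by
  classical
  rw [DD_sum m 0 (m+1) (by omega)]
  have h1 : ∀ p : Equiv.Perm (Fin 1), ¬ Contains1234 p := by
    rintro p ⟨a, b, _, _, h, _⟩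
    omega
  haveI : Subsingleton (Equiv.Perm (Fin (0+1))) := inferInstanceAs (Subsingleton (Equiv.Perm (Fin 1)))
  rw [Fintype.sum_subsingleton _ (1 : Equiv.Perm (Fin (0+1))), if_pos (h1 _)]
  apply DD_eq m _ _ _ (h1 _)
  refine ⟨by simp, by omega, ?_⟩
  intro r hr
  have : ∀ x, ¬ Top (1 : Equiv.Perm (Fin (0+1))) x := by
    rintro x ⟨a, b, _, h, _⟩; omega
  exact ⟨fun _ x hx => absurd hx (this x), fun _ => by omega⟩

end V

theorem stmt11 (n : ℕ) (hn : 1 ≤ n) :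
    Nat.card {p : Equiv.Perm (Fin n) // ¬ Contains1234 p}
      = Nat.card {pm : List Bool × (ℕ → ℕ) //
          IsDyckPath n pm.1 ∧ IsValleyMarking pm.1 pm.2} := by
  obtain ⟨m, rfl⟩ : ∃ m, n = m + 1 := ⟨n - 1, by omega⟩
  rw [V.perm_card, V.path_card, V.f_eq_h]
end

section
/- For all n ≥ 1, the number of (1-23-4)-avoiding permutations of {1,...,n} equals the number of Stirling permutations of size n whose plateaus, read from left to right, are increasing. -/
/-- `l` is a permutation (as a sequence) of the multiset `{1,1,2,2,...,n,n}`. -/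
def IsDoubleMultiset (n : ℕ) (l : List ℕ) : Prop :=
  ∀ i : ℕ, l.count i = if 1 ≤ i ∧ i ≤ n then 2 else 0

/-- A Stirling permutation of size `n`: a permutation of `{1,1,2,2,...,n,n}`
such that every entry lying strictly between the two (equal) occurrences of a
value exceeds that value. -/
def IsStirlingPerm (n : ℕ) (l : List ℕ) : Prop :=
  IsDoubleMultiset n l ∧
    ∀ a b c : Fin l.length, a < b → b < c → l.get a = l.get c →
      l.get a < l.get b

/-- A Gessel permutation of size `n`: a permutation of `{1,1,2,2,...,n,n}` in
which the second occurrence of each value is a right-to-left minimum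
(equivalently, the second occurrences of `1,2,...,n` appear in that order). -/
def IsGesselPerm (n : ℕ) (l : List ℕ) : Prop :=
  IsDoubleMultiset n l ∧
    ∀ a c d : Fin l.length, a < c → l.get a = l.get c → c < d →
      l.get c < l.get d

/-- The plateaus of `l` (pairs of adjacent equal entries), read from left to
right, have increasing values. Entries are accessed with `List.getD` (all
indices involved are in range). -/
def HasIncPlateaus (l : List ℕ) : Prop :=
  ∀ i j : ℕ, i < j → j + 1 < l.length →
    l.getD i 0 = l.getD (i + 1) 0 → l.getD j 0 = l.getD (j + 1) 0 →
    l.getD i 0 < l.getD j 0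

/-- valid choices at a node with label `k` -/
def okc (k : ℕ) : Option (ℕ × ℕ) → Prop
  | none => True
  | some (j, t) => t ≤ j ∧ j ≤ k

/-- label of the child -/
def nlc (k : ℕ) : Option (ℕ × ℕ) → ℕ
  | none => k + 1
  | some (j, _) => j

theorem tree_bij {α β : Type} [Nonempty α] (N : ℕ) (V : ℕ → Set α) (W : ℕ → Set β)
    (la : α → ℕ) (lb : β → ℕ)
    (ca : ℕ → α × Option (ℕ × ℕ) → α) (cb : ℕ → β × Option (ℕ × ℕ) → β)
    (h0 : ∃ f : α → β, Set.BijOn f (V 0) (W 0) ∧ ∀ x ∈ V 0, lb (f x) = la x)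
    (hV : ∀ n, n < N → Set.BijOn (ca n) {p | p.1 ∈ V n ∧ okc (la p.1) p.2} (V (n+1)))
    (hW : ∀ n, n < N → Set.BijOn (cb n) {p | p.1 ∈ W n ∧ okc (lb p.1) p.2} (W (n+1)))
    (hla : ∀ n, n < N → ∀ p : α × Option (ℕ × ℕ), p.1 ∈ V n → okc (la p.1) p.2 →
      la (ca n p) = nlc (la p.1) p.2)
    (hlb : ∀ n, n < N → ∀ p : β × Option (ℕ × ℕ), p.1 ∈ W n → okc (lb p.1) p.2 →
      lb (cb n p) = nlc (lb p.1) p.2) :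
    ∀ n, n ≤ N → ∃ f : α → β, Set.BijOn f (V n) (W n) ∧ ∀ x ∈ V n, lb (f x) = la x := by
  intro n
  induction n with
  | zero => intro _; exact h0
  | succ n ih =>
    intro hn
    obtain ⟨f, hf, hl⟩ := ih (by omega)
    have hv := hV n (by omega)
    have hw := hW n (by omega)
    have hinv := hv.invOn_invFunOn
    have hmid : Set.BijOn (fun p : α × Option (ℕ × ℕ) => (f p.1, p.2))
        {p | p.1 ∈ V n ∧ okc (la p.1) p.2} {p | p.1 ∈ W n ∧ okc (lb p.1) p.2} := by
      refine ⟨?_, ?_, ?_⟩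
      · rintro ⟨q, c⟩ ⟨h1, h2⟩
        exact ⟨hf.mapsTo h1, by simpa [hl q h1] using h2⟩
      · rintro ⟨q, c⟩ ⟨h1, h2⟩ ⟨q', c'⟩ ⟨h1', h2'⟩ h
        simp only [Prod.mk.injEq] at h
        exact Prod.ext (hf.injOn h1 h1' h.1) h.2
      · rintro ⟨q, c⟩ ⟨h1, h2⟩
        obtain ⟨a, ha, rfl⟩ := hf.surjOn h1
        exact ⟨(a, c), ⟨ha, by simpa [hl a ha] using h2⟩, rfl⟩
    have hsymm := Set.BijOn.symm hinv.symm hv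
    refine ⟨_, (hw.comp (hmid.comp hsymm)), ?_⟩
    intro x hx
    have hm := hsymm.mapsTo hx
    have e := hinv.2 hx
    have h1 := hmid.mapsTo hm
    simp only [Function.comp]
    rw [hlb n (by omega) _ h1.1 h1.2]
    conv_rhs => rw [← e]
    rw [hla n (by omega) _ hm.1 hm.2]
    simp only [hl _ hm.1]
/-- no ascent `b b'` in the list with something smaller than `b` before -/
def HH : List ℕ → List ℕ → Prop
  | _, [] => True
  | s, b :: w => (∀ b' ∈ w.head?, b < b' → ∀ a ∈ s, b ≤ a) ∧ HH (b :: s) w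

/-- avoidance of 1-23-4, with `s` the earlier entries -/
def GG : List ℕ → List ℕ → Prop
  | _, [] => True
  | s, b :: w => (∀ b' ∈ w.head?, b < b' → (∀ a ∈ s, b ≤ a) ∨ (∀ c ∈ w, c ≤ b')) ∧ GG (b :: s) w

theorem GG_mono (y : List ℕ) : ∀ (s s' : List ℕ),
    (∀ b ∈ y, (∀ a ∈ s, b ≤ a) → (∀ a ∈ s', b ≤ a)) → GG s y → GG s' y := by
  induction y with
  | nil => intro s s' _ _; trivial
  | cons b y ih =>
    intro s s' h hg
    refine ⟨?_, ?_⟩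
    · intro b' hb' hlt
      rcases hg.1 b' hb' hlt with h1 | h1
      · exact Or.inl (h b (by simp) h1)
      · exact Or.inr h1
    · refine ih _ _ ?_ hg.2
      intro c hc h1 a ha
      simp only [List.mem_cons, forall_eq_or_imp] at h1 ha
      rcases ha with rfl | ha
      · exact h1.1
      · exact h c (by simp [hc]) h1.2 a ha

theorem GG_split (n : ℕ) (y : List ℕ) (hy : ∀ a ∈ y, a < n) (x : List ℕ) : ∀ (s : List ℕ),
    (∀ a ∈ x, a < n) → (GG s (x ++ n :: y) ↔ HH s x ∧ GG (x ++ s) y) := by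
  induction x with
  | nil =>
    intro s _
    simp only [List.nil_append, GG, HH, true_and]
    constructor
    · rintro ⟨_, h⟩
      exact GG_mono _ _ _ (fun b hb h a ha => h a (by simp [ha])) h
    · intro h
      refine ⟨?_, ?_⟩
      · intro b' hb' hlt
        have := hy b' (List.mem_of_mem_head? hb')
        omega
      · refine GG_mono _ _ _ ?_ h
        intro b hb h a ha
        simp only [List.mem_cons] at ha
        rcases ha with rfl | ha
        · exact (hy b hb).le
        · exact h a ha
  | cons b x ih =>
    intro s hx
    simp only [List.mem_cons, forall_eq_or_imp] at hx
    simp only [List.cons_append, GG, HH]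
    rw [ih _ hx.2]
    have e1 : GG (x ++ b :: s) y ↔ GG (b :: (x ++ s)) y := by
      constructor <;> refine GG_mono _ _ _ ?_ <;> intro c hc h a ha <;> apply h <;>
        simp at ha ⊢ <;> tauto
    rw [e1]
    have e2 : (∀ b' ∈ (x ++ n :: y).head?, b < b' → (∀ a ∈ s, b ≤ a) ∨ ∀ c ∈ (x ++ n :: y), c ≤ b')
        ↔ (∀ b' ∈ x.head?, b < b' → ∀ a ∈ s, b ≤ a) := by
      cases x with
      | nil =>
        simp only [List.nil_append, List.head?_cons, Option.mem_def, Option.some.injEq,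
          List.head?_nil]
        constructor
        · intro _ b' hb'; cases hb'
        · intro _ b' hb' _
          subst hb'
          right
          intro c hc
          simp only [List.mem_cons] at hc
          rcases hc with rfl | hc
          · exact le_rfl
          · exact (hy c hc).le
      | cons z x =>
        simp only [List.cons_append, List.head?_cons, Option.mem_def, Option.some.injEq]
        constructor
        · intro h b' hb' hlt
          rcases h b' hb' hlt with h | h
          · exact h
          · have := h n (by simp)
            have := hx.2 z (by simp)
            omega
        · intro h b' hb' hlt
          exact Or.inl (h b' hb' hlt)
    rw [e2]
    tauto

/-- blocks: minimum followed by a decreasing list -/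
def Blk (c : List ℕ) : Prop := ∃ m r, c = m :: r ∧ r.Pairwise (· > ·) ∧ ∀ x ∈ r, m < x

def hd (c : List ℕ) : ℕ := c.headD 0

/-- well formed list of blocks -/
def WZ (Z : List (List ℕ)) : Prop := (∀ c ∈ Z, Blk c) ∧ Z.Pairwise (fun c d => hd d < hd c)

def Str (s T : List ℕ) (Z : List (List ℕ)) : Prop :=
  T.Pairwise (· > ·) ∧ (∀ t ∈ T, ∃ a ∈ s, a < t) ∧ WZ Z ∧ ∀ c ∈ Z, ∀ a ∈ s, hd c < a

theorem Str_tail {s T : List ℕ} {Z : List (List ℕ)} {b : ℕ} :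
    Str s (b :: T) Z ↔ (∃ a ∈ s, a < b) ∧ (∀ t ∈ T, t < b) ∧ Str (b :: s) T Z ∧
      (∀ t ∈ T, ∃ a ∈ s, a < t) := by
  unfold Str
  simp only [List.pairwise_cons, List.mem_cons, forall_eq_or_imp, exists_eq_or_imp]
  constructor
  · rintro ⟨⟨h1, h2⟩, ⟨h3, h4⟩, h5, h6⟩
    refine ⟨h3, h1, ⟨h2, fun t ht => Or.inr (h4 t ht), h5, ?_⟩, h4⟩
    intro c hc
    obtain ⟨a, ha, hab⟩ := h3
    exact ⟨(h6 c hc a ha).trans hab, h6 c hc⟩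
  · rintro ⟨h3, h1, ⟨h2, h4, h5, h6⟩, h7⟩
    exact ⟨⟨h1, h2⟩, ⟨h3, h7⟩, h5, fun c hc => (h6 c hc).2⟩

theorem Str_blk {s r : List ℕ} {Z : List (List ℕ)} {b : ℕ} :
    Str s [] ((b :: r) :: Z) ↔ (∀ a ∈ s, b < a) ∧ Str (b :: s) r Z := by
  unfold Str WZ
  simp only [List.pairwise_cons, List.mem_cons, forall_eq_or_imp, exists_eq_or_imp, hd,
    List.headD_cons, List.not_mem_nil, false_imp_iff, implies_true, List.Pairwise.nil, true_and]
  constructor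
  · rintro ⟨⟨⟨⟨m, r', h0, h1, h2⟩, h3⟩, h4, h5⟩, h6, h7⟩
    cases h0
    refine ⟨h6, h1, fun t ht => Or.inl (h2 t ht), ⟨h3, h5⟩, fun c hc => ⟨h4 c hc, h7 c hc⟩⟩
  · rintro ⟨h1, h2, h3, ⟨h4, h5⟩, h6⟩
    refine ⟨⟨⟨⟨b, r, rfl, h2, ?_⟩, h4⟩, fun c hc => (h6 c hc).1, h5⟩, h1, fun c hc => (h6 c hc).2⟩
    intro t ht
    rcases h3 t ht with h | ⟨a, ha, hat⟩
    · exact h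
    · exact (h1 a ha).trans hat

theorem Str_ne {s T : List ℕ} {Z : List (List ℕ)} (h : Str s T Z) : ∀ c ∈ Z, c ≠ [] := by
  intro c hc
  obtain ⟨m, r, rfl, _⟩ := h.2.2.1.1 c hc
  simp

theorem Str_cases {s T : List ℕ} {Z : List (List ℕ)} {b : ℕ} {w : List ℕ} (h : Str s T Z)
    (e : T ++ Z.flatten = b :: w) :
    (∃ T', T = b :: T' ∧ w = T' ++ Z.flatten ∧ (∃ a ∈ s, a < b) ∧ Str (b :: s) T' Z ∧
      ∀ t ∈ T', t < b) ∨
    (T = [] ∧ ∃ r Z', Z = (b :: r) :: Z' ∧ w = r ++ Z'.flatten ∧ (∀ a ∈ s, b < a) ∧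
      Str (b :: s) r Z') := by
  cases T with
  | cons b' T' =>
    simp only [List.cons_append, List.cons.injEq] at e
    obtain ⟨rfl, rfl⟩ := e
    rw [Str_tail] at h
    exact Or.inl ⟨T', rfl, rfl, h.1, h.2.2.1, h.2.1⟩
  | nil =>
    cases Z with
    | nil => simp at e
    | cons c Z' =>
      have := Str_ne h c (by simp)
      cases c with
      | nil => exact absurd rfl this
      | cons b' r =>
        simp only [List.nil_append, List.flatten_cons, List.cons_append, List.cons.injEq] at e
        obtain ⟨rfl, rfl⟩ := e
        rw [Str_blk] at h
        exact Or.inr ⟨rfl, r, Z', rfl, rfl, h.1, h.2⟩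

theorem Str_unique (w : List ℕ) : ∀ (s T T' : List ℕ) (Z Z' : List (List ℕ)),
    Str s T Z → Str s T' Z' → T ++ Z.flatten = w → T' ++ Z'.flatten = w → T = T' ∧ Z = Z' := by
  induction w with
  | nil =>
    intro s T T' Z Z' h h' e e'
    have aux : ∀ T Z, Str s T Z → T ++ Z.flatten = [] → T = [] ∧ Z = [] := by
      intro T Z h e
      simp only [List.append_eq_nil_iff, List.flatten_eq_nil_iff] at e
      refine ⟨e.1, ?_⟩
      cases Z with
      | nil => rfl
      | cons c Z => exact absurd (e.2 c (by simp)) (Str_ne h c (by simp))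
    obtain ⟨rfl, rfl⟩ := aux T Z h e
    obtain ⟨rfl, rfl⟩ := aux T' Z' h' e'
    exact ⟨rfl, rfl⟩
  | cons b w ih =>
    intro s T T' Z Z' h h' e e'
    rcases Str_cases h e with ⟨T1, rfl, e1, hb, h1, _⟩ | ⟨rfl, r, Z1, rfl, e1, hb, h1⟩ <;>
    rcases Str_cases h' e' with ⟨T1', rfl, e1', hb', h1', _⟩ | ⟨rfl, r', Z1', rfl, e1', hb', h1'⟩
    · obtain ⟨rfl, rfl⟩ := ih _ _ _ _ _ h1 h1' e1.symm e1'.symm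
      exact ⟨rfl, rfl⟩
    · obtain ⟨a, ha, hab⟩ := hb
      have := hb' a ha
      omega
    · obtain ⟨a, ha, hab⟩ := hb'
      have := hb a ha
      omega
    · obtain ⟨rfl, rfl⟩ := ih _ _ _ _ _ h1 h1' e1.symm e1'.symm
      exact ⟨rfl, rfl⟩

theorem HH_of_Str (w : List ℕ) : ∀ (s T : List ℕ) (Z : List (List ℕ)),
    Str s T Z → T ++ Z.flatten = w → HH s w := by
  induction w with
  | nil => intros; trivial
  | cons b w ih =>
    intro s T Z h e
    rcases Str_cases h e with ⟨T1, rfl, e1, hb, h1, h2⟩ | ⟨rfl, r, Z1, rfl, e1, hb, h1⟩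
    · refine ⟨?_, ih _ _ _ h1 e1.symm⟩
      intro b' hb' hlt
      exfalso
      cases w with
      | nil => simp at hb'
      | cons b'' w =>
        simp only [List.head?_cons, Option.mem_def, Option.some.injEq] at hb'
        subst hb'
        rcases Str_cases h1 e1.symm with ⟨T2, rfl, _⟩ | ⟨_, _, _, _, _, h3, _⟩
        · have := h2 b'' (by simp); omega
        · have := h3 b (by simp); omega
    · refine ⟨?_, ih _ _ _ h1 e1.symm⟩
      intro b' hb' hlt a ha
      exact (hb a ha).le

theorem Str_of_HH (w : List ℕ) : ∀ (s : List ℕ), w.Nodup → (∀ a ∈ w, a ∉ s) → HH s w →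
    ∃ T Z, T ++ Z.flatten = w ∧ Str s T Z := by
  induction w with
  | nil =>
    intro s _ _ _
    exact ⟨[], [], rfl, by simp [Str, WZ]⟩
  | cons b w ih =>
    intro s hnd hd h
    have hbw : b ∉ w := by simp at hnd; exact hnd.1
    obtain ⟨T, Z, e, hS⟩ := ih (b :: s) (by simp at hnd; exact hnd.2) (by
      intro a ha
      simp only [List.mem_cons, not_or]
      exact ⟨fun h => hbw (h ▸ ha), hd a (by simp [ha])⟩) h.2
    by_cases hb : ∃ a ∈ s, a < b
    · refine ⟨b :: T, Z, by simp [e], ?_⟩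
      have hT : ∀ t ∈ T, t < b := by
        cases T with
        | nil => simp
        | cons t T =>
          have ht : t < b := by
            by_contra hc
            have htw : t ∈ w := by rw [← e]; simp
            have : t ≠ b := fun h => hbw (h ▸ htw)
            obtain ⟨a, ha, hab⟩ := hb
            have := h.1 t (by rw [← e]; simp) (by omega) a ha
            omega
          intro t' ht'
          simp only [List.mem_cons] at ht'
          rcases ht' with rfl | ht'
          · exact ht
          · have := (List.pairwise_cons.1 hS.1).1 t' ht'
            omega
      rw [Str_tail]
      refine ⟨hb, hT, hS, ?_⟩
      intro t ht
      obtain ⟨a, ha, hat⟩ := hS.2.1 t ht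
      simp only [List.mem_cons] at ha
      rcases ha with rfl | ha
      · have := hT t ht; omega
      · exact ⟨a, ha, hat⟩
    · refine ⟨[], (b :: T) :: Z, by simp [e], ?_⟩
      rw [Str_blk]
      refine ⟨?_, hS⟩
      push Not at hb
      intro a ha
      have := hb a ha
      have : a ≠ b := fun h => hd b (by simp) (h ▸ ha)
      omega
abbrev PSt := List (List ℕ) × List ℕ

def VV (n : ℕ) : Set PSt :=
  {q | WZ q.1 ∧ (q.1.flatten ++ q.2).Perm (List.range n) ∧ GG q.1.flatten q.2}

def insB (n : ℕ) (c : List ℕ) : List ℕ := hd c :: n :: c.tail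

def rotB (c : List ℕ) : List ℕ := c.tail ++ [hd c]

def childP (n : ℕ) : PSt × Option (ℕ × ℕ) → PSt
  | ((Bs, ρ), none) => ([n] :: Bs, ρ)
  | ((Bs, ρ), some (j, t)) =>
    if t = j then (Bs.take j, (Bs.drop j).flatten ++ n :: ρ)
    else if Bs.length ≤ j then (Bs.modify t (insB n), ρ)
    else ((Bs.take (j+1)).eraseIdx t, rotB (Bs.getD t []) ++ (Bs.drop (j+1)).flatten ++ n :: ρ)

inductive CR (n : ℕ) : PSt → Option (ℕ × ℕ) → PSt → Prop
  | a (Bs ρ) : CR n (Bs, ρ) none ([n] :: Bs, ρ)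
  | b (X m r Y ρ) : CR n (X ++ (m :: r) :: Y, ρ) (some (X.length + Y.length + 1, X.length))
      (X ++ (m :: n :: r) :: Y, ρ)
  | c (X Z ρ) : CR n (X ++ Z, ρ) (some (X.length, X.length)) (X, Z.flatten ++ n :: ρ)
  | d (X m r Y B Z ρ) : CR n (X ++ (m :: r) :: (Y ++ B :: Z), ρ)
      (some (X.length + Y.length + 1, X.length))
      (X ++ Y ++ [B], (r ++ [m]) ++ Z.flatten ++ n :: ρ)

theorem CR_child {n q ch c} (h : CR n q ch c) : childP n (q, ch) = c := by
  cases h with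
  | a => rfl
  | b X m r Y ρ =>
    rw [childP, if_neg (by omega), if_pos (by simp; omega)]
    have : ∀ X : List (List ℕ), (X ++ (m :: r) :: Y).modify X.length (insB n)
        = X ++ (m :: n :: r) :: Y := by
      intro X
      induction X with
      | nil => simp [insB, hd]
      | cons x X ih => simpa using ih
    rw [this]
  | c => simp [childP]
  | d X m r Y B Z ρ =>
    rw [childP, if_neg (by omega), if_neg (by simp; omega)]
    have e : X ++ (m :: r) :: (Y ++ B :: Z) = (X ++ (m :: r) :: (Y ++ [B])) ++ Z := by simp
    have e1 : (X ++ (m :: r) :: (Y ++ B :: Z)).take (X.length + Y.length + 1 + 1)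
        = X ++ (m :: r) :: (Y ++ [B]) := by
      rw [e, List.take_left']; simp; omega
    have e2 : (X ++ (m :: r) :: (Y ++ B :: Z)).drop (X.length + Y.length + 1 + 1) = Z := by
      rw [e, List.drop_left']; simp; omega
    rw [e1, e2]
    have e3 : (X ++ (m :: r) :: (Y ++ B :: Z)).getD X.length [] = m :: r := by
      simp
    have e4 : (X ++ (m :: r) :: (Y ++ [B])).eraseIdx X.length = X ++ Y ++ [B] := by
      rw [List.eraseIdx_append_of_length_le (le_refl _)]; simp
    rw [e3, e4]
    simp [rotB, hd]

theorem CR_exists {n q ch} (hq : WZ q.1) (h : okc q.1.length ch) : ∃ c, CR n q ch c := by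
  obtain ⟨Bs, ρ⟩ := q
  cases ch with
  | none => exact ⟨_, CR.a _ _⟩
  | some jt =>
    obtain ⟨j, t⟩ := jt
    obtain ⟨h1, h2⟩ := h
    simp only at h1 h2 hq
    by_cases htj : t = j
    · subst htj
      have hl : (Bs.take t).length = t := by simp; omega
      have := CR.c (n := n) (Bs.take t) (Bs.drop t) ρ
      rw [hl, List.take_append_drop] at this
      exact ⟨_, this⟩
    · have ht : t < Bs.length := by omega
      obtain ⟨m, r, hmr, _⟩ := hq.1 Bs[t] (List.getElem_mem ht)
      have e : Bs = Bs.take t ++ (m :: r) :: Bs.drop (t+1) := by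
        rw [← hmr]; simp
      have hl : (Bs.take t).length = t := by simp; omega
      by_cases hj : j = Bs.length
      · have := CR.b (n := n) (Bs.take t) m r (Bs.drop (t+1)) ρ
        rw [← e, hl, show t + (Bs.drop (t+1)).length + 1 = j by simp; omega] at this
        exact ⟨_, this⟩
      · have e2 : Bs.drop (t+1) = (Bs.drop (t+1)).take (j - t - 1) ++
            Bs[j]'(by omega) :: Bs.drop (j+1) := by
          conv_lhs => rw [← List.take_append_drop (j - t - 1) (Bs.drop (t+1))]
          congr 1
          rw [List.drop_drop, show t + 1 + (j - t - 1) = j by omega]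
          simp
        have := CR.d (n := n) (Bs.take t) m r ((Bs.drop (t+1)).take (j - t - 1)) (Bs[j]'(by omega))
          (Bs.drop (j+1)) ρ
        rw [← e2, ← e, hl, show t + ((Bs.drop (t+1)).take (j - t - 1)).length + 1 = j by
          simp; omega] at this
        exact ⟨_, this⟩

theorem CR_ok {n q ch c} (h : CR n q ch c) : okc q.1.length ch := by
  cases h with
  | a => trivial
  | b => simp [okc]; omega
  | c => simp [okc]
  | d => simp [okc]; omega

theorem CR_label {n q ch c} (h : CR n q ch c) : c.1.length = nlc q.1.length ch := by
  cases h with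
  | a => simp [nlc]
  | b => simp [nlc]; omega
  | c => simp [nlc]
  | d => simp [nlc]; omega

theorem VV_lt {n q} (h : q ∈ VV n) : ∀ a ∈ q.1.flatten ++ q.2, a < n := by
  intro a ha
  have := (h.2.1.mem_iff (a := a)).1 ha
  simpa using this

theorem VV_nodup {n q} (h : q ∈ VV n) : (q.1.flatten ++ q.2).Nodup :=
  h.2.1.nodup_iff.2 List.nodup_range

theorem Blk_le {c : List ℕ} (h : Blk c) : ∀ x ∈ c, hd c ≤ x := by
  obtain ⟨m, r, rfl, _, h2⟩ := h
  intro x hx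
  simp only [List.mem_cons] at hx
  rcases hx with rfl | hx
  · simp [hd]
  · exact (h2 x hx).le

theorem Blk_hd {c : List ℕ} (h : Blk c) : hd c ∈ c := by
  obtain ⟨m, r, rfl, _, h2⟩ := h
  simp [hd]

theorem GG_set {s s' y : List ℕ} (h : ∀ a, a ∈ s' → a ∈ s) (g : GG s y) : GG s' y :=
  GG_mono _ _ _ (fun _ _ h1 a ha => h1 a (h a ha)) g

theorem perm_range_succ {l l' : List ℕ} {n : ℕ} (h : l'.Perm (n :: l)) :
    l'.Perm (List.range (n+1)) ↔ l.Perm (List.range n) := by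
  have : (n :: List.range n).Perm (List.range (n+1)) := by
    rw [List.range_succ]
    exact (List.perm_append_singleton _ _).symm
  constructor
  · intro h1
    exact (List.perm_cons n).1 ((h.symm.trans h1).trans this.symm)
  · intro h1
    exact (h.trans (h1.cons n)).trans this

theorem CR_perm {n q ch c} (h : CR n q ch c) :
    (c.1.flatten ++ c.2).Perm (n :: (q.1.flatten ++ q.2)) := by
  cases h <;>
  · rw [List.perm_iff_count]
    intro a
    simp only [List.flatten_cons, List.flatten_append, List.count_append, List.count_cons,
      List.flatten_nil, List.count_nil]
    omega

theorem CR_sound {n q ch c} (h : CR n q ch c) (hq : q ∈ VV n) : c ∈ VV (n+1) := by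
  have hp := (perm_range_succ (CR_perm h)).2 hq.2.1
  have hlt := VV_lt hq
  refine ⟨?_, hp, ?_⟩
  · obtain ⟨⟨w1, w2⟩, _, _⟩ := hq
    cases h with
    | a Bs ρ =>
      refine ⟨?_, ?_⟩
      · simp only [List.mem_cons, forall_eq_or_imp]
        exact ⟨⟨n, [], by simp⟩, w1⟩
      · simp only [List.pairwise_cons]
        refine ⟨?_, w2⟩
        intro d hd'
        have : hd d < n := hlt _ (by
          simp only [List.mem_append, List.mem_flatten]
          exact Or.inl ⟨d, hd', Blk_hd (w1 d hd')⟩)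
        simpa [hd] using this
    | b X m r Y ρ =>
      refine ⟨?_, ?_⟩
      · intro c hc
        simp only [List.mem_append, List.mem_cons] at hc w1
        rcases hc with hc | rfl | hc
        · exact w1 c (Or.inl hc)
        · obtain ⟨m', r', e, h1, h2⟩ := w1 (m :: r) (by simp)
          cases e
          have hl : ∀ x, x = m ∨ x ∈ r → x < n := by
            intro x hx
            apply hlt; simp; tauto
          refine ⟨m, n :: r, rfl, ?_, ?_⟩
          · rw [List.pairwise_cons]
            exact ⟨fun x hx => hl x (Or.inr hx), h1⟩
          · simp only [List.mem_cons, forall_eq_or_imp]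
            exact ⟨hl m (Or.inl rfl), h2⟩
        · exact w1 c (Or.inr (Or.inr hc))
      · simpa [List.pairwise_append, List.pairwise_cons, hd] using w2
    | c X Z ρ =>
      exact ⟨fun c hc => w1 c (by simp [hc]), w2.sublist (List.sublist_append_left _ _)⟩
    | d X m r Y B Z ρ =>
      have hs : (X ++ Y ++ [B]).Sublist (X ++ (m :: r) :: (Y ++ B :: Z)) := by
        rw [List.append_assoc]
        refine List.Sublist.append (List.Sublist.refl _) (List.Sublist.cons _ ?_)
        exact List.Sublist.append (List.Sublist.refl _) (by simp)
      exact ⟨fun c hc => w1 c (hs.subset hc), w2.sublist hs⟩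
  · obtain ⟨⟨w1, w2⟩, _, g⟩ := hq
    cases h with
    | a Bs ρ =>
      refine GG_mono _ _ _ ?_ g
      intro b hb h a ha
      simp only [List.flatten_cons, List.mem_append, List.mem_singleton] at ha
      rcases ha with rfl | ha
      · exact (hlt b (by simp [hb])).le
      · exact h a ha
    | b X m r Y ρ =>
      refine GG_mono _ _ _ ?_ g
      intro b hb h a ha
      simp only [List.flatten_cons, List.flatten_append, List.mem_append, List.mem_cons] at ha h
      by_cases han : a = n
      · subst han; exact (hlt b (by simp [hb])).le
      · apply h; tauto
    | c X Z ρ =>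
      simp only
      rw [GG_split n _ (fun a ha => hlt a (by simp [ha])) _ _
        (fun a ha => hlt a (by simp only [List.mem_append, List.flatten_append] at ha ⊢; tauto))]
      refine ⟨HH_of_Str _ _ [] Z ?_ rfl, ?_⟩
      · refine ⟨List.Pairwise.nil, by simp, ⟨fun c hc => w1 c (by simp [hc]),
          w2.sublist (List.sublist_append_right _ _)⟩, ?_⟩
        intro c hc a ha
        obtain ⟨d, hd1, hd2⟩ := List.mem_flatten.1 ha
        have h1 := Blk_le (w1 d (by simp [hd1])) a hd2
        have h2 := (List.pairwise_append.1 w2).2.2 d hd1 c hc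
        omega
      · exact GG_set (by intro a ha; simp only [List.mem_append, List.flatten_append] at ha ⊢; tauto) g
    | d X m r Y B Z ρ =>
      simp only
      rw [GG_split n _ (fun a ha => hlt a (by simp [ha])) _ _
        (fun a ha => hlt a (by
          simp only [List.mem_append, List.flatten_append, List.flatten_cons, List.mem_cons,
            List.not_mem_nil, or_false] at ha ⊢
          tauto))]
      obtain ⟨w3, w4, w5⟩ := List.pairwise_append.1 w2
      rw [List.pairwise_cons] at w4
      obtain ⟨w6, w7⟩ := w4
      obtain ⟨w8, w9, w10⟩ := List.pairwise_append.1 w7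
      rw [List.pairwise_cons] at w9
      obtain ⟨m', r', e, h1, h2⟩ := w1 (m :: r) (by simp)
      cases e
      refine ⟨HH_of_Str _ _ (r ++ [m]) Z ?_ (by simp), ?_⟩
      · refine ⟨?_, ?_, ⟨fun c hc => w1 c (by simp [hc]), w9.2⟩, ?_⟩
        · rw [List.pairwise_append]
          refine ⟨h1, by simp, ?_⟩
          intro a ha b hb
          simp only [List.mem_singleton] at hb
          subst hb
          exact h2 a ha
        · intro t ht
          have hB : hd B < m := by simpa [hd] using w6 B (by simp)
          refine ⟨hd B, ?_, ?_⟩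
          · have := Blk_hd (w1 B (by simp))
            simp [this]
          · simp only [List.mem_append, List.mem_singleton] at ht
            rcases ht with ht | rfl
            · exact hB.trans (h2 t ht)
            · exact hB
        · intro c hc a ha
          obtain ⟨d, hd1, hd2⟩ := List.mem_flatten.1 ha
          have hdd : hd c < hd d := by
            simp only [List.mem_append, List.mem_singleton] at hd1
            rcases hd1 with (hd1 | hd1) | rfl
            · exact w5 d hd1 c (by simp [hc])
            · exact w10 d hd1 c (by simp [hc])
            · exact w9.1 c hc
          have h1 := Blk_le (w1 d (by
            simp only [List.mem_append, List.mem_singleton, List.mem_cons] at hd1 ⊢; tauto)) a hd2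
          omega
      · refine GG_set ?_ g
        intro a ha
        simp only [List.mem_append, List.flatten_append, List.flatten_cons, List.mem_cons,
            List.not_mem_nil, or_false, List.flatten_nil] at ha ⊢
        tauto
theorem split_hd (m : ℕ) (P : List (List ℕ)) (h : P.Pairwise (fun c d => hd d < hd c)) :
    ∃ X Y, P = X ++ Y ∧ (∀ c ∈ X, m < hd c) ∧ (∀ c ∈ Y, hd c ≤ m) := by
  induction P with
  | nil => exact ⟨[], [], rfl, by simp, by simp⟩
  | cons c P ih =>
    rw [List.pairwise_cons] at h
    by_cases hc : m < hd c
    · obtain ⟨X, Y, rfl, h1, h2⟩ := ih h.2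
      exact ⟨c :: X, Y, rfl, by simpa using ⟨hc, h1⟩, h2⟩
    · refine ⟨[], c :: P, rfl, by simp, ?_⟩
      intro d hd'
      simp only [List.mem_cons] at hd'
      rcases hd' with rfl | hd'
      · omega
      · have := h.1 d hd'; omega

theorem CR_complete {n c} (hc : c ∈ VV (n+1)) : ∃ q ch, CR n q ch c ∧ q ∈ VV n := by
  have hlt := VV_lt hc
  have hnd := VV_nodup hc
  have hn : n ∈ c.1.flatten ++ c.2 := (hc.2.1.mem_iff).2 (by simp)
  suffices ∃ q ch, CR n q ch c ∧ WZ q.1 ∧ GG q.1.flatten q.2 by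
    obtain ⟨q, ch, h1, h2, h3⟩ := this
    exact ⟨q, ch, h1, h2, (perm_range_succ (CR_perm h1)).1 hc.2.1, h3⟩
  obtain ⟨Bs, ρ⟩ := c
  obtain ⟨⟨w1, w2⟩, _, g⟩ := hc
  simp only at hlt hnd hn w1 w2 g
  rcases List.mem_append.1 hn with hn | hn
  · obtain ⟨C, hC, hnC⟩ := List.mem_flatten.1 hn
    obtain ⟨X, Y, rfl⟩ := List.append_of_mem hC
    obtain ⟨m, r, rfl, h1, h2⟩ := w1 C hC
    obtain ⟨w3, w4, w5⟩ := List.pairwise_append.1 w2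
    rw [List.pairwise_cons] at w4
    by_cases hm : n = m
    · subst hm
      have hr : r = [] := by
        rw [List.eq_nil_iff_forall_not_mem]
        intro a ha
        have := hlt a (by simp [ha])
        have := h2 a ha
        omega
      have hX : X = [] := by
        rw [List.eq_nil_iff_forall_not_mem]
        intro d hd'
        have h3 := w5 d hd' _ (List.mem_cons_self)
        have := hlt (hd d) (by
          have := Blk_hd (w1 d (by simp [hd']))
          simp only [List.mem_append, List.mem_flatten]
          exact Or.inl ⟨d, by simp [hd'], this⟩)
        simp [hd] at h3 this
        omega
      subst hr hX
      refine ⟨_, _, CR.a Y ρ, ⟨fun c hc => w1 c (by simp [hc]), w4.2⟩, ?_⟩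
      exact GG_set (by intro a ha; simp only [List.nil_append, List.flatten_cons, List.mem_append]; tauto) g
    · have hnr : n ∈ r := by
        simp only [List.mem_cons] at hnC; tauto
      obtain ⟨r', rfl⟩ : ∃ r', r = n :: r' := by
        cases r with
        | nil => simp at hnr
        | cons a r' =>
          rw [List.pairwise_cons] at h1
          rcases List.mem_cons.1 hnr with rfl | h
          · exact ⟨_, rfl⟩
          · have := h1.1 n h
            have := hlt a (by simp)
            omega
      rw [List.pairwise_cons] at h1
      refine ⟨_, _, CR.b X m r' Y ρ, ⟨?_, ?_⟩, ?_⟩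
      · intro c hc
        simp only [List.mem_append, List.mem_cons] at hc
        rcases hc with hc | rfl | hc
        · exact w1 c (by simp [hc])
        · exact ⟨m, r', rfl, h1.2, fun x hx => h2 x (by simp [hx])⟩
        · exact w1 c (by simp [hc])
      · simpa [List.pairwise_append, List.pairwise_cons, hd] using w2
      · exact GG_set (by
          intro a ha
          simp only [List.flatten_append, List.flatten_cons, List.mem_append, List.mem_cons] at ha ⊢
          tauto) g
  · obtain ⟨ρ1, ρ2, rfl⟩ := List.append_of_mem hn
    have hx : ∀ a, a ∈ ρ1 ∨ a ∈ ρ2 → a < n := by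
      intro a ha
      have h1 := hlt a (by simp; tauto)
      have h2 : a ≠ n := by
        rintro rfl
        have := (List.nodup_append.1 hnd).2.1
        have := (List.nodup_middle.1 this)
        rw [List.nodup_cons] at this
        exact this.1 (List.mem_append.2 ha)
      omega
    rw [GG_split n _ (fun a ha => hx a (Or.inr ha)) _ _ (fun a ha => hx a (Or.inl ha))] at g
    obtain ⟨g1, g2⟩ := g
    have hnd1 := List.nodup_append.1 hnd
    obtain ⟨T, Z, e, st⟩ := Str_of_HH ρ1 Bs.flatten (List.nodup_append.1 hnd1.2.1).1
      (fun a ha h => hnd1.2.2 a h a (by simp [ha]) rfl) g1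
    obtain ⟨s1, s2, ⟨s3, s4⟩, s5⟩ := st
    have hdm : ∀ c ∈ Bs, hd c ∈ Bs.flatten := fun c hc =>
      List.mem_flatten.2 ⟨c, hc, Blk_hd (w1 c hc)⟩
    rcases List.eq_nil_or_concat T with rfl | ⟨r, m, rfl⟩
    · simp only [List.nil_append] at e
      subst e
      refine ⟨_, _, CR.c Bs Z ρ2, ⟨?_, ?_⟩, ?_⟩
      · intro c hc
        rcases List.mem_append.1 hc with hc | hc
        · exact w1 c hc
        · exact s3 c hc
      · exact List.pairwise_append.2 ⟨w2, s4, fun c hc d hd' => s5 d hd' _ (hdm c hc)⟩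
      · exact GG_set (by
          intro a ha
          simp only [List.flatten_append, List.mem_append] at ha ⊢
          tauto) g2
    · rw [List.concat_eq_append] at *
      subst e
      obtain ⟨a0, ha0, ham⟩ := s2 m (by simp)
      obtain ⟨C0, hC0, haC⟩ := List.mem_flatten.1 ha0
      rcases List.eq_nil_or_concat Bs with rfl | ⟨P, B, rfl⟩
      · simp at hC0
      · rw [List.concat_eq_append] at *
        obtain ⟨p1, p2, p3⟩ := List.pairwise_append.1 w2
        have hBm : hd B < m := by
          have h1 := Blk_le (w1 C0 hC0) a0 haC
          rcases List.mem_append.1 hC0 with h | h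
          · have := p3 C0 h B (by simp); omega
          · simp only [List.mem_singleton] at h; subst h; omega
        obtain ⟨X, Y, rfl, x1, x2⟩ := split_hd m P p1
        rw [List.pairwise_append] at s1
        obtain ⟨q1, q2, q3⟩ := List.pairwise_append.1 p1
        have hYm : ∀ c ∈ Y, hd c < m := by
          intro c hc
          have h1 := x2 c hc
          have h2 : hd c ≠ m := fun h => hnd1.2.2 (hd c) (hdm c (by simp [hc])) m (by simp) h
          omega
        refine ⟨_, _, CR.d X m r Y B Z ρ2, ⟨?_, ?_⟩, ?_⟩
        · intro c hc
          simp only [List.mem_append, List.mem_cons] at hc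
          rcases hc with hc | rfl | hc | rfl | hc
          · exact w1 c (by simp [hc])
          · exact ⟨m, r, rfl, s1.1, fun x hx => s1.2.2 x hx m (by simp)⟩
          · exact w1 c (by simp [hc])
          · exact w1 c (by simp)
          · exact s3 c hc
        · have hm : hd (m :: r) = m := rfl
          have z : ∀ c ∈ X ++ Y ++ [B], ∀ d ∈ Z, hd d < hd c := fun c hc d hd' =>
            s5 d hd' _ (hdm c hc)
          simp only [List.mem_append, List.mem_singleton] at z p3
          simp only [List.pairwise_append, List.pairwise_cons, List.mem_append, List.mem_cons, hm]
          refine ⟨q1, ⟨?_, q2, ⟨?_, s4⟩, ?_⟩, ?_⟩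
          · rintro d (h | rfl | h)
            · exact hYm d h
            · exact hBm
            · exact (z B (by simp) d h).trans hBm
          · intro d h
            exact z B (by simp) d h
          · rintro c h d (rfl | h')
            · exact p3 c (Or.inr h) d rfl
            · exact z c (by simp [h]) d h'
          · rintro c h d (rfl | h' | rfl | h')
            · exact x1 c h
            · exact q3 c h d h'
            · exact p3 c (Or.inl h) d rfl
            · exact z c (by simp [h]) d h'
        · exact GG_set (by
            intro a ha
            simp only [List.mem_append, List.flatten_append, List.flatten_cons, List.mem_cons,
              List.not_mem_nil, or_false, List.flatten_nil] at ha ⊢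
            tauto) g2
theorem split_uniq {α : Type} (p : α → Prop) : ∀ (x x' y y' : List α) (a a' : α),
    (∀ b ∈ x, ¬ p b) → (∀ b ∈ x', ¬ p b) → p a → p a' → x ++ a :: y = x' ++ a' :: y' →
    x = x' ∧ a = a' ∧ y = y'
  | [], [], _, _, _, _, _, _, _, _, e => by simpa using e
  | [], b :: x', _, _, a, _, _, h', h, _, e => by
    simp only [List.nil_append, List.cons_append, List.cons.injEq] at e
    obtain ⟨rfl, _⟩ := e
    exact absurd h (h' a (by simp))
  | b :: x, [], _, _, _, a', h', _, _, h, e => by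
    simp only [List.nil_append, List.cons_append, List.cons.injEq] at e
    obtain ⟨rfl, _⟩ := e
    exact absurd h (h' b (by simp))
  | b :: x, b' :: x', y, y', a, a', h, h', p1, p2, e => by
    simp only [List.cons_append, List.cons.injEq] at e
    obtain ⟨rfl, e⟩ := e
    obtain ⟨rfl, r2⟩ := split_uniq p x x' y y' a a' (fun c hc => h c (by simp [hc]))
      (fun c hc => h' c (by simp [hc])) p1 p2 e
    exact ⟨rfl, r2⟩

theorem Str_d {n : ℕ} {X m r Y B Z} {ρ : List ℕ} (hq : (X ++ (m :: r) :: (Y ++ B :: Z), ρ) ∈ VV n) :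
    Str (X ++ Y ++ [B]).flatten (r ++ [m]) Z ∧ (∀ c ∈ X, m < hd c) ∧ (∀ c ∈ Y, hd c < m) := by
  obtain ⟨⟨w1, w2⟩, _, g⟩ := hq
  obtain ⟨w3, w4, w5⟩ := List.pairwise_append.1 w2
  rw [List.pairwise_cons] at w4
  obtain ⟨w6, w7⟩ := w4
  obtain ⟨w8, w9, w10⟩ := List.pairwise_append.1 w7
  rw [List.pairwise_cons] at w9
  obtain ⟨m', r', e, h1, h2⟩ := w1 (m :: r) (by simp)
  cases e
  refine ⟨?_, fun c hc => w5 c hc (m :: r) (by simp), fun c hc => w6 c (by simp [hc])⟩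
  refine ⟨?_, ?_, ⟨fun c hc => w1 c (by simp [hc]), w9.2⟩, ?_⟩
  · rw [List.pairwise_append]
    refine ⟨h1, by simp, ?_⟩
    intro a ha b hb
    simp only [List.mem_singleton] at hb
    subst hb
    exact h2 a ha
  · intro t ht
    have hB : hd B < m := by simpa [hd] using w6 B (by simp)
    refine ⟨hd B, ?_, ?_⟩
    · have := Blk_hd (w1 B (by simp))
      simp [this]
    · simp only [List.mem_append, List.mem_singleton] at ht
      rcases ht with ht | rfl
      · exact hB.trans (h2 t ht)
      · exact hB
  · intro c hc a ha
    obtain ⟨d, hd1, hd2⟩ := List.mem_flatten.1 ha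
    have hdd : hd c < hd d := by
      simp only [List.mem_append, List.mem_singleton] at hd1
      rcases hd1 with (hd1 | hd1) | rfl
      · exact w5 d hd1 c (by simp [hc])
      · exact w10 d hd1 c (by simp [hc])
      · exact w9.1 c hc
    have h1 := Blk_le (w1 d (by
      simp only [List.mem_append, List.mem_cons] at hd1 ⊢; tauto)) a hd2
    omega

theorem Str_c {n : ℕ} {X Z} {ρ : List ℕ} (hq : (X ++ Z, ρ) ∈ VV n) :
    Str X.flatten [] Z := by
  obtain ⟨⟨w1, w2⟩, _, g⟩ := hq
  refine ⟨List.Pairwise.nil, by simp, ⟨fun c hc => w1 c (by simp [hc]),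
    w2.sublist (List.sublist_append_right _ _)⟩, ?_⟩
  intro c hc a ha
  obtain ⟨d, hd1, hd2⟩ := List.mem_flatten.1 ha
  have h1 := Blk_le (w1 d (by simp [hd1])) a hd2
  have h2 := (List.pairwise_append.1 w2).2.2 d hd1 c hc
  omega

/-- information extracted from a child -/
theorem CR_info {n q ch c} (h : CR n q ch c) (hq : q ∈ VV n) :
    (∃ X C Y ρ, c = (X ++ C :: Y, ρ) ∧ n ∈ C ∧ (∀ b ∈ X, n ∉ b) ∧
      ((C = [n] ∧ X = [] ∧ ch = none ∧ q = (Y, ρ)) ∨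
        (∃ m r, C = m :: n :: r ∧ ch = some (X.length + Y.length + 1, X.length) ∧
          q = (X ++ (m :: r) :: Y, ρ)))) ∨
    (n ∉ c.1.flatten ∧ ∃ T Z ρ, c.2 = (T ++ Z.flatten) ++ n :: ρ ∧ n ∉ T ++ Z.flatten ∧
      Str c.1.flatten T Z ∧ 
      ((T = [] ∧ ch = some (c.1.length, c.1.length) ∧ q = (c.1 ++ Z, ρ)) ∨
       (∃ r m X Y B, T = r ++ [m] ∧ c.1 = X ++ Y ++ [B] ∧ (∀ c ∈ X, m < hd c) ∧
          (∀ c ∈ Y, hd c < m) ∧ ch = some (X.length + Y.length + 1, X.length) ∧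
          q = (X ++ (m :: r) :: (Y ++ B :: Z), ρ)))) := by
  have hlt := VV_lt hq
  have hn : n ∉ q.1.flatten ++ q.2 := fun h => lt_irrefl _ (hlt n h)
  cases h with
  | a Bs ρ =>
    left
    exact ⟨[], [n], Bs, ρ, rfl, by simp, by simp, Or.inl ⟨rfl, rfl, rfl, rfl⟩⟩
  | b X m r Y ρ =>
    left
    refine ⟨X, _, Y, ρ, rfl, by simp, ?_, Or.inr ⟨m, r, rfl, rfl, rfl⟩⟩
    intro b hb hnb
    apply hn
    simp only [List.mem_append, List.mem_flatten]
    exact Or.inl ⟨b, by simp [hb], hnb⟩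
  | c X Z ρ =>
    right
    simp only [List.flatten_append, List.mem_append] at hn
    exact ⟨by tauto, [], Z, ρ, by simp, by simp only [List.nil_append]; tauto, Str_c hq, 
      Or.inl ⟨rfl, rfl, rfl⟩⟩
  | d X m r Y B Z ρ =>
    right
    obtain ⟨h1, h2, h3⟩ := Str_d hq
    simp only [List.flatten_append, List.flatten_cons, List.mem_append, List.mem_cons] at hn
    refine ⟨?_, r ++ [m], Z, ρ, by simp, ?_, h1, Or.inr ⟨r, m, X, Y, B, rfl, rfl, h2, h3, rfl, rfl⟩⟩
    · simp only [List.flatten_append, List.flatten_cons, List.mem_append, List.flatten_nil,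
        List.not_mem_nil]
      tauto
    · simp only [List.mem_append, List.mem_singleton]
      tauto

theorem filt_eq {m : ℕ} {X Y : List (List ℕ)} (h1 : ∀ c ∈ X, m < hd c) (h2 : ∀ c ∈ Y, hd c < m) :
    (X ++ Y).filter (fun c => decide (m < hd c)) = X := by
  rw [List.filter_append, List.filter_eq_self.2 (by simpa using h1),
    List.filter_eq_nil_iff.2 (by intro a ha; have := h2 a ha; simp; omega)]
  simp

theorem CR_inj {n q ch q' ch' c} (h : CR n q ch c) (h' : CR n q' ch' c) (hq : q ∈ VV n)
    (hq' : q' ∈ VV n) : q = q' ∧ ch = ch' := by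
  have key : ∀ {X C Y ρ}, c = (X ++ C :: Y, ρ) → n ∈ C → n ∉ c.1.flatten → False := by
    rintro X C Y ρ rfl h1 h2
    apply h2
    simp [h1]
  rcases CR_info h hq with ⟨X, C, Y, ρ, e, i1, i2, i3⟩ | ⟨i0, T, Z, ρ, e, i1, i2, i3⟩ <;>
  rcases CR_info h' hq' with ⟨X', C', Y', ρ', e', j1, j2, j3⟩ | ⟨j0, T', Z', ρ', e', j1, j2, j3⟩
  · rw [e] at e'
    obtain ⟨e1, rfl⟩ := Prod.mk.inj e'
    obtain ⟨rfl, rfl, rfl⟩ := split_uniq (fun b => n ∈ b) X X' Y Y' C C' i2 j2 i1 j1 e1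
    rcases i3 with ⟨rfl, rfl, rfl, rfl⟩ | ⟨m, r, rfl, rfl, rfl⟩ <;>
    rcases j3 with ⟨k1, k2, rfl, rfl⟩ | ⟨m', r', k1, rfl, rfl⟩
    · exact ⟨rfl, rfl⟩
    · simp at k1
    · simp at k1
    · cases k1; exact ⟨rfl, rfl⟩
  · exact (key e i1 j0).elim
  · exact (key e' j1 i0).elim
  · rw [e] at e'
    obtain ⟨e1, _, rfl⟩ := split_uniq (fun b => b = n) _ _ _ _ _ _
      (fun b hb hbn => i1 (hbn ▸ hb)) (fun b hb hbn => j1 (hbn ▸ hb)) rfl rfl e'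
    obtain ⟨rfl, rfl⟩ := Str_unique _ _ _ _ _ _ i2 j2 rfl e1.symm
    rcases i3 with ⟨rfl, rfl, rfl⟩ | ⟨r, m, X, Y, B, rfl, hc, x1, y1, rfl, rfl⟩ <;>
    rcases j3 with ⟨k1, rfl, rfl⟩ | ⟨r', m', X', Y', B', k1, hc', x2, y2, rfl, rfl⟩
    · exact ⟨rfl, rfl⟩
    · simp at k1
    · simp at k1
    · have := List.append_inj' k1 rfl
      obtain ⟨rfl, hm⟩ := this
      cases hm
      rw [hc] at hc'
      obtain ⟨hxy, hb⟩ := List.append_inj' hc' rfl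
      cases hb
      have hX : X = X' := by rw [← filt_eq x1 y1, hxy, filt_eq x2 y2]
      subst hX
      have := List.append_cancel_left hxy
      subst this
      exact ⟨rfl, rfl⟩

theorem perm_bij (n : ℕ) : Set.BijOn (childP n) {p | p.1 ∈ VV n ∧ okc (p.1.1.length) p.2}
    (VV (n+1)) := by
  refine ⟨?_, ?_, ?_⟩
  · rintro ⟨q, ch⟩ ⟨h1, h2⟩
    obtain ⟨c, hc⟩ := CR_exists (n := n) h1.1 h2
    rw [CR_child hc]
    exact CR_sound hc h1
  · rintro ⟨q, ch⟩ ⟨h1, h2⟩ ⟨q', ch'⟩ ⟨h1', h2'⟩ e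
    obtain ⟨c, hc⟩ := CR_exists (n := n) h1.1 h2
    obtain ⟨c', hc'⟩ := CR_exists (n := n) h1'.1 h2'
    rw [CR_child hc, CR_child hc'] at e
    subst e
    obtain ⟨rfl, rfl⟩ := CR_inj hc hc' h1 h1'
    rfl
  · intro c hc
    obtain ⟨q, ch, h, hq⟩ := CR_complete hc
    exact ⟨(q, ch), ⟨hq, CR_ok h⟩, CR_child h⟩

theorem perm_label (n : ℕ) (p : PSt × Option (ℕ × ℕ)) (h1 : p.1 ∈ VV n)
    (h2 : okc (p.1.1.length) p.2) : (childP n p).1.length = nlc p.1.1.length p.2 := by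
  obtain ⟨c, hc⟩ := CR_exists (n := n) h1.1 h2
  rw [show p = (p.1, p.2) from rfl, CR_child hc]
  exact CR_label hc

theorem VV_zero : VV 0 = {([], [])} := by
  ext ⟨Bs, ρ⟩
  simp only [VV, Set.mem_setOf_eq, Set.mem_singleton_iff, List.range_zero, List.perm_nil,
    List.append_eq_nil_iff, Prod.mk.injEq]
  constructor
  · rintro ⟨⟨w1, _⟩, ⟨h, h'⟩, _⟩
    refine ⟨?_, h'⟩
    rw [List.eq_nil_iff_forall_not_mem]
    intro b hb
    have := Blk_hd (w1 b hb)
    have h3 : hd b ∈ Bs.flatten := List.mem_flatten.2 ⟨b, hb, this⟩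
    rw [h] at h3
    simp at h3
  · rintro ⟨rfl, rfl⟩
    simp [WZ, GG]
theorem word_bij (n : ℕ) : Set.BijOn (fun q : PSt => q.1.flatten ++ n :: q.2) (VV n)
    {l | l.Perm (List.range (n+1)) ∧ GG [] l} := by
  have st : ∀ q ∈ VV n, Str [] [] q.1 := fun q hq => ⟨List.Pairwise.nil, by simp, hq.1, by simp⟩
  refine ⟨?_, ?_, ?_⟩
  · intro q hq
    have hlt := VV_lt hq
    refine ⟨(perm_range_succ List.perm_middle).2 hq.2.1, ?_⟩
    dsimp only
    rw [GG_split n _ (fun a ha => hlt a (by simp [ha])) _ _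
      (fun a ha => hlt a (List.mem_append_left _ ha))]
    exact ⟨HH_of_Str _ _ [] _ (st q hq) rfl, by simpa using hq.2.2⟩
  · intro q hq q' hq' e
    have h1 : ∀ q ∈ VV n, ∀ b ∈ q.1.flatten, ¬ (b = n) := by
      intro q hq b hb
      have := VV_lt hq b (List.mem_append_left _ hb)
      omega
    obtain ⟨e1, _, e2⟩ := split_uniq (fun b => b = n) _ _ _ _ _ _ (h1 q hq) (h1 q' hq') rfl rfl e
    exact Prod.ext (Str_unique _ _ _ _ _ _ (st q hq) (st q' hq') rfl e1.symm).2 e2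
  · rintro l ⟨hp, g⟩
    have hn : n ∈ l := hp.mem_iff.2 (by simp)
    obtain ⟨x, y, rfl⟩ := List.append_of_mem hn
    have hp' := (perm_range_succ (List.perm_middle)).1 hp
    have hlt : ∀ a ∈ x ++ y, a < n := fun a ha => by simpa using hp'.mem_iff.1 ha
    have hnd : (x ++ y).Nodup := hp'.nodup_iff.2 List.nodup_range
    rw [GG_split n _ (fun a ha => hlt a (by simp [ha])) _ _
      (fun a ha => hlt a (by simp [ha]))] at g
    obtain ⟨T, Z, e, s1⟩ := Str_of_HH x [] (List.nodup_append.1 hnd).1 (by simp) g.1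
    have hT : T = [] := by
      rw [List.eq_nil_iff_forall_not_mem]
      intro t ht
      have := s1.2.1 t ht
      simp at this
    subst hT
    simp only [List.nil_append] at e
    subst e
    exact ⟨(Z, y), ⟨s1.2.2.1, hp', by simpa using g.2⟩, rfl⟩

theorem GG_iff (w : List ℕ) : ∀ s, GG s w ↔ ∀ x b b' y, w = x ++ b :: b' :: y → b < b' →
    ((∀ a ∈ s, b ≤ a) ∧ (∀ a ∈ x, b ≤ a)) ∨ ∀ c ∈ y, c ≤ b' := by
  induction w with
  | nil => intro s; simp [GG]
  | cons d w ih =>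
    intro s
    simp only [GG, ih]
    constructor
    · rintro ⟨h1, h2⟩ x b b' y e hb
      cases x with
      | nil =>
        simp only [List.nil_append, List.cons.injEq] at e
        obtain ⟨rfl, rfl⟩ := e
        rcases h1 b' (by simp) hb with h | h
        · left; exact ⟨h, by simp⟩
        · right; exact fun c hc => h c (by simp [hc])
      | cons d' x =>
        simp only [List.cons_append, List.cons.injEq] at e
        obtain ⟨rfl, e⟩ := e
        rcases h2 x b b' y e hb with h | h
        · left
          simp only [List.mem_cons, forall_eq_or_imp] at h ⊢
          tauto
        · exact Or.inr h
    · intro h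
      refine ⟨?_, ?_⟩
      · intro b' hb' hb
        cases w with
        | nil => simp at hb'
        | cons b'' y =>
          simp only [List.head?_cons, Option.mem_some_iff] at hb'
          subst hb'
          rcases h [] d b'' y rfl hb with h | h
          · exact Or.inl h.1
          · right
            simpa using h
      · rintro x b b' y rfl hb
        rcases h (d :: x) b b' y rfl hb with h | h
        · left
          simp only [List.mem_cons, forall_eq_or_imp] at h ⊢
          tauto
        · exact Or.inr h

theorem GG_cont {n : ℕ} (p : Equiv.Perm (Fin n)) :
    GG [] (List.ofFn (fun i => (p i : ℕ))) ↔ ¬ Contains1234 p := by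
  rw [GG_iff]
  constructor
  · rintro h ⟨a, b, b', c, h1, h2, h3, h4, h5, h6⟩
    set w := List.ofFn (fun i => (p i : ℕ)) with hw
    have hl : w.length = n := by simp [hw]
    have hb : (b : ℕ) < w.length := by omega
    have hb' : (b : ℕ) + 1 < w.length := by omega
    have e : w = w.take b ++ w[(b:ℕ)] :: w[(b:ℕ)+1] :: w.drop (b + 2) := by
      rw [List.getElem_cons_drop, List.getElem_cons_drop, List.take_append_drop]
    have g : ∀ i : Fin n, w[(i : ℕ)]'(by omega) = (p i : ℕ) := by intro i; simp [hw]
    have g1 : w[(b:ℕ)+1] = (p b' : ℕ) := by rw [← g b']; congr 1; omega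
    rcases h _ _ _ _ e (by rw [g, g1]; exact h5) with h | h
    · have := h.2 (p a) (by
        rw [← g a, List.mem_take_iff_getElem]
        exact ⟨a, by omega, rfl⟩)
      rw [g] at this
      omega
    · have := h (p c) (by
        rw [← g c, List.mem_drop_iff_getElem]
        exact ⟨c - (b + 2), by omega, by congr 1; omega⟩)
      rw [g1] at this
      omega
  · intro h x b b' y e hb
    by_contra hcon
    simp only [List.not_mem_nil, false_imp_iff, implies_true, true_and, not_or, not_forall,
      not_le] at hcon
    obtain ⟨⟨a, ha, hab⟩, c, hc, hcb⟩ := hcon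
    obtain ⟨i, hi, rfl⟩ := List.getElem_of_mem ha
    obtain ⟨j, hj, rfl⟩ := List.getElem_of_mem hc
    have hl := congrArg List.length e
    simp only [List.length_ofFn, List.length_append, List.length_cons] at hl
    have g : ∀ k (hk : k < n), (p ⟨k, hk⟩ : ℕ) = (x ++ b :: b' :: y)[k]'(by simp; omega) := by
      intro k hk
      rw [List.getElem_of_eq e.symm]
      simp
    apply h
    refine ⟨⟨i, by omega⟩, ⟨x.length, by omega⟩, ⟨x.length + 1, by omega⟩,
      ⟨x.length + 2 + j, by omega⟩, ?_, rfl, ?_, ?_, ?_, ?_⟩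
    · exact hi
    · rw [Fin.mk_lt_mk]; omega
    · rw [Fin.lt_def, g, g]
      simpa [List.getElem_append, hi] using hab
    · rw [Fin.lt_def, g, g]
      simpa [List.getElem_append] using hb
    · rw [Fin.lt_def, g, g]
      have : x.length + 2 + j - x.length = j + 2 := by omega
      have h7 : ¬ (x.length + 2 + j < x.length) := by omega
      simpa [List.getElem_append, this, h7] using hcb

theorem perm_word_bij (n : ℕ) : Set.BijOn
    (fun p : Equiv.Perm (Fin n) => List.ofFn (fun i => (p i : ℕ)))
    {p | ¬ Contains1234 p} {l | l.Perm (List.range n) ∧ GG [] l} := by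
  refine ⟨?_, ?_, ?_⟩
  · intro p hp
    refine ⟨?_, (GG_cont p).2 hp⟩
    rw [List.perm_ext_iff_of_nodup (List.nodup_ofFn.2
      (fun i j h => p.injective (Fin.ext h))) List.nodup_range]
    intro a
    simp only [List.mem_ofFn, List.mem_range, Set.mem_range]
    constructor
    · rintro ⟨i, rfl⟩; exact (p i).2
    · intro ha; exact ⟨p.symm ⟨a, ha⟩, by simp⟩
  · intro p _ p' _ e
    have := List.ofFn_injective e
    ext i
    exact congrFun this i
  · rintro l ⟨hp, g⟩
    have hl : l.length = n := by simpa using hp.length_eq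
    have hnd : l.Nodup := hp.nodup_iff.2 List.nodup_range
    have hlt : ∀ a ∈ l, a < n := fun a ha => by simpa using hp.mem_iff.1 ha
    subst hl
    let f : Fin l.length → Fin l.length := fun i => ⟨l[i], hlt _ (List.getElem_mem _)⟩
    have hf : Function.Injective f := by
      intro i j h
      have : l[i] = l[j] := congrArg Fin.val h
      exact Fin.ext ((List.Nodup.getElem_inj_iff hnd).1 this)
    let p := Equiv.ofBijective f (Finite.injective_iff_bijective.1 hf)
    have e : List.ofFn (fun i => (p i : ℕ)) = l := by
      change List.ofFn (fun i : Fin l.length => l[i]) = l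
      exact List.ofFn_getElem
    refine ⟨p, ?_, e⟩
    apply (GG_cont p).1
    rw [e]; exact g
def Stir (l : List ℕ) : Prop := ∀ a b, [a, b, a].Sublist l → a < b

def plats : List ℕ → List ℕ
  | a :: b :: l => if a = b then a :: plats (b :: l) else plats (b :: l)
  | _ => []

def Clo (l : List ℕ) : Prop := ∀ i ∈ l, l.count i = 2

def Cmp (c : List ℕ) : Prop := (∃ v x, c = v :: (x ++ [v])) ∧ Clo c

theorem Stir.sub {l l' : List ℕ} (h : Stir l) (s : l'.Sublist l) : Stir l' :=
  fun a b h1 => h a b (h1.trans s)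

theorem plats_sub (l : List ℕ) : (plats l).Sublist l := by
  induction l with
  | nil => simp [plats]
  | cons a l ih =>
    cases l with
    | nil => simp [plats]
    | cons b l =>
      rw [plats]
      split_ifs
      · exact ih.cons_cons a
      · exact ih.cons a

theorem plats_append (x y : List ℕ) (h : ∀ a ∈ x, a ∉ y) : plats (x ++ y) = plats x ++ plats y := by
  induction x with
  | nil => simp [plats]
  | cons a x ih =>
    have ih' := ih (fun b hb => h b (by simp [hb]))
    cases x with
    | nil =>
      cases y with
      | nil => simp [plats]
      | cons b y =>
        have : a ≠ b := by
          rintro rfl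
          exact h a (by simp) (by simp)
        simp [plats, this]
    | cons b x =>
      simp only [List.cons_append] at ih' ⊢
      rw [plats, plats, ih']
      split_ifs <;> simp

theorem plats_cons (m : ℕ) (C : List ℕ) (h : m ∉ C) : plats (m :: C) = plats C := by
  have := plats_append [m] C (by simpa using h)
  simpa [plats] using this

theorem plats_mid (m : ℕ) (A B C : List ℕ) (hA : m ∉ A) (hB : m ∉ B) (hC : m ∉ C)
    (hB0 : B ≠ []) (h1 : ∀ a ∈ A, a ∉ B ∧ a ∉ C) (h2 : ∀ a ∈ B, a ∉ C) :
    plats (A ++ (m :: (B ++ [m])) ++ C) = plats (A ++ B ++ C) := by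
  have e : A ++ (m :: (B ++ [m])) ++ C = A ++ (m :: (B ++ m :: C)) := by simp
  rw [e, plats_append, List.append_assoc, plats_append, plats_append B C h2]
  · congr 1
    cases B with
    | nil => exact absurd rfl hB0
    | cons b B =>
      have hmb : m ≠ b := by rintro rfl; simp at hB
      rw [List.cons_append, plats, if_neg hmb, ← List.cons_append, plats_append, plats_cons m C hC]
      intro a ha
      simp only [List.mem_cons, not_or]
      exact ⟨fun h => hB (h ▸ ha), h2 a ha⟩
  · intro a ha
    simp only [List.mem_append, not_or]
    exact h1 a ha
  · intro a ha
    simp only [List.mem_append, List.mem_cons, not_or]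
    exact ⟨fun h => hA (h ▸ ha), (h1 a ha).1, fun h => hA (h ▸ ha), (h1 a ha).2⟩

theorem plats_two (m : ℕ) (C : List ℕ) (hC : m ∉ C) : plats (m :: m :: C) = m :: plats C := by
  rw [plats, if_pos rfl, plats_cons m C hC]

theorem plats_has (M : ℕ) (A C : List ℕ) : M ∈ plats (A ++ M :: M :: C) := by
  induction A with
  | nil => simp [plats]
  | cons a A ih =>
    cases A with
    | nil =>
      simp only [List.cons_append, List.nil_append] at ih ⊢
      rw [plats]
      split_ifs
      · simp [ih]
      · exact ih
    | cons b A =>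
      simp only [List.cons_append] at ih ⊢
      rw [plats]
      split_ifs
      · simp [ih]
      · exact ih

theorem plats_ne {l : List ℕ} (h0 : l ≠ []) (h1 : Clo l) (h2 : Stir l) : plats l ≠ [] := by
  obtain ⟨M, hM, hmax⟩ : ∃ M ∈ l, ∀ a ∈ l, a ≤ M := by
    obtain ⟨M, hM, h⟩ := l.toFinset.exists_max_image id (by simpa using h0)
    exact ⟨M, by simpa using hM, by simpa using h⟩
  obtain ⟨A, R, rfl, hMA⟩ := List.eq_append_cons_of_mem hM
  have hc := h1 M hM
  · rw [List.count_append, List.count_cons_self, List.count_eq_zero.2 hMA] at hc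
    have hMR : M ∈ R := List.count_pos_iff.1 (by omega)
    obtain ⟨B, C, rfl⟩ := List.append_of_mem hMR
    have hB : B = [] := by
      rw [List.eq_nil_iff_forall_not_mem]
      intro b hb
      have a1 : M < b := h2 M b (by
        refine List.Sublist.trans ?_ (List.sublist_append_right _ _)
        refine List.Sublist.cons_cons M ?_
        exact List.Sublist.append (l₁ := [b]) (by simpa using hb) (by simp))
      have := hmax b (by simp [hb])
      omega
    subst hB
    exact List.ne_nil_of_mem (plats_has M A C)

/-- splitting at the second occurrence of the head -/
theorem Clo_split {v : ℕ} {r : List ℕ} (h1 : Clo (v :: r)) (h2 : Stir (v :: r)) :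
    ∃ p s, r = p ++ v :: s ∧ Cmp (v :: (p ++ [v])) ∧ Clo s := by
  have hv := h1 v (by simp)
  rw [List.count_cons_self] at hv
  have hvr : v ∈ r := List.count_pos_iff.1 (by omega)
  obtain ⟨p, s, rfl⟩ := List.append_of_mem hvr
  rw [List.count_append, List.count_cons_self] at hv
  have hvp : v ∉ p := List.count_eq_zero.1 (by omega)
  have hvs : v ∉ s := List.count_eq_zero.1 (by omega)
  have hps : ∀ i ∈ p, i ∉ s := by
    intro i hi his
    have a1 : v < i := h2 v i (by
      refine List.Sublist.cons_cons v ?_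
      exact List.Sublist.append (l₁ := [i]) (by simpa using hi) (by simp))
    have a2 : i < v := h2 i v (by
      refine List.Sublist.cons v ?_
      refine List.Sublist.append (l₁ := [i]) (by simpa using hi) ?_
      refine List.Sublist.cons_cons v ?_
      simpa using his)
    omega
  refine ⟨p, s, rfl, ⟨⟨v, p, rfl⟩, ?_⟩, ?_⟩
  · intro i hi
    by_cases hiv : i = v
    · subst hiv
      have := List.count_eq_zero.2 hvp
      simp [this]
    · have hip : i ∈ p := by
        simp only [List.mem_cons, List.mem_append, List.not_mem_nil, or_false] at hi; tauto
      have h3 := h1 i (by simp [hip])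
      have h4 := List.count_eq_zero.2 (hps i hip)
      simp only [List.count_cons, List.count_append, List.count_nil] at h3 ⊢
      omega
  · intro i hi
    have hiv : i ≠ v := fun h => hvs (h ▸ hi)
    have hip : i ∉ p := fun h => hps i h hi
    have h3 := h1 i (by simp [hi])
    have h4 := List.count_eq_zero.2 hip
    have hiv' : (v == i) = false := by simpa using hiv.symm
    simp only [List.count_cons, List.count_append, hiv', h4] at h3
    simpa using h3

theorem decomp (k : ℕ) : ∀ l : List ℕ, l.length ≤ k → Clo l → Stir l →
    ∃ Cs : List (List ℕ), Cs.flatten = l ∧ ∀ c ∈ Cs, Cmp c := by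
  induction k with
  | zero =>
    intro l hl _ _
    have : l = [] := by simpa using hl
    exact ⟨[], by simp [this], by simp⟩
  | succ k ih =>
    intro l hl h1 h2
    cases l with
    | nil => exact ⟨[], by simp, by simp⟩
    | cons v r =>
      obtain ⟨p, s, rfl, hc, hs⟩ := Clo_split h1 h2
      simp only [List.length_cons, List.length_append] at hl
      obtain ⟨Cs, e, hCs⟩ := ih s (by omega) hs (h2.sub (by
        refine List.Sublist.cons v ?_
        exact (List.sublist_cons_self v s).trans (List.sublist_append_right _ _)))
      refine ⟨(v :: (p ++ [v])) :: Cs, by simp [e], ?_⟩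
      simpa using ⟨hc, hCs⟩

theorem Cmp_notin {v : ℕ} {x : List ℕ} (h : Cmp (v :: (x ++ [v]))) : v ∉ x := by
  have := h.2 v (by simp)
  simp only [List.count_cons_self, List.count_append, List.count_nil] at this
  exact List.count_eq_zero.1 (by omega)

theorem decomp_uniq : ∀ (Cs Cs' : List (List ℕ)), (∀ c ∈ Cs, Cmp c) → (∀ c ∈ Cs', Cmp c) →
    Cs.flatten = Cs'.flatten → Cs = Cs'
  | [], [], _, _, _ => rfl
  | [], c :: Cs', _, h, e => by
    obtain ⟨⟨v, x, rfl⟩, _⟩ := h c (by simp)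
    simp at e
  | c :: Cs, [], h, _, e => by
    obtain ⟨⟨v, x, rfl⟩, _⟩ := h c (by simp)
    simp at e
  | c :: Cs, c' :: Cs', h, h', e => by
    have hc := h c (by simp)
    have hc' := h' c' (by simp)
    obtain ⟨⟨v, x, rfl⟩, _⟩ := id hc
    obtain ⟨⟨v', x', rfl⟩, _⟩ := id hc'
    simp only [List.flatten_cons, List.cons_append, List.append_assoc, List.nil_append,
      List.cons.injEq] at e
    obtain ⟨rfl, e⟩ := e
    have n1 := Cmp_notin hc
    have n2 := Cmp_notin hc'
    obtain ⟨rfl, _, e⟩ := split_uniq (fun b => b = v) _ _ _ _ _ _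
      (fun b hb hbn => n1 (hbn ▸ hb)) (fun b hb hbn => n2 (hbn ▸ hb)) rfl rfl e
    rw [decomp_uniq Cs Cs' (fun d hd' => h d (by simp [hd'])) (fun d hd' => h' d (by simp [hd'])) e]

theorem stir_split {a b : ℕ} {x y : List ℕ} (h : [a, b, a].Sublist (x ++ y))
    (hd : ¬ (a ∈ x ∧ a ∈ y)) : [a, b, a].Sublist x ∨ [a, b, a].Sublist y := by
  obtain ⟨l1, l2, e, h1, h2⟩ := List.sublist_append_iff.1 h
  cases l1 with
  | nil => right; simp only [List.nil_append] at e; rw [e]; exact h2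
  | cons c l1 =>
    rcases List.eq_nil_or_concat l2 with rfl | ⟨l3, d, rfl⟩
    · left; simp only [List.append_nil] at e; rw [e]; exact h1
    · exfalso
      rw [List.concat_eq_append] at *
      have e1 : a = c := by simp at e; exact e.1
      have e2 : a = d := by
        have := congrArg List.getLast? e
        rw [← List.append_assoc, List.getLast?_append] at this
        simpa using this
      subst e1
      apply hd
      refine ⟨h1.subset (by simp), h2.subset (by simp [← e2])⟩
def cnt (N m : ℕ) (l : List ℕ) : Prop := ∀ i, l.count i = if m ≤ i ∧ i ≤ N then 2 else 0

def WW (N m : ℕ) : Set (List (List ℕ)) :=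
  {Cs | (∀ c ∈ Cs, Cmp c) ∧ cnt N m Cs.flatten ∧ Stir Cs.flatten ∧
    (plats Cs.flatten).Pairwise (· < ·)}

def childS (m : ℕ) : List (List ℕ) × Option (ℕ × ℕ) → List (List ℕ)
  | (q, none) => [m, m] :: q
  | (q, some (j, t)) => q.take t ++ (m :: (((q.drop t).take (q.length - j)).flatten ++ [m])) ::
      (q.drop t).drop (q.length - j)

inductive SR (m : ℕ) : List (List ℕ) → Option (ℕ × ℕ) → List (List ℕ) → Prop
  | a (q) : SR m q none ([m, m] :: q)
  | b (X M Y) (h : M ≠ []) : SR m (X ++ M ++ Y) (some (X.length + Y.length, X.length))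
      (X ++ (m :: (M.flatten ++ [m])) :: Y)

theorem SR_child {m q ch c} (h : SR m q ch c) : childS m (q, ch) = c := by
  cases h with
  | a => rfl
  | b X M Y h =>
    rw [childS]
    have : (X ++ M ++ Y).length - (X.length + Y.length) = M.length := by simp; omega
    rw [this]
    simp

theorem SR_exists {m q ch} (hq : q ≠ []) (h : okc (q.length - 1) ch) : ∃ c, SR m q ch c := by
  cases ch with
  | none => exact ⟨_, SR.a _⟩
  | some jt =>
    obtain ⟨j, t⟩ := jt
    obtain ⟨h1, h2⟩ := h
    have hl : 0 < q.length := List.length_pos_iff.2 hq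
    have := SR.b (m := m) (q.take t) ((q.drop t).take (q.length - j)) ((q.drop t).drop (q.length - j))
      (by
        apply List.ne_nil_of_length_pos
        simp only [List.length_take, List.length_drop]; omega)
    rw [List.append_assoc, List.take_append_drop, List.take_append_drop] at this
    rw [show (q.take t).length = t by simp; omega,
      show t + ((q.drop t).drop (q.length - j)).length = j by simp; omega] at this
    exact ⟨_, this⟩

theorem SR_ok {m q ch c} (h : SR m q ch c) : okc (q.length - 1) ch := by
  cases h with
  | a => trivial
  | b X M Y h =>
    have := List.length_pos_iff.2 h
    simp [okc]; omega

theorem SR_label {m q ch c} (h : SR m q ch c) (hq : q ≠ []) :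
    c.length - 1 = nlc (q.length - 1) ch := by
  have hl : 0 < q.length := List.length_pos_iff.2 hq
  cases h with
  | a => simp [nlc]; omega
  | b X M Y h => simp [nlc]

theorem SR_count {m q ch c} (h : SR m q ch c) (i : ℕ) :
    c.flatten.count i = q.flatten.count i + if i = m then 2 else 0 := by
  have e : (if (m == i) = true then 1 else 0) + (if (m == i) = true then 1 else 0) =
    if i = m then 2 else 0 := by
    by_cases him : i = m
    · simp [him]
    · simp [him, Ne.symm him]
  cases h <;>
  · simp only [List.flatten_cons, List.flatten_append, List.count_append, List.count_cons,
      List.count_nil]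
    omega

theorem cnt_step {N m q ch c} (hm : m + 1 ≤ N) (h : SR m q ch c) :
    cnt N m c.flatten ↔ cnt N (m+1) q.flatten := by
  unfold cnt
  refine forall_congr' (fun i => ?_)
  rw [SR_count h]
  split_ifs <;> omega

theorem cnt_clo {N m l} (h : cnt N m l) : Clo l := by
  intro i hi
  have h1 := h i
  have h2 := List.count_pos_iff.2 hi
  split_ifs at h1 <;> omega

theorem cnt_ge {N m l} (h : cnt N m l) : ∀ i ∈ l, m ≤ i := by
  intro i hi
  have h1 := h i
  have h2 := List.count_pos_iff.2 hi
  split_ifs at h1 <;> omega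

/-- closed pieces are disjoint inside a closed word -/
theorem clo_disj {A B : List ℕ} {a : ℕ} (h : A.count a + B.count a ≤ 2) (hA : a ∈ A)
    (h2 : ∀ i ∈ A, 2 ≤ A.count i) : a ∉ B := by
  have := h2 a hA
  exact List.count_eq_zero.1 (by omega)

theorem flat_ge {Cs : List (List ℕ)} (h : ∀ c ∈ Cs, Cmp c) : ∀ i ∈ Cs.flatten, 2 ≤ Cs.flatten.count i := by
  intro i hi
  obtain ⟨c, hc, hic⟩ := List.mem_flatten.1 hi
  obtain ⟨X, Y, rfl⟩ := List.append_of_mem hc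
  have := (h c hc).2 i hic
  simp only [List.flatten_append, List.flatten_cons, List.count_append]
  omega

theorem plats_step {N m q ch c} (h : SR m q ch c) (hq : ∀ c ∈ q, Cmp c) (hc : cnt N (m+1) q.flatten) :
    plats c.flatten = match ch with
      | none => m :: plats q.flatten
      | some _ => plats q.flatten := by
  have hm : m ∉ q.flatten := fun h => by have := cnt_ge hc m h; omega
  cases h with
  | a =>
    simp only [List.flatten_cons, List.cons_append, List.nil_append]
    exact plats_two m _ hm
  | b X M Y h0 =>
    have hcl : ∀ a, X.flatten.count a + M.flatten.count a + Y.flatten.count a ≤ 2 := by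
      intro a
      have := hc a
      simp only [List.flatten_append, List.count_append] at this
      split_ifs at this <;> omega
    simp only [List.mem_append] at hq
    simp only [List.flatten_append, List.mem_append, not_or] at hm
    have hX := flat_ge (fun c hc => hq c (Or.inl (Or.inl hc)))
    have hM := flat_ge (fun c hc => hq c (Or.inl (Or.inr hc)))
    have := plats_mid m X.flatten M.flatten Y.flatten hm.1.1 hm.1.2 hm.2 ?_ ?_ ?_
    · simpa using this
    · intro e
      cases M with
      | nil => exact h0 rfl
      | cons d M =>
        obtain ⟨⟨v, x, rfl⟩, _⟩ := hq d (by simp)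
        simp at e
    · intro a ha
      have := hcl a
      exact ⟨clo_disj (by omega) ha hX, clo_disj (by omega) ha hX⟩
    · intro a ha
      have := hcl a
      exact clo_disj (by omega) ha hM

theorem stir_add {m : ℕ} {A B C : List ℕ} (h : Stir (A ++ B ++ C)) (hm : ∀ a ∈ A ++ B ++ C, m < a)
    (d1 : ∀ a ∈ A, a ∉ B ∧ a ∉ C) (d2 : ∀ a ∈ B, a ∉ C) :
    Stir (A ++ (m :: (B ++ m :: C))) := by
  have hmn : m ∉ A ++ B ++ C := fun h => lt_irrefl _ (hm m h)
  have hmn' := hmn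
  simp only [List.mem_append, not_or] at hmn'
  intro a b hs
  by_cases ha : a = m
  · subst ha
    have hb : b ∈ A ++ (a :: (B ++ a :: C)) := hs.subset (by simp)
    by_cases hb' : b = a
    · subst hb'
      have := hs.count_le b
      simp only [List.count_append, List.count_cons_self, List.count_eq_zero.2 hmn'.1.1,
        List.count_eq_zero.2 hmn'.1.2, List.count_eq_zero.2 hmn'.2, List.count_nil] at this
      omega
    · apply hm
      simp only [List.mem_append, List.mem_cons] at hb ⊢
      tauto
  · by_cases hb : b = m
    · subst hb
      exfalso
      rcases stir_split hs (by
        rintro ⟨h1, h2⟩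
        have := d1 a h1
        simp only [List.mem_append, List.mem_cons] at h2
        tauto) with hs | hs
      · exact hmn'.1.1 (hs.subset (by simp))
      · have hs : [a, b, a].Sublist (B ++ b :: C) := by
          cases hs with
          | cons _ h => exact h
          | cons_cons => exact absurd rfl ha
        rcases stir_split hs (by
          rintro ⟨h1, h2⟩
          have := d2 a h1
          simp only [List.mem_cons] at h2
          tauto) with hs | hs
        · exact hmn'.1.2 (hs.subset (by simp))
        · have hs : [a, b, a].Sublist C := by
            cases hs with
            | cons _ h => exact h
            | cons_cons => exact absurd rfl ha
          exact hmn'.2 (hs.subset (by simp))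
    · apply h
      have := hs.filter (fun x => decide (x ≠ m))
      have f : ∀ l : List ℕ, m ∉ l → l.filter (fun x => decide (x ≠ m)) = l := by
        intro l hl
        rw [List.filter_eq_self]
        intro x hx
        simp only [decide_eq_true_eq]
        rintro rfl
        exact hl hx
      rw [f [a, b, a] (by simp only [List.mem_cons, List.not_mem_nil]; tauto), List.filter_append,
        List.filter_cons_of_neg (by simp), List.filter_append, List.filter_cons_of_neg (by simp),
        f A hmn'.1.1, f B hmn'.1.2, f C hmn'.2] at this
      simpa using this

theorem SR_sound {N m q ch c} (hmN : m + 1 ≤ N) (h : SR m q ch c) (hq : q ∈ WW N (m+1)) :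
    c ∈ WW N m := by
  obtain ⟨h1, h2, h3, h4⟩ := hq
  have hm : ∀ a ∈ q.flatten, m < a := fun a ha => by have := cnt_ge h2 a ha; omega
  refine ⟨?_, (cnt_step hmN h).2 h2, ?_, ?_⟩
  · have hcc := (cnt_step hmN h).2 h2
    cases h with
    | a =>
      simp only [List.mem_cons, forall_eq_or_imp]
      refine ⟨⟨⟨m, [], rfl⟩, ?_⟩, h1⟩
      intro i hi
      have : i = m := by simpa using hi
      simp [this]
    | b X M Y h0 =>
      intro c hc
      simp only [List.mem_append, List.mem_cons] at hc
      rcases hc with hc | rfl | hc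
      · exact h1 c (by simp [hc])
      · refine ⟨⟨m, _, rfl⟩, ?_⟩
        intro i hi
        have e := hcc i
        have hM := flat_ge (fun c hc => h1 c (by simp [hc]) : ∀ c ∈ M, Cmp c)
        simp only [List.flatten_append, List.flatten_cons, List.count_append, List.count_cons,
          List.count_nil] at e ⊢
        have : 2 ≤ M.flatten.count i + ((if (m == i) = true then 1 else 0) +
            (if (m == i) = true then 1 else 0)) := by
          by_cases him : i = m
          · simp [him]
          · have := hM i (by
              simp only [List.mem_cons, List.mem_append, List.not_mem_nil, or_false] at hi
              tauto)
            omega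
        split_ifs at e this ⊢ <;> omega
      · exact h1 c (by simp [hc])
  · cases h with
    | a =>
      simpa using stir_add (m := m) (A := []) (B := []) (C := q.flatten) (by simpa using h3)
        (by simpa only [List.nil_append] using hm) (by simp) (by simp)
    | b X M Y h0 =>
      have hcl : ∀ a, X.flatten.count a + M.flatten.count a + Y.flatten.count a ≤ 2 := by
        intro a
        have := h2 a
        simp only [List.flatten_append, List.count_append] at this
        split_ifs at this <;> omega
      have hX := flat_ge (fun c hc => h1 c (by simp [hc]) : ∀ c ∈ X, Cmp c)
      have hM := flat_ge (fun c hc => h1 c (by simp [hc]) : ∀ c ∈ M, Cmp c)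
      have := stir_add (m := m) (A := X.flatten) (B := M.flatten) (C := Y.flatten)
        (by simpa using h3) (by simpa only [List.flatten_append] using hm) (by
          intro a ha
          have := hcl a
          exact ⟨clo_disj (by omega) ha hX, clo_disj (by omega) ha hX⟩) (by
          intro a ha
          have := hcl a
          exact clo_disj (by omega) ha hM)
      simpa using this
  · rw [plats_step h h1 h2]
    cases h with
    | a =>
      simp only [List.pairwise_cons]
      exact ⟨fun a ha => hm a ((plats_sub _).subset ha), h4⟩
    | b => exact h4

theorem SR_complete {N m c} (hmN : m + 1 ≤ N) (hc : c ∈ WW N m) :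
    ∃ q ch, SR m q ch c ∧ q ∈ WW N (m+1) := by
  obtain ⟨h1, h2, h3, h4⟩ := hc
  suffices ∃ q ch, SR m q ch c ∧ (∀ c ∈ q, Cmp c) ∧ q.flatten.Sublist c.flatten by
    obtain ⟨q, ch, g1, g2, g3⟩ := this
    have g4 := (cnt_step hmN g1).1 h2
    refine ⟨q, ch, g1, g2, g4, h3.sub g3, ?_⟩
    rw [plats_step g1 g2 g4] at h4
    cases ch with
    | none => exact (List.pairwise_cons.1 h4).2
    | some => exact h4
  have hmem : m ∈ c.flatten := List.count_pos_iff.1 (by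
    rw [h2 m, if_pos ⟨le_refl _, by omega⟩]; omega)
  obtain ⟨D, hD, hmD⟩ := List.mem_flatten.1 hmem
  obtain ⟨X, Y, rfl⟩ := List.append_of_mem hD
  have hDc := h1 D hD
  obtain ⟨⟨v, x, rfl⟩, hcl⟩ := id hDc
  have hDs : (v :: (x ++ [v])).Sublist (X ++ (v :: (x ++ [v])) :: Y).flatten := by
    rw [List.flatten_append, List.flatten_cons]
    exact (List.sublist_append_left _ _).trans (List.sublist_append_right _ _)
  have hvm : v = m := by
    by_contra hne
    have hmx : m ∈ x := by
      simp only [List.mem_cons, List.mem_append, List.not_mem_nil, or_false] at hmD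
      rcases hmD with h | h | h
      · exact absurd h.symm hne
      · exact h
      · exact absurd h.symm hne
    have hlt := h3 v m (List.Sublist.trans (by
      refine List.Sublist.cons_cons v ?_
      exact List.Sublist.append (l₁ := [m]) (by simpa using hmx) (by simp)) hDs)
    have := cnt_ge h2 v (hDs.subset (by simp))
    omega
  subst hvm
  have hvx := Cmp_notin hDc
  have hxs : x.Sublist (v :: (x ++ [v])) := (List.sublist_append_left _ _).trans (List.sublist_cons_self _ _)
  have hxc : Clo x := by
    intro i hi
    have e := hcl i (by simp [hi])
    have hiv : v ≠ i := by rintro rfl; exact hvx hi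
    simpa [List.count_cons, hiv] using e
  obtain ⟨M, e, hM⟩ := decomp _ x le_rfl hxc ((h3.sub hDs).sub hxs)
  cases M with
  | nil =>
    simp only [List.flatten_nil] at e
    subst e
    have hX : X = [] := by
      by_contra hX
      have hXn : X.flatten ≠ [] := by
        cases X with
        | nil => exact absurd rfl hX
        | cons d X =>
          obtain ⟨⟨w, y, rfl⟩, _⟩ := h1 d (by simp)
          simp
      have hXg := flat_ge (fun c hc => h1 c (by simp [hc]) : ∀ c ∈ X, Cmp c)
      have hcl2 : ∀ a, X.flatten.count a + ([v, v] ++ Y.flatten).count a ≤ 2 := by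
        intro a
        have := h2 a
        simp only [List.flatten_append, List.flatten_cons, List.count_append, List.nil_append] at this ⊢
        split_ifs at this <;> omega
      have hXc : Clo X.flatten := by
        intro i hi
        have := hXg i hi
        have := hcl2 i
        omega
      have hXs : X.flatten.Sublist (X ++ (v :: ([] ++ [v])) :: Y).flatten := by
        rw [List.flatten_append]; exact List.sublist_append_left _ _
      have hp := plats_ne hXn hXc (h3.sub hXs)
      obtain ⟨p, hp⟩ := List.exists_mem_of_ne_nil _ hp
      have hpX := (plats_sub _).subset hp
      have hpv := cnt_ge h2 p (hXs.subset hpX)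
      rw [List.flatten_append, plats_append, List.pairwise_append] at h4
      · have := h4.2.2 p hp v (by
          rw [List.flatten_cons]
          exact plats_has v [] _)
        omega
      · intro a ha
        exact clo_disj (by simpa using hcl2 a) ha hXg
    subst hX
    exact ⟨Y, none, SR.a Y, fun c hc => h1 c (by simp [hc]), by
      rw [List.nil_append, List.flatten_cons]; exact List.sublist_append_right _ _⟩
  | cons d M =>
    subst e
    refine ⟨_, _, SR.b X (d :: M) Y (by simp), ?_, ?_⟩
    · intro c hc
      simp only [List.mem_append] at hc
      rcases hc with (hc | hc) | hc
      · exact h1 c (by simp [hc])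
      · exact hM c hc
      · exact h1 c (by simp [hc])
    · simp only [List.flatten_append, List.append_assoc]
      refine List.Sublist.append (List.Sublist.refl _) ?_
      rw [List.flatten_cons (l := _ :: _)]
      exact List.Sublist.append hxs (List.Sublist.refl _)

theorem SR_info {N m q ch c} (h : SR m q ch c) (hq : q ∈ WW N (m+1)) :
    ∃ X x Y, c = X ++ (m :: (x ++ [m])) :: Y ∧ (∀ b ∈ X, m ∉ b) ∧
    ((x = [] ∧ X = [] ∧ ch = none ∧ q = Y) ∨
      (x ≠ [] ∧ ∃ M, M.flatten = x ∧ (∀ c ∈ M, Cmp c) ∧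
        ch = some (X.length + Y.length, X.length) ∧ q = X ++ M ++ Y)) := by
  obtain ⟨h1, h2, h3, h4⟩ := hq
  cases h with
  | a => exact ⟨[], [], q, rfl, by simp, Or.inl ⟨rfl, rfl, rfl, rfl⟩⟩
  | b X M Y h0 =>
    refine ⟨X, _, Y, rfl, ?_, Or.inr ⟨?_, M, rfl, fun c hc => h1 c (by simp [hc]), rfl, rfl⟩⟩
    · intro b hb hmb
      have := cnt_ge h2 m (List.mem_flatten.2 ⟨b, by simp [hb], hmb⟩)
      omega
    · cases M with
      | nil => exact absurd rfl h0
      | cons d M =>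
        obtain ⟨⟨v, x, rfl⟩, _⟩ := h1 d (by simp)
        simp

theorem SR_inj {N m q ch q' ch' c} (h : SR m q ch c) (h' : SR m q' ch' c) (hq : q ∈ WW N (m+1))
    (hq' : q' ∈ WW N (m+1)) : q = q' ∧ ch = ch' := by
  obtain ⟨X, x, Y, rfl, i1, i2⟩ := SR_info h hq
  obtain ⟨X', x', Y', e, j1, j2⟩ := SR_info h' hq'
  obtain ⟨rfl, e, rfl⟩ := split_uniq (fun b => m ∈ b) _ _ _ _ _ _ i1 j1 (by simp) (by simp) e
  have e : x = x' := by simpa using e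
  subst e
  rcases i2 with ⟨rfl, rfl, rfl, rfl⟩ | ⟨g1, M, rfl, g2, rfl, rfl⟩ <;>
  rcases j2 with ⟨k1, k2, rfl, rfl⟩ | ⟨k1, M', k2, k3, rfl, rfl⟩
  · exact ⟨rfl, rfl⟩
  · exact absurd rfl k1
  · exact absurd k1 g1
  · obtain rfl := decomp_uniq _ _ k3 g2 k2
    exact ⟨rfl, rfl⟩

theorem WW_ne {N m q} (hm : m ≤ N) (hq : q ∈ WW N m) : q ≠ [] := by
  rintro rfl
  have := hq.2.1 m
  simp [hm] at this

theorem stir_bij {N m : ℕ} (hm : m + 1 ≤ N) :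
    Set.BijOn (childS m) {p | p.1 ∈ WW N (m+1) ∧ okc (p.1.length - 1) p.2} (WW N m) := by
  refine ⟨?_, ?_, ?_⟩
  · rintro ⟨q, ch⟩ ⟨h1, h2⟩
    obtain ⟨c, hc⟩ := SR_exists (m := m) (WW_ne hm h1) h2
    rw [SR_child hc]
    exact SR_sound hm hc h1
  · rintro ⟨q, ch⟩ ⟨h1, h2⟩ ⟨q', ch'⟩ ⟨h1', h2'⟩ e
    obtain ⟨c, hc⟩ := SR_exists (m := m) (WW_ne hm h1) h2
    obtain ⟨c', hc'⟩ := SR_exists (m := m) (WW_ne hm h1') h2'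
    rw [SR_child hc, SR_child hc'] at e
    subst e
    obtain ⟨rfl, rfl⟩ := SR_inj hc hc' h1 h1'
    rfl
  · intro c hc
    obtain ⟨q, ch, h, hq⟩ := SR_complete hm hc
    exact ⟨(q, ch), ⟨hq, SR_ok h⟩, SR_child h⟩

theorem stir_label {N m : ℕ} (hm : m + 1 ≤ N) (p : List (List ℕ) × Option (ℕ × ℕ))
    (h1 : p.1 ∈ WW N (m+1)) (h2 : okc (p.1.length - 1) p.2) :
    (childS m p).length - 1 = nlc (p.1.length - 1) p.2 := by
  obtain ⟨c, hc⟩ := SR_exists (m := m) (WW_ne hm h1) h2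
  rw [show p = (p.1, p.2) from rfl, SR_child hc]
  exact SR_label hc (WW_ne hm h1)

theorem WW_base (N : ℕ) : WW N N = {[[N, N]]} := by
  have hC : ∀ c ∈ [[N, N]], Cmp c := by
    simp only [List.mem_singleton, forall_eq]
    refine ⟨⟨N, [], rfl⟩, ?_⟩
    intro i hi
    have : i = N := by simpa using hi
    simp [this]
  have hcnt : ∀ i, [N, N].count i = if N ≤ i ∧ i ≤ N then 2 else 0 := by
    intro i
    by_cases h : i = N
    · simp [h]
    · rw [if_neg (by omega)]
      simp [List.count_cons, Ne.symm h]
  ext Cs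
  rw [Set.mem_singleton_iff]
  constructor
  · rintro ⟨h1, h2, h3, h4⟩
    apply decomp_uniq _ _ h1 hC
    have : Cs.flatten.Perm (List.replicate 2 N) := by
      rw [List.perm_iff_count]
      intro a
      rw [h2 a]
      exact (hcnt a).symm
    rw [List.perm_replicate.1 this]
    rfl
  · rintro rfl
    refine ⟨hC, hcnt, ?_, by simp [plats]⟩
    intro a b h
    have := h.length_le
    simp at this
theorem Stir_iff (l : List ℕ) : Stir l ↔ ∀ a b c : Fin l.length, a < b → b < c →
    l.get a = l.get c → l.get a < l.get b := by
  constructor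
  · intro h a b c h1 h2 e
    apply h
    have h3 := List.map_getElem_sublist (l := l) (is := [a, b, c]) (by
      simp [h1, h2, h1.trans h2])
    simp only [List.get_eq_getElem] at e ⊢
    simp only [List.map_cons, List.map_nil, Fin.getElem_fin] at h3
    rw [← e] at h3
    exact h3
  · intro h a b hs
    obtain ⟨is, e, hp⟩ := List.sublist_eq_map_getElem hs
    match is, e, hp with
    | [i, j, k], e, hp =>
      simp only [List.map_cons, List.map_nil, Fin.getElem_fin, List.cons.injEq, and_true] at e
      simp only [List.pairwise_cons, List.mem_cons, forall_eq_or_imp] at hp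
      have := h i j k hp.1.1 hp.2.1.1 (by simp only [List.get_eq_getElem]; rw [← e.1, ← e.2.2])
      simp only [List.get_eq_getElem] at this
      rw [← e.1, ← e.2.1] at this
      exact this
    | [], e, _ => simp at e
    | [_], e, _ => simp at e
    | [_, _], e, _ => simp at e
    | _ :: _ :: _ :: _ :: _, e, _ => simp at e

theorem plats_mem (x : ℕ) (l : List ℕ) : x ∈ plats l ↔ ∃ j, j + 1 < l.length ∧
    l.getD j 0 = l.getD (j+1) 0 ∧ l.getD j 0 = x := by
  induction l with
  | nil => simp [plats]
  | cons a l ih =>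
    cases l with
    | nil => simp [plats]
    | cons b l =>
      have key : (∃ j, j + 1 < (a :: b :: l).length ∧
          (a :: b :: l).getD j 0 = (a :: b :: l).getD (j+1) 0 ∧ (a :: b :: l).getD j 0 = x) ↔
          ((a = b ∧ a = x) ∨ x ∈ plats (b :: l)) := by
        rw [ih]
        constructor
        · rintro ⟨j, h1, h2, h3⟩
          cases j with
          | zero => left; simpa using And.intro h2 h3
          | succ j =>
            right
            exact ⟨j, by simpa using h1, by simpa using h2, by simpa using h3⟩
        · rintro (⟨rfl, rfl⟩ | ⟨j, h1, h2, h3⟩)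
          · exact ⟨0, by simp, by simp, by simp⟩
          · exact ⟨j + 1, by simpa using h1, by simpa using h2, by simpa using h3⟩
      rw [key, plats]
      split_ifs with h
      · simp [h, eq_comm]
      · simp [h]

theorem plats_iff (l : List ℕ) : (plats l).Pairwise (· < ·) ↔ HasIncPlateaus l := by
  induction l with
  | nil => simp [plats, HasIncPlateaus]
  | cons a l ih =>
    cases l with
    | nil => simp [plats, HasIncPlateaus]
    | cons b l =>
      have key : HasIncPlateaus (a :: b :: l) ↔
          ((a = b → ∀ x ∈ plats (b :: l), a < x) ∧ HasIncPlateaus (b :: l)) := by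
        constructor
        · intro h
          refine ⟨?_, ?_⟩
          · intro hab x hx
            obtain ⟨j, h1, h2, rfl⟩ := (plats_mem x _).1 hx
            have := h 0 (j+1) (by omega) (by simpa using h1) (by simpa using hab) (by simpa using h2)
            simpa using this
          · intro i j hij hj h1 h2
            have := h (i+1) (j+1) (by omega) (by simpa using hj) (by simpa using h1)
              (by simpa using h2)
            simpa using this
        · rintro ⟨g1, g2⟩ i j hij hj h1 h2
          cases j with
          | zero => omega
          | succ j =>
            cases i with
            | zero =>
              have := g1 (by simpa using h1) ((b :: l).getD j 0) ((plats_mem _ _).2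
                ⟨j, by simpa using hj, by simpa using h2, rfl⟩)
              simpa using this
            | succ i =>
              have := g2 i j (by omega) (by simpa using hj) (by simpa using h1) (by simpa using h2)
              simpa using this
      rw [key, ← ih, plats]
      split_ifs with h
      · simp [h]
      · simp [h]

theorem flat_bij (N : ℕ) : Set.BijOn List.flatten (WW N 1)
    {l | IsStirlingPerm N l ∧ HasIncPlateaus l} := by
  refine ⟨?_, ?_, ?_⟩
  · rintro Cs ⟨h1, h2, h3, h4⟩
    exact ⟨⟨h2, (Stir_iff _).1 h3⟩, (plats_iff _).1 h4⟩
  · rintro Cs ⟨h1, _⟩ Cs' ⟨h1', _⟩ e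
    exact decomp_uniq _ _ h1 h1' e
  · rintro l ⟨⟨h2, h3⟩, h4⟩
    have h3' := (Stir_iff _).2 h3
    obtain ⟨Cs, rfl, h⟩ := decomp _ l le_rfl (cnt_clo (N := N) (m := 1) h2) h3'
    exact ⟨Cs, ⟨h, h2, h3', (plats_iff _).2 h4⟩, rfl⟩

theorem stmt12 (n : ℕ) (hn : 1 ≤ n) :
    Nat.card {p : Equiv.Perm (Fin n) // ¬ Contains1234 p}
      = Nat.card {l : List ℕ // IsStirlingPerm n l ∧ HasIncPlateaus l} := by
  obtain ⟨f, hf, _⟩ := tree_bij (n - 1) VV (fun k => WW n (n - k)) (fun q => q.1.length)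
    (fun q => q.length - 1) childP (fun k => childS (n - (k + 1)))
    (by
      refine ⟨fun _ => [[n, n]], ?_, ?_⟩
      · rw [VV_zero, Nat.sub_zero, WW_base]
        simp
      · intro x hx
        rw [VV_zero, Set.mem_singleton_iff] at hx
        subst hx
        simp)
    (fun k _ => perm_bij k)
    (fun k hk => by
      have := stir_bij (N := n) (m := n - (k+1)) (by omega)
      rw [show n - (k + 1) + 1 = n - k by omega] at this
      exact this)
    (fun k _ p h1 h2 => perm_label k p h1 h2)
    (fun k hk p h1 h2 => by
      refine stir_label (N := n) (m := n - (k+1)) (by omega) p ?_ h2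
      rw [show n - (k + 1) + 1 = n - k by omega]
      exact h1)
    (n - 1) le_rfl
  have e1 := Nat.card_congr (perm_word_bij n).equiv
  have hw := word_bij (n - 1)
  rw [show n - 1 + 1 = n by omega] at hw
  have e2 := Nat.card_congr hw.equiv
  have e3 := Nat.card_congr hf.equiv
  have hfl := flat_bij n
  rw [show 1 = n - (n - 1) by omega] at hfl
  have e4 := Nat.card_congr hfl.equiv
  exact e1.trans (e2.symm.trans (e3.trans e4))
end

section
/- Let u(n,i,j,k) be the number of permutations of {1,...,n} having i short LRMin segments, j long LRMin segments, and k free ascents. Then for n ≥ 2, i ≥ 1, j ≥ 0, k ≥ 0 with i + j ≥ 1, i + 2j ≤ n, and k ≤ n - i - j, the recurrence u(n,i,j,k) = u(n-1,i-1,j,k) + (j+k)·u(n-1,i,j,k) + (i+1)·u(n-1,i+1,j-1,k) + (n-i-j-k)·u(n-1,i,j,k-1) holds, with initial condition u(1,1,0,0) = 1. -/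
/-- The entry `p b` is a left-to-right minimum: every earlier entry is larger. -/
def IsLRMin {n : ℕ} (p : Equiv.Perm (Fin n)) (b : Fin n) : Prop :=
  ∀ a : Fin n, a < b → p b < p a

/-- Position `b` starts a short LRMin segment (a segment of length 1): `p b` is
a left-to-right minimum and the next position, if any, is again a
left-to-right minimum. -/
def StartsShortSegment {n : ℕ} (p : Equiv.Perm (Fin n)) (b : Fin n) : Prop :=
  IsLRMin p b ∧ ∀ b' : Fin n, (b' : ℕ) = (b : ℕ) + 1 → IsLRMin p b'

/-- Position `b` starts a long LRMin segment (length at least 2): `p b` is a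
left-to-right minimum and the next position exists and is not one. -/
def StartsLongSegment {n : ℕ} (p : Equiv.Perm (Fin n)) (b : Fin n) : Prop :=
  IsLRMin p b ∧ ∃ b' : Fin n, (b' : ℕ) = (b : ℕ) + 1 ∧ ¬ IsLRMin p b'

/-- Position `b` is the initiator of a free ascent: `p b < p (b+1)` and `p b`
is not a left-to-right minimum. -/
def IsFreeAscentAt {n : ℕ} (p : Equiv.Perm (Fin n)) (b : Fin n) : Prop :=
  ¬ IsLRMin p b ∧ ∃ b' : Fin n, (b' : ℕ) = (b : ℕ) + 1 ∧ p b < p b'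

/-- The number of short LRMin segments of `p`. -/
noncomputable def shortCount (n : ℕ) (p : Equiv.Perm (Fin n)) : ℕ :=
  Nat.card {b : Fin n // StartsShortSegment p b}

/-- The number of long LRMin segments of `p`. -/
noncomputable def longCount (n : ℕ) (p : Equiv.Perm (Fin n)) : ℕ :=
  Nat.card {b : Fin n // StartsLongSegment p b}

/-- The number of free ascents of `p`. -/
noncomputable def freeAscentCount (n : ℕ) (p : Equiv.Perm (Fin n)) : ℕ :=
  Nat.card {b : Fin n // IsFreeAscentAt p b}

/-- `segCount n i j k` is the number of permutations of `{1,...,n}` with `i`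
short LRMin segments, `j` long LRMin segments, and `k` free ascents. -/
noncomputable def segCount (n i j k : ℕ) : ℕ :=
  Nat.card {p : Equiv.Perm (Fin n) //
    shortCount n p = i ∧ longCount n p = j ∧ freeAscentCount n p = k}

/-- Insert the new maximum at position `a`. -/
def insMax {m : ℕ} (a : Fin (m+1)) (q : Equiv.Perm (Fin m)) : Equiv.Perm (Fin (m+1)) :=
  ((finSuccEquiv' a).trans (Equiv.optionCongr q)).trans (finSuccEquiv' (Fin.last m)).symm

lemma insMax_self {m : ℕ} (a : Fin (m+1)) (q : Equiv.Perm (Fin m)) :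
    insMax a q a = Fin.last m := by
  simp [insMax]

lemma insMax_succAbove {m : ℕ} (a : Fin (m+1)) (q : Equiv.Perm (Fin m)) (x : Fin m) :
    insMax a q (a.succAbove x) = (q x).castSucc := by
  simp [insMax]

lemma insMax_bij (m : ℕ) :
    Function.Bijective (fun t : Fin (m+1) × Equiv.Perm (Fin m) => insMax t.1 t.2) := by
  rw [Fintype.bijective_iff_injective_and_card]
  constructor
  · rintro ⟨a, q⟩ ⟨a', q'⟩ h
    simp only at h
    have ha : a = a' := by
      apply (insMax a q).injective
      rw [insMax_self, h, insMax_self]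
    subst ha
    have : q = q' := by
      ext x
      have := congrArg (fun p => (p (a.succAbove x)).val) h
      simpa [insMax_succAbove] using this
    rw [this]
  · simp [Fintype.card_perm, Nat.factorial_succ]

lemma isLRMin_ins_self {m : ℕ} (a : Fin (m+1)) (q : Equiv.Perm (Fin m)) :
    IsLRMin (insMax a q) a ↔ a = 0 := by
  constructor
  · intro h
    by_contra h0
    have := h 0 (Fin.pos_of_ne_zero h0)
    rw [insMax_self] at this
    exact absurd this (not_lt.mpr (Fin.le_last _))
  · rintro rfl b hb
    exact absurd hb (Fin.not_lt_zero b)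

lemma isLRMin_ins {m : ℕ} (a : Fin (m+1)) (q : Equiv.Perm (Fin m)) (x : Fin m) :
    IsLRMin (insMax a q) (a.succAbove x) ↔ IsLRMin q x := by
  constructor
  · intro h y hy
    have := h (a.succAbove y) (Fin.succAbove_lt_succAbove_iff.mpr hy)
    simpa [insMax_succAbove] using this
  · intro h b hb
    rcases Fin.eq_self_or_eq_succAbove a b with rfl | ⟨y, rfl⟩
    · rw [insMax_self, insMax_succAbove]
      exact Fin.castSucc_lt_last _
    · rw [insMax_succAbove, insMax_succAbove]
      exact h y (Fin.succAbove_lt_succAbove_iff.mp hb)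

lemma next_self {m : ℕ} (a : Fin (m+1)) (x : Fin m) :
    (a : ℕ) = (a.succAbove x : ℕ) + 1 ↔ a = x.succ := by
  simp only [Fin.succAbove, Fin.ext_iff, Fin.lt_def]
  split_ifs <;> simp at * <;> omega

lemma next_of {m : ℕ} (a : Fin (m+1)) (x y : Fin m) :
    (a.succAbove y : ℕ) = (a.succAbove x : ℕ) + 1 ↔ a ≠ x.succ ∧ (y : ℕ) = x + 1 := by
  simp only [Fin.succAbove, Fin.ext_iff, Fin.lt_def, ne_eq]
  split_ifs <;> simp at * <;> omega

lemma short_self {m : ℕ} (a : Fin (m+1)) (q : Equiv.Perm (Fin m)) :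
    StartsShortSegment (insMax a q) a ↔ a = 0 := by
  unfold StartsShortSegment
  rw [isLRMin_ins_self]
  refine ⟨fun h => h.1, fun h => ⟨h, fun b hb => ?_⟩⟩
  subst h
  rcases Fin.eq_self_or_eq_succAbove 0 b with rfl | ⟨y, rfl⟩
  · simp at hb
  · rw [isLRMin_ins]
    intro z hz
    simp at hb
    have := Fin.lt_def.mp hz
    simp [hb] at this

lemma short_ins {m : ℕ} (a : Fin (m+1)) (q : Equiv.Perm (Fin m)) (x : Fin m) :
    StartsShortSegment (insMax a q) (a.succAbove x) ↔ StartsShortSegment q x ∧ a ≠ x.succ := by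
  unfold StartsShortSegment
  rw [isLRMin_ins, Fin.forall_iff_succAbove a, isLRMin_ins_self, next_self]
  simp only [isLRMin_ins, next_of]
  have : a = x.succ → a ≠ 0 := by rintro rfl; exact Fin.succ_ne_zero x
  tauto

lemma long_self {m : ℕ} (a : Fin (m+1)) (q : Equiv.Perm (Fin m)) :
    ¬ StartsLongSegment (insMax a q) a := by
  rintro ⟨h, b, hb, hb'⟩
  have h0 := (isLRMin_ins_self a q).1 h
  exact hb' (((short_self a q).2 h0).2 b hb)

lemma long_ins {m : ℕ} (a : Fin (m+1)) (q : Equiv.Perm (Fin m)) (x : Fin m) :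
    StartsLongSegment (insMax a q) (a.succAbove x) ↔
      StartsLongSegment q x ∨ (a = x.succ ∧ StartsShortSegment q x) := by
  have h := short_ins a q x
  have h1 := isLRMin_ins a q x
  have key : ∀ {n : ℕ} (p : Equiv.Perm (Fin n)) b, StartsLongSegment p b ↔
      IsLRMin p b ∧ ¬ StartsShortSegment p b := by
    intro n p b
    unfold StartsLongSegment StartsShortSegment
    constructor
    · rintro ⟨h, b', hb, hn⟩
      exact ⟨h, fun h' => hn (h'.2 b' hb)⟩
    · rintro ⟨h, h'⟩
      refine ⟨h, ?_⟩
      by_contra hc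
      push Not at hc
      exact h' ⟨h, hc⟩
  have h2 : StartsShortSegment q x → IsLRMin q x := fun h => h.1
  rw [key, key]
  tauto

lemma free_self {m : ℕ} (a : Fin (m+1)) (q : Equiv.Perm (Fin m)) :
    ¬ IsFreeAscentAt (insMax a q) a := by
  rintro ⟨_, b, _, hb⟩
  rw [insMax_self] at hb
  exact absurd hb (not_lt.mpr (Fin.le_last _))

lemma free_ins {m : ℕ} (a : Fin (m+1)) (q : Equiv.Perm (Fin m)) (x : Fin m) :
    IsFreeAscentAt (insMax a q) (a.succAbove x) ↔
      IsFreeAscentAt q x ∨ (a = x.succ ∧ ¬ IsLRMin q x) := by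
  unfold IsFreeAscentAt
  rw [isLRMin_ins, Fin.exists_iff_succAbove a, next_self, insMax_self]
  simp only [insMax_succAbove, next_of, Fin.castSucc_lt_castSucc_iff, Fin.castSucc_lt_last]
  by_cases h : a = x.succ <;> simp [h]
  tauto

lemma card_eq_sum {α : Type*} [Fintype α] (P : α → Prop) [DecidablePred P] :
    Nat.card {b : α // P b} = ∑ b, if P b then 1 else 0 := by
  rw [Nat.card_eq_fintype_card, Fintype.card_subtype, Finset.card_filter]

lemma counts_zero {m : ℕ} (q : Equiv.Perm (Fin m)) :
    shortCount (m+1) (insMax 0 q) = shortCount m q + 1 ∧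
    longCount (m+1) (insMax 0 q) = longCount m q ∧
    freeAscentCount (m+1) (insMax 0 q) = freeAscentCount m q := by
  classical
  have h0 : ∀ x : Fin m, (0 : Fin (m+1)) ≠ x.succ := fun x => (Fin.succ_ne_zero x).symm
  unfold shortCount longCount freeAscentCount
  simp only [card_eq_sum]
  refine ⟨?_, ?_, ?_⟩
  · rw [Fin.sum_univ_succAbove _ 0, if_pos ((short_self 0 q).2 rfl), add_comm]
    congr 1
    exact Finset.sum_congr rfl fun x _ => if_congr (by rw [short_ins]; have := h0 x; tauto) rfl rfl
  · rw [Fin.sum_univ_succAbove _ 0, if_neg (long_self 0 q), zero_add]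
    exact Finset.sum_congr rfl fun x _ => if_congr (by rw [long_ins]; have := h0 x; tauto) rfl rfl
  · rw [Fin.sum_univ_succAbove _ 0, if_neg (free_self 0 q), zero_add]
    exact Finset.sum_congr rfl fun x _ => if_congr (by rw [free_ins]; have := h0 x; tauto) rfl rfl

open Classical in
lemma counts_succ {m : ℕ} (q : Equiv.Perm (Fin m)) (y : Fin m) :
    shortCount (m+1) (insMax y.succ q) + (if StartsShortSegment q y then 1 else 0)
      = shortCount m q ∧
    longCount (m+1) (insMax y.succ q) =
      longCount m q + (if StartsShortSegment q y then 1 else 0) ∧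
    freeAscentCount (m+1) (insMax y.succ q) = freeAscentCount m q +
      (if ¬ IsLRMin q y ∧ ¬ IsFreeAscentAt q y then 1 else 0) := by
  have e : ∀ (P : Fin m → Prop) [DecidablePred P], (if P y then 1 else 0) =
      ∑ x, if x = y ∧ P x then 1 else 0 := by
    intro P _
    rw [Finset.sum_eq_single y] <;> simp +contextual
  unfold shortCount longCount freeAscentCount
  simp only [card_eq_sum]
  refine ⟨?_, ?_, ?_⟩
  · rw [Fin.sum_univ_succAbove _ y.succ,
      if_neg (fun h => Fin.succ_ne_zero y ((short_self _ q).1 h)), zero_add,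
      e (fun x => StartsShortSegment q x), ← Finset.sum_add_distrib]
    refine Finset.sum_congr rfl fun x _ => ?_
    simp only [short_ins, ne_eq, Fin.succ_inj]
    by_cases h : x = y <;> by_cases h' : StartsShortSegment q x <;> simp [h, h', eq_comm (a := y)]
  · rw [Fin.sum_univ_succAbove _ y.succ, if_neg (long_self _ q), zero_add,
      e (fun x => StartsShortSegment q x), ← Finset.sum_add_distrib]
    refine Finset.sum_congr rfl fun x _ => ?_
    simp only [long_ins, Fin.succ_inj]
    have : StartsShortSegment q x → ¬ StartsLongSegment q x := by
      rintro ⟨_, h⟩ ⟨_, b, hb, hn⟩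
      exact hn (h b hb)
    simp only [eq_comm (a := y)]
    by_cases h : x = y <;> by_cases h' : StartsShortSegment q x <;>
      by_cases h'' : StartsLongSegment q x <;> simp_all
  · rw [Fin.sum_univ_succAbove _ y.succ, if_neg (free_self _ q), zero_add,
      e (fun x => ¬ IsLRMin q x ∧ ¬ IsFreeAscentAt q x), ← Finset.sum_add_distrib]
    refine Finset.sum_congr rfl fun x _ => ?_
    simp only [free_ins, Fin.succ_inj]
    have : IsFreeAscentAt q x → ¬ IsLRMin q x := fun h => h.1
    simp only [eq_comm (a := y)]
    by_cases h : x = y <;> by_cases h' : IsLRMin q x <;>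
      by_cases h'' : IsFreeAscentAt q x <;> simp_all

open Classical in
/-- Indicator of the statistics triple. -/
noncomputable def ind (m i j k : ℕ) (q : Equiv.Perm (Fin m)) : ℕ :=
  if shortCount m q = i ∧ longCount m q = j ∧ freeAscentCount m q = k then 1 else 0

lemma segCount_eq (m i j k : ℕ) : segCount m i j k = ∑ q, ind m i j k q := by
  classical
  unfold segCount ind
  rw [card_eq_sum]

lemma ind_zero {m : ℕ} (q : Equiv.Perm (Fin m)) (i j k : ℕ) (hi : 1 ≤ i) :
    ind (m+1) i j k (insMax 0 q) = ind m (i-1) j k q := by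
  obtain ⟨h1, h2, h3⟩ := counts_zero q
  unfold ind
  rw [h1, h2, h3]
  congr 1
  apply propext
  omega

open Classical in
lemma ind_succ {m : ℕ} (q : Equiv.Perm (Fin m)) (i j k : ℕ) (y : Fin m) :
    ind (m+1) i j k (insMax y.succ q) =
      (if StartsShortSegment q y then 1 else 0) *
        (if j = 0 then 0 else ind m (i+1) (j-1) k q)
      + ((if StartsLongSegment q y then 1 else 0) + (if IsFreeAscentAt q y then 1 else 0))
        * ind m i j k q
      + (if ¬ IsLRMin q y ∧ ¬ IsFreeAscentAt q y then 1 else 0) *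
        (if k = 0 then 0 else ind m i j (k-1) q) := by
  obtain ⟨h1, h2, h3⟩ := counts_succ q y
  have hs : StartsShortSegment q y → IsLRMin q y := fun h => h.1
  have hl : StartsLongSegment q y → IsLRMin q y := fun h => h.1
  have hf : IsFreeAscentAt q y → ¬ IsLRMin q y := fun h => h.1
  have hsl : StartsShortSegment q y → ¬ StartsLongSegment q y := by
    rintro ⟨_, h⟩ ⟨_, b, hb, hn⟩
    exact hn (h b hb)
  have hor : IsLRMin q y → StartsShortSegment q y ∨ StartsLongSegment q y := by
    intro h
    by_cases hh : ∀ b' : Fin m, (b' : ℕ) = (y : ℕ) + 1 → IsLRMin q b'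
    · exact Or.inl ⟨h, hh⟩
    · push Not at hh
      exact Or.inr ⟨h, hh⟩
  unfold ind
  by_cases c1 : IsLRMin q y
  · have c2 : ¬ IsFreeAscentAt q y := fun h => hf h c1
    by_cases c3 : StartsShortSegment q y
    · have c4 := hsl c3
      simp only [c1, c2, c3, c4, if_true, if_false, not_true, false_and] at *
      split_ifs <;> omega
    · have c4 := (hor c1).resolve_left c3
      simp only [c1, c2, c3, c4, if_true, if_false, not_true, false_and] at *
      split_ifs <;> omega
  · have c3 : ¬ StartsShortSegment q y := fun h => c1 (hs h)
    have c4 : ¬ StartsLongSegment q y := fun h => c1 (hl h)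
    by_cases c2 : IsFreeAscentAt q y
    · simp only [c1, c2, c3, c4, if_true, if_false, not_true, not_false_eq_true, and_false] at *
      split_ifs <;> omega
    · simp only [c1, c2, c3, c4, if_true, if_false, not_false_eq_true, and_true] at *
      split_ifs <;> omega

open Classical in
lemma total {m : ℕ} (q : Equiv.Perm (Fin m)) :
    shortCount m q + longCount m q + freeAscentCount m q +
      (∑ y, if ¬ IsLRMin q y ∧ ¬ IsFreeAscentAt q y then 1 else 0) = m := by
  unfold shortCount longCount freeAscentCount
  simp only [card_eq_sum]
  rw [← Finset.sum_add_distrib, ← Finset.sum_add_distrib, ← Finset.sum_add_distrib]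
  trans ∑ y : Fin m, 1
  · refine Finset.sum_congr rfl fun y _ => ?_
    have hs : StartsShortSegment q y → IsLRMin q y := fun h => h.1
    have hl : StartsLongSegment q y → IsLRMin q y := fun h => h.1
    have hf : IsFreeAscentAt q y → ¬ IsLRMin q y := fun h => h.1
    have hsl : StartsShortSegment q y → ¬ StartsLongSegment q y := by
      rintro ⟨_, h⟩ ⟨_, b, hb, hn⟩
      exact hn (h b hb)
    have hor : IsLRMin q y → StartsShortSegment q y ∨ StartsLongSegment q y := by
      intro h
      by_cases hh : ∀ b' : Fin m, (b' : ℕ) = (y : ℕ) + 1 → IsLRMin q b'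
      · exact Or.inl ⟨h, hh⟩
      · push Not at hh
        exact Or.inr ⟨h, hh⟩
    by_cases c1 : IsLRMin q y <;> by_cases c2 : IsFreeAscentAt q y <;>
      by_cases c3 : StartsShortSegment q y <;> by_cases c4 : StartsLongSegment q y <;> simp_all
  · simp

lemma ind_sum {m : ℕ} (q : Equiv.Perm (Fin m)) (i j k : ℕ) :
    ∑ y : Fin m, ind (m+1) i j k (insMax y.succ q) =
      (i+1) * (if j = 0 then 0 else ind m (i+1) (j-1) k q)
      + (j + k) * ind m i j k q
      + (m + 1 - i - j - k) * (if k = 0 then 0 else ind m i j (k-1) q) := by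
  classical
  have ht := total q
  simp only [ind_succ]
  rw [Finset.sum_add_distrib, Finset.sum_add_distrib, ← Finset.sum_mul, ← Finset.sum_mul,
    ← Finset.sum_mul, Finset.sum_add_distrib, ← card_eq_sum, ← card_eq_sum, ← card_eq_sum]
  change shortCount m q * _ + (longCount m q + freeAscentCount m q) * _ + _ = _
  generalize (∑ y, if ¬ IsLRMin q y ∧ ¬ IsFreeAscentAt q y then 1 else 0) = R at *
  unfold ind
  congr 1
  · congr 1
    · split_ifs <;> simp
      omega
    · split_ifs <;> simp
      omega
  · split_ifs <;> simp
    omega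

lemma rec_main (m i j k : ℕ) (hi : 1 ≤ i) :
    segCount (m+1) i j k
        = segCount m (i - 1) j k
          + (j + k) * segCount m i j k
          + (i + 1) * (if j = 0 then 0 else segCount m (i + 1) (j - 1) k)
          + (m + 1 - i - j - k) *
              (if k = 0 then 0 else segCount m i j (k - 1)) := by
  have h1 : (if j = 0 then 0 else segCount m (i + 1) (j - 1) k)
      = ∑ q, (if j = 0 then 0 else ind m (i+1) (j-1) k q) := by
    split_ifs <;> simp [segCount_eq]
  have h2 : (if k = 0 then 0 else segCount m i j (k - 1))
      = ∑ q, (if k = 0 then 0 else ind m i j (k-1) q) := by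
    split_ifs <;> simp [segCount_eq]
  rw [h1, h2]
  simp only [segCount_eq]
  rw [← (insMax_bij m).sum_comp, Fintype.sum_prod_type_right, Finset.mul_sum, Finset.mul_sum,
    Finset.mul_sum, ← Finset.sum_add_distrib, ← Finset.sum_add_distrib,
    ← Finset.sum_add_distrib]
  refine Finset.sum_congr rfl fun q _ => ?_
  rw [Fin.sum_univ_succ, ind_sum, ind_zero q i j k hi]
  ring

lemma seg_zero : segCount 0 0 0 0 = 1 := by
  rw [segCount_eq]
  simp [ind, shortCount, longCount, freeAscentCount]





theorem stmt14 :
    segCount 1 1 0 0 = 1 ∧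
    ∀ n i j k : ℕ, 2 ≤ n → 1 ≤ i → 1 ≤ i + j → i + 2 * j ≤ n →
      k ≤ n - i - j →
      segCount n i j k
        = segCount (n - 1) (i - 1) j k
          + (j + k) * segCount (n - 1) i j k
          + (i + 1) * (if j = 0 then 0 else segCount (n - 1) (i + 1) (j - 1) k)
          + (n - i - j - k) *
              (if k = 0 then 0 else segCount (n - 1) i j (k - 1)) := by
  constructor
  · rw [rec_main 0 1 0 0 le_rfl]
    simp [seg_zero]
  · intro n i j k hn hi _ _ _
    obtain ⟨m, rfl⟩ : ∃ m, n = m + 1 := ⟨n - 1, by omega⟩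
    exact rec_main m i j k hi
end
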